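/- arXiv:0802.1185 — 2 statements merged into one kernel-verified Lean document; each statement's English description precedes it below -/
import Mathlib

section
/- Let Ω ⊂ ℝ^n be a bounded domain with boundary of class C^{1+ε}, 0 < ε < 1, and let T be an even smooth homogeneous Calderón–Zygmund operator with kernel K. Then for every f ∈ Lip(ε,Ω) and every x ∈ ℝ^n, the maximal singular integral satisfies T*(fχ_Ω)(x) = sup_{δ>0} |∫_{y∈Ω, |y−x|>δ} f(y) K(x−y) dy| ≤ C ‖T‖_CZ ‖f‖_{ε,Ω}, where C depends only on n, ε and Ω. -/
open MeasureTheory Metric Set Filter Topology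
open scoped ENNReal NNReal

noncomputable section

/-- `ℝ^n` with the Euclidean norm. -/
abbrev En (n : ℕ) : Type := EuclideanSpace ℝ (Fin n)

/-- The Hölder norm `‖f‖_{ε,Ω} = sup_Ω |f| + σ_ε(f)`, valued in `ℝ≥0∞`. -/
def holderNorm {X : Type*} [NormedAddCommGroup X] (ε : ℝ) (Ω : Set X) (f : X → ℂ) : ℝ≥0∞ :=
  (⨆ x : Ω, (‖f x.1‖₊ : ℝ≥0∞)) +
    ⨆ p : Ω × Ω, ENNReal.ofReal (‖f p.1.1 - f p.2.1‖ / ‖p.1.1 - p.2.1‖ ^ ε)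

/-- The Calderón–Zygmund constant `‖T‖_CZ = sup_{x≠0}|K(x)||x|^n + sup_{x≠0}|∇K(x)||x|^{n+1}`. -/
def czConst (n : ℕ) (K : En n → ℝ) : ℝ≥0∞ :=
  (⨆ x : {x : En n // x ≠ 0}, ENNReal.ofReal (|K x.1| * ‖x.1‖ ^ n)) +
    ⨆ x : {x : En n // x ≠ 0}, ENNReal.ofReal (‖fderiv ℝ K x.1‖ * ‖x.1‖ ^ (n + 1))

/-- `Ω ⊆ ℝ^n` has boundary of class `C^{1+ε}`: near each boundary point, after a rotation,
`Ω` is the subgraph of a `C^1` function whose gradient is `ε`-Hölder. -/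
def HasC1HolderBoundary (n : ℕ) (ε : ℝ) (Ω : Set (En n)) : Prop :=
  ∃ hn : 0 < n, ∀ a ∈ frontier Ω, ∃ r > 0,
    ∃ R : En n ≃ₗᵢ[ℝ] En n, ∃ φ : (Fin (n - 1) → ℝ) → ℝ,
      ContDiff ℝ 1 φ ∧
      (∃ c : ℝ≥0, HolderOnWith c ε.toNNReal (fderiv ℝ φ) univ) ∧
      Ω ∩ ball a r = {x ∈ ball a r |
        R x ⟨n - 1, Nat.sub_lt hn Nat.one_pos⟩ <
          φ fun i : Fin (n - 1) => R x (Fin.castLE (Nat.sub_le n 1) i)}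


/-! ### Rotation invariant measures on the sphere -/

lemma exists_rot {n : ℕ} {v w : En n} (h : ‖v‖ = ‖w‖) : ∃ R : En n ≃ₗᵢ[ℝ] En n, R v = w :=
  ⟨Submodule.reflection (ℝ ∙ (v - w))ᗮ, Submodule.reflection_sub h⟩

/-- invariance under all linear isometries -/
def RotInv {n : ℕ} (μ : Measure (En n)) : Prop :=
  ∀ R : En n ≃ₗᵢ[ℝ] En n, μ.map R = μ

lemma RotInv.closedBall_eq {n : ℕ} {μ : Measure (En n)} (h : RotInv μ) {v w : En n}
    (hvw : ‖v‖ = ‖w‖) (r : ℝ) : μ (closedBall v r) = μ (closedBall w r) := by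
  obtain ⟨R, hR⟩ := exists_rot hvw
  conv_rhs => rw [← h R]
  rw [Measure.map_apply R.continuous.measurable measurableSet_closedBall]
  congr 1
  rw [← hR, LinearIsometryEquiv.preimage_closedBall]
  simp

lemma RotInv.eq_smul {n : ℕ} {μ ν : Measure (En n)} [IsFiniteMeasure μ] [IsFiniteMeasure ν]
    (hμ : RotInv μ) (hν : RotInv ν) (hac : μ ≪ ν) (hs : ν (sphere (0 : En n) 1)ᶜ = 0) :
    ∃ c : ℝ≥0∞, μ = c • ν := by
  by_cases h0 : ν = 0
  · refine ⟨0, ?_⟩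
    rw [h0] at hac ⊢
    simpa using hac
  have hae := Besicovitch.ae_tendsto_rnDeriv μ ν
  have hs' : ∀ᵐ x ∂ν, x ∈ sphere (0 : En n) 1 := hs
  have : NeZero ν := ⟨h0⟩
  obtain ⟨x0, hx0, hx0s⟩ := (hae.and hs').exists
  refine ⟨μ.rnDeriv ν x0, ?_⟩
  have hconst : μ.rnDeriv ν =ᵐ[ν] fun _ => μ.rnDeriv ν x0 := by
    filter_upwards [hae, hs'] with x hx hxs
    refine tendsto_nhds_unique hx ?_
    have hn : ‖x‖ = ‖x0‖ := by
      rw [mem_sphere_zero_iff_norm] at hxs hx0s; rw [hxs, hx0s]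
    simpa only [hμ.closedBall_eq hn, hν.closedBall_eq hn] using hx0
  have hld : μ.HaveLebesgueDecomposition ν :=
    Measure.haveLebesgueDecomposition_of_finiteMeasure
  have hwd := Measure.withDensity_rnDeriv_eq μ ν hac
  rw [withDensity_congr_ae hconst, withDensity_const] at hwd
  exact hwd.symm

/-- Two rotation invariant measures on the sphere: zero integral transfers. -/
lemma RotInv.integral_eq_zero {n : ℕ} {μ ν : Measure (En n)} [IsFiniteMeasure μ]
    [IsFiniteMeasure ν] (hμ : RotInv μ) (hν : RotInv ν) (hμs : μ (sphere (0 : En n) 1)ᶜ = 0)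
    (hνs : ν (sphere (0 : En n) 1)ᶜ = 0) (hμ0 : μ ≠ 0) (g : En n → ℝ) (hg : ∫ x, g x ∂μ = 0) :
    ∫ x, g x ∂ν = 0 := by
  have hρ : RotInv (μ + ν) := fun R => by
    rw [Measure.map_add _ _ R.continuous.measurable, hμ R, hν R]
  have hρs : (μ + ν) (sphere (0 : En n) 1)ᶜ = 0 := by simp [hμs, hνs]
  obtain ⟨c, hc⟩ := hμ.eq_smul hρ (Measure.AbsolutelyContinuous.rfl.add_right ν) hρs
  obtain ⟨d, hd⟩ := hν.eq_smul hρ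
    (by rw [add_comm]; exact Measure.AbsolutelyContinuous.rfl.add_right μ) hρs
  have hctop : c ≠ ⊤ := by
    rintro rfl
    have h1 : μ univ = ⊤ * (μ + ν) univ := by
      conv_lhs => rw [hc]
      rw [Measure.smul_apply, smul_eq_mul]
    have h2 : (μ + ν) univ ≠ 0 := by
      simpa using fun h => absurd h hμ0
    rw [ENNReal.top_mul h2] at h1
    exact measure_ne_top μ univ h1
  have hc0 : c ≠ 0 := by
    rintro rfl
    exact hμ0 (by rw [hc]; simp)
  rw [hc, integral_smul_measure] at hg
  rw [hd, integral_smul_measure]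
  have : c.toReal ≠ 0 := ENNReal.toReal_ne_zero.2 ⟨hc0, hctop⟩
  rcases smul_eq_zero.1 hg with h | h
  · exact absurd h this
  · rw [h, smul_zero]

lemma rotInv_sphere {n : ℕ} (d : ℝ) : RotInv ((μH[d] : Measure (En n)).restrict (sphere 0 1)) := by
  intro R
  have h := (R.toIsometryEquiv.measurePreserving_hausdorffMeasure d).restrict_preimage
    (s := sphere (0 : En n) 1) isClosed_sphere.measurableSet
  have h2 : R.toIsometryEquiv ⁻¹' sphere (0 : En n) 1 = sphere 0 1 := by
    ext x; simp
  rw [h2] at h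
  exact h.map_eq

lemma normalize_lip {E : Type*} [NormedAddCommGroup E] [NormedSpace ℝ E] :
    LipschitzOnWith 2 (fun v : E => ‖v‖⁻¹ • v) {v | 1 ≤ ‖v‖} := by
  refine LipschitzOnWith.of_dist_le_mul fun v hv w hw => ?_
  simp only [mem_ofPred_eq] at hv hw
  rw [dist_eq_norm, dist_eq_norm]
  have hv0 : 0 < ‖v‖ := by linarith
  have hw0 : 0 < ‖w‖ := by linarith
  have e : ‖v‖⁻¹ • v - ‖w‖⁻¹ • w = ‖v‖⁻¹ • (v - w) + (‖v‖⁻¹ - ‖w‖⁻¹) • w := by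
    rw [smul_sub, sub_smul]; abel
  rw [e]
  refine (norm_add_le _ _).trans ?_
  have h1 : ‖‖v‖⁻¹ • (v - w)‖ ≤ ‖v - w‖ := by
    rw [norm_smul, norm_inv, norm_norm]
    exact mul_le_of_le_one_left (norm_nonneg _) (inv_le_one_of_one_le₀ hv)
  have h2 : ‖(‖v‖⁻¹ - ‖w‖⁻¹) • w‖ ≤ ‖v - w‖ := by
    have : (‖v‖⁻¹ - ‖w‖⁻¹) * ‖w‖ = (‖w‖ - ‖v‖) * ‖v‖⁻¹ := by field_simp
    rw [norm_smul, ← norm_norm w, ← norm_mul, norm_norm w, this, norm_mul, norm_inv, norm_norm]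
    refine (mul_le_of_le_one_right (norm_nonneg _) (inv_le_one_of_one_le₀ hv)).trans ?_
    rw [← norm_neg (v - w), neg_sub]
    exact abs_norm_sub_norm_le _ _
  push_cast; linarith

lemma sphere_finite (m : ℕ) : (μH[(m : ℝ)] : Measure (En (m + 1))) (sphere 0 1) < ⊤ := by
  -- faces
  let F : Fin (m + 1) → ℝ → (Fin m → ℝ) → En (m + 1) := fun i s u =>
    WithLp.toLp 2 (i.insertNth s u)
  have hFlip : ∀ i s, LipschitzWith
      ((Fintype.card (Fin (m+1)) : ℝ≥0) ^ (1 / (2 : ℝ≥0∞)).toReal * 1) (F i s) := by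
    intro i s
    refine (PiLp.lipschitzWith_toLp 2 (fun _ : Fin (m+1) => ℝ)).comp ?_
    refine LipschitzWith.of_dist_le_mul fun u v => ?_
    rw [NNReal.coe_one, one_mul, dist_pi_le_iff dist_nonneg]
    intro j
    refine Fin.succAboveCases i ?_ (fun k => ?_) j
    · simp
    · simpa using dist_le_pi_dist u v k
  have hFn : ∀ i s, |s| = 1 → ∀ u, 1 ≤ ‖F i s u‖ := by
    intro i s hs u
    have := PiLp.norm_apply_le (F i s u) i
    simpa [F, hs] using this
  have hcover : sphere (0 : En (m+1)) 1 ⊆ ⋃ i : Fin (m+1), ⋃ s : Bool,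
      (fun v : En (m+1) => ‖v‖⁻¹ • v) '' (F i (if s then 1 else -1) '' closedBall 0 1) := by
    intro x hx
    rw [mem_sphere_zero_iff_norm] at hx
    obtain ⟨i, -, hi⟩ := Finset.exists_max_image Finset.univ (fun i => |x i|) ⟨0, Finset.mem_univ _⟩
    have hxi : x i ≠ 0 := by
      intro h
      have : x = 0 := by
        ext j
        have := hi j (Finset.mem_univ _)
        rw [h, abs_zero] at this
        simpa using this
      rw [this] at hx; simp at hx
    have hpos : 0 < |x i| := abs_pos.2 hxi
    simp only [mem_iUnion]
    refine ⟨i, decide (0 < x i), _, ⟨fun j => x (i.succAbove j) / |x i|, ?_, rfl⟩, ?_⟩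
    · rw [mem_closedBall_zero_iff, pi_norm_le_iff_of_nonneg zero_le_one]
      intro j
      rw [Real.norm_eq_abs, abs_div, abs_abs]
      exact div_le_one_of_le₀ (hi _ (Finset.mem_univ _)) hpos.le
    · have hF : F i (if decide (0 < x i) = true then 1 else -1)
          (fun j => x (i.succAbove j) / |x i|) = |x i|⁻¹ • x := by
        ext j
        refine Fin.succAboveCases i ?_ (fun k => ?_) j
        · simp only [F, Fin.insertNth_apply_same, PiLp.smul_apply, smul_eq_mul, decide_eq_true_eq]
          split_ifs with h
          · rw [abs_of_pos h]; field_simp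
          · have : x i < 0 := lt_of_le_of_ne (not_lt.1 h) hxi
            rw [abs_of_neg this]; field_simp
        · simp [F, div_eq_inv_mul]
      simp only [hF]
      rw [norm_smul, hx, norm_inv, norm_abs_eq_norm, Real.norm_eq_abs, mul_one, inv_inv, smul_smul,
        mul_inv_cancel₀ hpos.ne', one_smul]
  refine (measure_mono hcover).trans_lt ?_
  refine (measure_iUnion_le _).trans_lt ?_
  rw [tsum_fintype]
  refine ENNReal.sum_lt_top.2 fun i _ => ?_
  refine (measure_iUnion_le _).trans_lt ?_
  rw [tsum_fintype]
  refine ENNReal.sum_lt_top.2 fun s _ => ?_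
  have hlip := normalize_lip (E := En (m+1))
  have hm0 : (0 : ℝ) ≤ m := Nat.cast_nonneg m
  have h1 := (hlip.mono (s := F i (if s then 1 else -1) '' closedBall 0 1) (by
    rintro _ ⟨u, -, rfl⟩
    exact hFn i _ (by split_ifs <;> simp) u)).hausdorffMeasure_image_le hm0
  refine h1.trans_lt (ENNReal.mul_lt_top (ENNReal.rpow_lt_top_of_nonneg hm0 (by simp)) ?_)
  refine ((hFlip i _).hausdorffMeasure_image_le hm0 _).trans_lt
    (ENNReal.mul_lt_top (ENNReal.rpow_lt_top_of_nonneg hm0 (by simp)) ?_)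
  have := hausdorffMeasure_pi_real (ι := Fin m)
  rw [Fintype.card_fin] at this
  rw [this]
  exact (isCompact_closedBall _ _).measure_lt_top

lemma sphere_pos (m : ℕ) : (μH[(m : ℝ)] : Measure (En (m + 1))) (sphere 0 1) ≠ 0 := by
  intro h0
  let P : En (m+1) → (Fin m → ℝ) := fun x j => x j.succ
  have hP : LipschitzWith 1 P := by
    refine LipschitzWith.of_dist_le_mul fun u v => ?_
    rw [NNReal.coe_one, one_mul, dist_pi_le_iff dist_nonneg]
    intro j
    rw [dist_eq_norm, dist_eq_norm]
    exact PiLp.norm_apply_le (u - v) j.succ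
  have hm0 : (0 : ℝ) ≤ m := Nat.cast_nonneg m
  have h1 := hP.hausdorffMeasure_image_le hm0 (sphere 0 1)
  have hpi := hausdorffMeasure_pi_real (ι := Fin m)
  rw [Fintype.card_fin] at hpi
  rw [h0, mul_zero, hpi] at h1
  have hopen : IsOpen {u : Fin m → ℝ | ∑ j, u j ^ 2 < 1} :=
    isOpen_lt (by fun_prop) continuous_const
  have hpos : 0 < volume {u : Fin m → ℝ | ∑ j, u j ^ 2 < 1} :=
    hopen.measure_pos _ ⟨0, by simp⟩
  have hsub : {u : Fin m → ℝ | ∑ j, u j ^ 2 < 1} ⊆ P '' sphere 0 1 := by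
    intro u hu
    simp only [mem_ofPred_eq] at hu
    refine ⟨WithLp.toLp 2 (Fin.cons (√(1 - ∑ j, u j ^ 2)) u), ?_, ?_⟩
    · rw [mem_sphere_zero_iff_norm, EuclideanSpace.norm_eq, Real.sqrt_eq_one, Fin.sum_univ_succ]
      simp [Real.sq_sqrt (sub_nonneg.2 hu.le)]
    · ext j; simp [P]
  exact absurd ((measure_mono hsub).trans h1) (not_le.2 hpos)

/-- Integral of a degree zero homogeneous function against a radial weight vanishes. -/
lemma radial_integral_zero {n : ℕ} (hn : 0 < n) (ω : En n → ℝ)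
    (hom : ∀ t : ℝ, 0 < t → ∀ x, ω (t • x) = ω x)
    (hωc : ContinuousOn ω {(0 : En n)}ᶜ)
    (hz : (∫ ξ in sphere (0 : En n) 1, ω ξ ∂μH[(n : ℝ) - 1]) = 0)
    (w : ℝ → ℝ≥0) (hw : Measurable w)
    (hfin : ∫⁻ x : En n, w ‖x‖ ≠ ⊤) :
    ∫ x : En n, (w ‖x‖ : ℝ) * ω x = 0 := by
  obtain ⟨m, rfl⟩ : ∃ m, n = m + 1 := ⟨n - 1, by omega⟩
  have hd : (((m + 1 : ℕ) : ℝ) - 1) = m := by push_cast; ring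
  rw [hd] at hz
  let N : En (m+1) → En (m+1) := fun v => ‖v‖⁻¹ • v
  have hN : Measurable N := measurable_norm.inv.smul measurable_id
  have hwm : Measurable fun x : En (m+1) => w ‖x‖ := hw.comp measurable_norm
  let τ : Measure (En (m+1)) := volume.withDensity fun x => (w ‖x‖ : ℝ≥0∞)
  have hτfin : IsFiniteMeasure τ := isFiniteMeasure_withDensity hfin
  have hτR : RotInv τ := by
    intro R
    ext s hs
    rw [Measure.map_apply R.continuous.measurable hs, withDensity_apply _ hs,
      withDensity_apply _ (R.continuous.measurable hs)]
    have := (R.measurePreserving.restrict_preimage hs).lintegral_comp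
      (f := fun x => (w ‖x‖ : ℝ≥0∞)) hwm.coe_nnreal_ennreal
    simpa using this
  have hτ0 : τ {0} = 0 := withDensity_absolutelyContinuous _ _ (measure_singleton 0)
  have hνR : RotInv (τ.map N) := by
    intro R
    rw [Measure.map_map R.continuous.measurable hN]
    conv_rhs => rw [← hτR R]
    rw [Measure.map_map hN R.continuous.measurable]
    congr 1
    ext1 x
    simp [N]
  have hνs : (τ.map N) (sphere (0 : En (m+1)) 1)ᶜ = 0 := by
    rw [Measure.map_apply hN isClosed_sphere.measurableSet.compl]
    refine measure_mono_null ?_ hτ0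
    intro x hx
    by_contra h
    have h' : ‖x‖ ≠ 0 := by simpa using h
    apply hx
    simp [N, norm_smul, h']
  have : IsFiniteMeasure ((μH[(m:ℝ)] : Measure (En (m+1))).restrict (sphere 0 1)) :=
    ⟨by rw [Measure.restrict_apply_univ]; exact sphere_finite m⟩
  have key := (rotInv_sphere (n := m+1) (m : ℝ)).integral_eq_zero hνR
    (by rw [Measure.restrict_apply isClosed_sphere.measurableSet.compl]; simp) hνs
    (by rw [Ne, Measure.restrict_eq_zero]; exact sphere_pos m) ω hz
  have hωm : Measurable (({(0 : En (m+1))}ᶜ : Set _).indicator ω) := by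
    have := hωc.measurable_piecewise (g := fun _ => 0) continuousOn_const
      (measurableSet_singleton (0 : En (m+1))).compl
    rwa [show (fun _ : En (m+1) => (0:ℝ)) = 0 from rfl, Set.piecewise_eq_indicator] at this
  have hind : ({(0 : En (m+1))}ᶜ : Set _).indicator ω =ᵐ[τ.map N] ω := by
    have : ∀ᵐ x ∂(τ.map N), x ∈ sphere (0 : En (m+1)) 1 := hνs
    filter_upwards [this] with x hx
    have : x ≠ 0 := by rintro rfl; simp at hx
    simp [this]
  rw [← integral_congr_ae hind, integral_map hN.aemeasurable hωm.aestronglyMeasurable,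
    integral_withDensity_eq_integral_smul hwm] at key
  rw [← key]
  refine integral_congr_ae ?_
  have : ∀ᵐ x : En (m+1), x ≠ 0 := by
    rw [ae_iff]; simp
  filter_upwards [this] with x hx
  have hx' : 0 < ‖x‖⁻¹ := by simpa using hx
  have : N x ≠ 0 := smul_ne_zero hx'.ne' hx
  rw [indicator_of_mem (by simpa using this)]
  simp only [N]
  rw [hom _ hx']
  rfl

/-! ### Volume of slabs and dyadic sums -/

lemma volume_slab {m : ℕ} (ν : En (m + 1)) (hν : ‖ν‖ = 1) (h ρ : ℝ) (hh : 0 ≤ h) (hρ : 0 ≤ ρ) :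
    volume {z : En (m + 1) | |inner ℝ ν z| ≤ h ∧ ‖z‖ ≤ ρ} ≤
      ENNReal.ofReal (2 * h * (2 * ρ) ^ m) := by
  obtain ⟨R, hR⟩ := exists_rot (v := ν) (w := EuclideanSpace.single (0 : Fin (m+1)) (1 : ℝ))
    (by simp [hν])
  let b : Fin (m+1) → ℝ := Fin.cons h (fun _ => ρ)
  let Q : Set (Fin (m+1) → ℝ) := Set.pi univ fun j => Icc (-(b j)) (b j)
  have hQm : MeasurableSet Q := MeasurableSet.univ_pi fun _ => measurableSet_Icc
  have hsub : {z : En (m + 1) | |inner ℝ ν z| ≤ h ∧ ‖z‖ ≤ ρ} ⊆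
      R ⁻¹' ((WithLp.ofLp : En (m+1) → (Fin (m+1) → ℝ)) ⁻¹' Q) := by
    rintro z ⟨hz1, hz2⟩
    simp only [mem_preimage, Q, Set.mem_pi, mem_univ, true_imp_iff, mem_Icc, ← abs_le]
    intro j
    refine Fin.cases ?_ (fun k => ?_) j
    · have : inner ℝ ν z = (R z) 0 := by
        rw [← R.inner_map_map, hR, EuclideanSpace.inner_single_left]; simp
      rw [this] at hz1
      simpa [b] using hz1
    · have := PiLp.norm_apply_le (R z) k.succ
      rw [R.norm_map, Real.norm_eq_abs] at this
      simpa [b] using this.trans hz2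
  refine (measure_mono hsub).trans ?_
  rw [R.measurePreserving.measure_preimage
      (((PiLp.volume_preserving_ofLp (Fin (m+1))).measurable hQm).nullMeasurableSet),
    (PiLp.volume_preserving_ofLp (Fin (m+1))).measure_preimage hQm.nullMeasurableSet,
    volume_pi_pi, Fin.prod_univ_succ]
  simp only [Real.volume_Icc, b, Fin.cons_zero, Fin.cons_succ, Finset.prod_const, Finset.card_univ,
    Fintype.card_fin, sub_neg_eq_add, ← two_mul]
  rw [ENNReal.ofReal_mul (p := 2 * h) (by positivity), ENNReal.ofReal_pow (by positivity)]

lemma dyadic_bound {n : ℕ} {E : Set (En n)} (hE : MeasurableSet E) (g : En n → ℝ≥0∞)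
    (ρ M V : ℕ → ℝ) (A q : ℝ) (hA : 0 ≤ A) (hq0 : 0 ≤ q) (hq1 : q < 1) (hM0 : ∀ k, 0 ≤ M k)
    (hcov : ∀ z ∈ E, ∃ k, ρ k ≤ ‖z‖ ∧ ‖z‖ ≤ 2 * ρ k)
    (hg : ∀ k, ∀ z ∈ E, ρ k ≤ ‖z‖ → ‖z‖ ≤ 2 * ρ k → g z ≤ ENNReal.ofReal (M k))
    (hV : ∀ k, volume (E ∩ {z | ρ k ≤ ‖z‖ ∧ ‖z‖ ≤ 2 * ρ k}) ≤ ENNReal.ofReal (V k))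
    (hMV : ∀ k, M k * V k ≤ A * q ^ k) :
    ∫⁻ z in E, g z ≤ ENNReal.ofReal (A / (1 - q)) := by
  have hsub : E ⊆ ⋃ k, (E ∩ {z | ρ k ≤ ‖z‖ ∧ ‖z‖ ≤ 2 * ρ k}) := by
    intro z hz
    obtain ⟨k, hk⟩ := hcov z hz
    exact mem_iUnion.2 ⟨k, hz, hk⟩
  have hmeas : ∀ k, MeasurableSet (E ∩ {z | ρ k ≤ ‖z‖ ∧ ‖z‖ ≤ 2 * ρ k}) := fun k =>
    hE.inter ((measurableSet_le measurable_const measurable_norm).inter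
      (measurableSet_le measurable_norm measurable_const))
  calc ∫⁻ z in E, g z ≤ ∫⁻ z in ⋃ k, (E ∩ {z | ρ k ≤ ‖z‖ ∧ ‖z‖ ≤ 2 * ρ k}), g z :=
        lintegral_mono_set hsub
    _ ≤ ∑' k, ∫⁻ z in (E ∩ {z | ρ k ≤ ‖z‖ ∧ ‖z‖ ≤ 2 * ρ k}), g z := lintegral_iUnion_le _ _
    _ ≤ ∑' k, ENNReal.ofReal (A * q ^ k) := by
        refine ENNReal.tsum_le_tsum fun k => ?_
        calc ∫⁻ z in (E ∩ {z | ρ k ≤ ‖z‖ ∧ ‖z‖ ≤ 2 * ρ k}), g z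
            ≤ ∫⁻ z in (E ∩ {z | ρ k ≤ ‖z‖ ∧ ‖z‖ ≤ 2 * ρ k}), ENNReal.ofReal (M k) :=
              setLIntegral_mono' (hmeas k) fun z hz => hg k z hz.1 hz.2.1 hz.2.2
          _ = ENNReal.ofReal (M k) * volume (E ∩ {z | ρ k ≤ ‖z‖ ∧ ‖z‖ ≤ 2 * ρ k}) := by
              rw [setLIntegral_const]
          _ ≤ ENNReal.ofReal (M k) * ENNReal.ofReal (V k) := by gcongr; exact hV k
          _ = ENNReal.ofReal (M k * V k) := (ENNReal.ofReal_mul (hM0 k)).symm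
          _ ≤ _ := ENNReal.ofReal_le_ofReal (hMV k)
    _ = ENNReal.ofReal (A / (1 - q)) := by
        rw [← ENNReal.ofReal_tsum_of_nonneg (fun k => by positivity)
          ((summable_geometric_of_lt_one hq0 hq1).mul_left A), tsum_mul_left,
          tsum_geometric_of_lt_one hq0 hq1, div_eq_mul_inv]

lemma exists_dyadic_up {a t : ℝ} (ha : 0 < a) (hat : a ≤ t) :
    ∃ k : ℕ, a * 2 ^ k ≤ t ∧ t ≤ 2 * (a * 2 ^ k) := by
  obtain ⟨k, hk1, hk2⟩ := exists_nat_pow_near (one_le_div ha |>.2 hat) (one_lt_two)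
  refine ⟨k, ?_, ?_⟩
  · rw [le_div_iff₀ ha] at hk1; linarith
  · rw [div_lt_iff₀ ha, pow_succ] at hk2; linarith

lemma exists_dyadic_down {a t : ℝ} (ht : 0 < t) (hat : t ≤ a) :
    ∃ k : ℕ, a / 2 * (1/2) ^ k ≤ t ∧ t ≤ 2 * (a / 2 * (1/2) ^ k) := by
  have ha : 0 < a := ht.trans_le hat
  obtain ⟨k, hk1, hk2⟩ := exists_nat_pow_near_of_lt_one (div_pos ht ha) (div_le_one ha |>.2 hat)
    (show (0 : ℝ) < 1/2 by norm_num) (by norm_num)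
  refine ⟨k, ?_, ?_⟩
  · rw [lt_div_iff₀ ha, pow_succ] at hk1; linarith
  · rw [div_le_iff₀ ha] at hk2; linarith

lemma bound_E1 {m : ℕ} (ν : En (m + 1)) (hν : ‖ν‖ = 1) (ρ0 : ℝ) (hρ : 0 < ρ0) :
    ∫⁻ z in {z : En (m+1) | |inner ℝ ν z| ≤ 2 * ρ0 ∧ ρ0 ≤ ‖z‖},
      ENNReal.ofReal ((‖z‖ ^ (m+1))⁻¹) ≤ ENNReal.ofReal (4 ^ (m+1) / (1 - 1/2)) := by
  refine dyadic_bound (ρ := fun k => ρ0 * 2 ^ k) (M := fun k => ((ρ0 * 2 ^ k) ^ (m+1))⁻¹)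
    (V := fun k => 2 * (2 * ρ0) * (2 * (2 * (ρ0 * 2 ^ k))) ^ m) ?_ _ _ _ (by positivity)
    (by norm_num) (by norm_num) (fun k => by positivity) ?_ ?_ ?_ ?_
  · exact (measurableSet_le (f := fun z : En (m+1) => |inner ℝ ν z|) (by fun_prop) measurable_const).inter
      (measurableSet_le measurable_const measurable_norm)
  · rintro z ⟨-, hz⟩
    exact exists_dyadic_up hρ hz
  · intro k z _ hz _
    apply ENNReal.ofReal_le_ofReal
    gcongr
  · intro k
    refine (measure_mono ?_).trans (volume_slab ν hν (2 * ρ0) (2 * (ρ0 * 2 ^ k)) (by positivity)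
      (by positivity))
    rintro z ⟨⟨h1, -⟩, -, h2⟩
    exact ⟨h1, h2⟩
  · intro k
    apply le_of_eq
    have : (2 : ℝ) ^ k ≠ 0 := by positivity
    have h4 : (4 : ℝ) ^ m = 2 ^ m * 2 ^ m := by rw [← mul_pow]; norm_num
    simp only [mul_pow, one_div, inv_pow, pow_succ, h4]
    field_simp
    try ring

lemma half_pow_rpow (ε : ℝ) (k : ℕ) : (((1:ℝ)/2) ^ k) ^ ε = (((1:ℝ)/2) ^ ε) ^ k := by
  rw [← Real.rpow_natCast, ← Real.rpow_natCast, ← Real.rpow_mul (by norm_num),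
    ← Real.rpow_mul (by norm_num), mul_comm]

lemma half_rpow_lt (ε : ℝ) (hε : 0 < ε) : ((1:ℝ)/2) ^ ε < 1 :=
  Real.rpow_lt_one (by norm_num) (by norm_num) hε

lemma bound_E2 {m : ℕ} (ν : En (m + 1)) (hν : ‖ν‖ = 1) (ε c r : ℝ) (hε : 0 < ε) (hc : 0 ≤ c)
    (hr : 0 < r) :
    ∫⁻ z in {z : En (m+1) | |inner ℝ ν z| ≤ 2 * c * ‖z‖ ^ (1 + ε) ∧ 0 < ‖z‖ ∧ ‖z‖ ≤ r},
      ENNReal.ofReal ((‖z‖ ^ (m+1))⁻¹) ≤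
        ENNReal.ofReal ((2 * 4 ^ (m+1) * c * r ^ ε) / (1 - (1/2) ^ ε)) := by
  refine dyadic_bound (ρ := fun k => r / 2 * (1/2) ^ k)
    (M := fun k => ((r / 2 * (1/2) ^ k) ^ (m+1))⁻¹)
    (V := fun k => 2 * (2 * c * (2 * (r / 2 * (1/2) ^ k)) ^ (1 + ε))
      * (2 * (2 * (r / 2 * (1/2) ^ k))) ^ m) ?_ _ _ _ (by positivity)
    (by positivity) (half_rpow_lt ε hε) (fun k => by positivity) ?_ ?_ ?_ ?_
  · exact (measurableSet_le (f := fun z : En (m+1) => |inner ℝ ν z|)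
      (g := fun z : En (m+1) => 2 * c * ‖z‖ ^ (1 + ε)) (by fun_prop) (by fun_prop)).inter
      ((measurableSet_lt measurable_const measurable_norm).inter
      (measurableSet_le measurable_norm measurable_const))
  · rintro z ⟨-, hz, hz'⟩
    exact exists_dyadic_down hz hz'
  · intro k z _ hz _
    apply ENNReal.ofReal_le_ofReal
    gcongr
  · intro k
    refine (measure_mono ?_).trans (volume_slab ν hν (2 * c * (2 * (r / 2 * (1/2) ^ k)) ^ (1 + ε))
      (2 * (r / 2 * (1/2) ^ k)) (by positivity) (by positivity))
    rintro z ⟨⟨h1, -⟩, -, h2⟩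
    refine ⟨h1.trans ?_, h2⟩
    gcongr
  · intro k
    apply le_of_eq
    have e1 : 2 * (r / 2 * (1/2 : ℝ) ^ k) = r * (1/2) ^ k := by ring
    rw [e1, Real.rpow_add (by positivity), Real.rpow_one,
      Real.mul_rpow hr.le (by positivity), half_pow_rpow]
    have : (1/2 : ℝ) ^ k ≠ 0 := by positivity
    have h4 : (4 : ℝ) ^ m = 2 ^ m * 2 ^ m := by rw [← mul_pow]; norm_num
    generalize (1/2 : ℝ) ^ k = s at *
    generalize ((1/2 : ℝ) ^ ε) ^ k = t at *
    simp only [mul_pow, div_pow, pow_succ, h4]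
    field_simp
    try ring

lemma bound_E3 {m : ℕ} (ε r : ℝ) (hε : 0 < ε) (hr : 0 < r) :
    ∫⁻ z in {z : En (m+1) | 0 < ‖z‖ ∧ ‖z‖ ≤ r},
      ENNReal.ofReal (‖z‖ ^ ε * (‖z‖ ^ (m+1))⁻¹) ≤
        ENNReal.ofReal ((4 ^ (m+1) * r ^ ε) / (1 - (1/2) ^ ε)) := by
  refine dyadic_bound (ρ := fun k => r / 2 * (1/2) ^ k)
    (M := fun k => (2 * (r / 2 * (1/2) ^ k)) ^ ε * ((r / 2 * (1/2) ^ k) ^ (m+1))⁻¹)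
    (V := fun k => 2 * (2 * (r / 2 * (1/2) ^ k))
      * (2 * (2 * (r / 2 * (1/2) ^ k))) ^ m) ?_ _ _ _ (by positivity)
    (by positivity) (half_rpow_lt ε hε) (fun k => by positivity) ?_ ?_ ?_ ?_
  · exact ((measurableSet_lt measurable_const measurable_norm).inter
      (measurableSet_le measurable_norm measurable_const))
  · rintro z ⟨hz, hz'⟩
    exact exists_dyadic_down hz hz'
  · intro k z _ hz hz2
    apply ENNReal.ofReal_le_ofReal
    gcongr
  · intro k
    refine (measure_mono ?_).trans (volume_slab (EuclideanSpace.single (0 : Fin (m+1)) (1 : ℝ))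
      (by simp) (2 * (r / 2 * (1/2) ^ k))
      (2 * (r / 2 * (1/2) ^ k)) (by positivity) (by positivity))
    rintro z ⟨-, -, h2⟩
    refine ⟨?_, h2⟩
    have := abs_real_inner_le_norm (EuclideanSpace.single (0 : Fin (m+1)) (1 : ℝ)) z
    simp only [PiLp.norm_single, norm_one, one_mul] at this
    exact this.trans h2
  · intro k
    apply le_of_eq
    have e1 : 2 * (r / 2 * (1/2 : ℝ) ^ k) = r * (1/2) ^ k := by ring
    rw [e1, Real.mul_rpow hr.le (by positivity), half_pow_rpow]
    have : (1/2 : ℝ) ^ k ≠ 0 := by positivity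
    have h4 : (4 : ℝ) ^ m = 2 ^ m * 2 ^ m := by rw [← mul_pow]; norm_num
    generalize (1/2 : ℝ) ^ k = s at *
    generalize ((1/2 : ℝ) ^ ε) ^ k = t at *
    simp only [mul_pow, div_pow, pow_succ, h4]
    field_simp
    try ring

/-! ### Geometry of the boundary -/

lemma taylor_holder {m : ℕ} {ε : ℝ} (hε : 0 < ε) {φ : (Fin m → ℝ) → ℝ} (hφ : ContDiff ℝ 1 φ)
    {c : ℝ≥0} (hc : HolderOnWith c ε.toNNReal (fderiv ℝ φ) univ) (u v : Fin m → ℝ) :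
    |φ v - φ u - fderiv ℝ φ u (v - u)| ≤ c * ‖v - u‖ ^ (1 + ε) := by
  have h := (convex_closedBall u ‖v - u‖).norm_image_sub_le_of_norm_fderiv_le' (f := φ)
    (φ := fderiv ℝ φ u) (C := c * ‖v - u‖ ^ ε) (x := u) (y := v) (𝕜 := ℝ)
    (fun x _ => (hφ.differentiable one_ne_zero) x) (fun x hx => by
      have h1 := hc.dist_le (mem_univ x) (mem_univ u)
      rw [Real.coe_toNNReal _ hε.le, dist_eq_norm] at h1
      refine h1.trans ?_
      have : dist x u ≤ ‖v - u‖ := hx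
      gcongr)
    (mem_closedBall_self (norm_nonneg _)) (by simp [dist_eq_norm])
  rw [Real.norm_eq_abs] at h
  refine h.trans (le_of_eq ?_)
  rcases eq_or_lt_of_le (norm_nonneg (v - u)) with h0 | h0
  · have h1 : 1 + ε ≠ 0 := by linarith
    rw [← h0, Real.zero_rpow h1]; simp
  · rw [Real.rpow_add h0, Real.rpow_one]; ring

/-- local description of the boundary by approximate half-spaces -/
lemma local_halfspace {n : ℕ} {ε : ℝ} (hε : 0 < ε) {Ω : Set (En n)} (hΩo : IsOpen Ω)
    (hΩ : HasC1HolderBoundary n ε Ω) (a0 : En n) (ha0 : a0 ∈ frontier Ω) :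
    ∃ r > 0, ∃ c : ℝ, 0 ≤ c ∧ ∀ a ∈ frontier Ω, a ∈ ball a0 r → ∃ ν : En n, ‖ν‖ = 1 ∧
      ∀ y ∈ ball a0 r, (y ∈ Ω → inner ℝ ν (y - a) ≤ c * ‖y - a‖ ^ (1 + ε)) ∧
        (y ∉ Ω → -(c * ‖y - a‖ ^ (1 + ε)) ≤ inner ℝ ν (y - a)) := by
  obtain ⟨hn, hΩ⟩ := hΩ
  obtain ⟨r, hr, R, φ, hφ, ⟨c, hc⟩, hgr⟩ := hΩ a0 ha0
  refine ⟨r, hr, c, c.2, fun a ha har => ?_⟩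
  set l : Fin n := ⟨n - 1, Nat.sub_lt hn Nat.one_pos⟩ with hl
  let ev : Fin n → (En n →L[ℝ] ℝ) := fun i => EuclideanSpace.proj i
  let Rc : En n →L[ℝ] En n := R.toContinuousLinearEquiv
  let P : En n →L[ℝ] (Fin (n-1) → ℝ) :=
    ContinuousLinearMap.pi fun i => (ev (Fin.castLE (Nat.sub_le n 1) i)).comp Rc
  let T : En n →L[ℝ] ℝ := (ev l).comp Rc
  have hmem : ∀ y ∈ ball a0 r, (y ∈ Ω ↔ T y < φ (P y)) := by
    intro y hy
    have : y ∈ Ω ∩ ball a0 r ↔ y ∈ {x ∈ ball a0 r |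
        R x l < φ fun i : Fin (n - 1) => R x (Fin.castLE (Nat.sub_le n 1) i)} := by rw [hgr]
    simp only [mem_inter_iff, hy, and_true, mem_ofPred_eq, true_and] at this
    exact this
  have hPn : ∀ z, ‖P z‖ ≤ ‖z‖ := by
    intro z
    rw [pi_norm_le_iff_of_nonneg (norm_nonneg _)]
    intro i
    have := PiLp.norm_apply_le (R z) (Fin.castLE (Nat.sub_le n 1) i)
    rw [R.norm_map] at this
    exact this
  have hφc : Continuous fun y => φ (P y) := hφ.continuous.comp P.continuous
  have haT : T a = φ (P a) := by
    apply le_antisymm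
    · have hcl : a ∈ closure (Ω ∩ ball a0 r) := by
        rw [mem_closure_iff_nhdsWithin_neBot]
        have h1 := mem_closure_iff_nhdsWithin_neBot.1 (frontier_subset_closure ha)
        rwa [nhdsWithin_inter_of_mem' (mem_nhdsWithin_of_mem_nhds (isOpen_ball.mem_nhds har))]
      have hsub : closure (Ω ∩ ball a0 r) ⊆ {y | T y ≤ φ (P y)} := by
        refine closure_minimal ?_ (isClosed_le T.continuous hφc)
        rintro y ⟨hy1, hy2⟩
        exact ((hmem y hy2).1 hy1).le
      exact hsub hcl
    · have : a ∉ Ω := by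
        rw [hΩo.frontier_eq] at ha; exact ha.2
      rw [hmem a har, not_lt] at this
      exact this
  let L : En n →L[ℝ] ℝ := T - (fderiv ℝ φ (P a)).comp P
  have hLn : 1 ≤ ‖L‖ := by
    have hLe : L (R.symm (EuclideanSpace.single l 1)) = 1 := by
      have hT : T (R.symm (EuclideanSpace.single l 1)) = 1 := by
        simp [T, ev, Rc]
      have hP : P (R.symm (EuclideanSpace.single l 1)) = 0 := by
        ext i
        have : (Fin.castLE (Nat.sub_le n 1) i) ≠ l := by
          intro h
          have := congrArg Fin.val h
          have hi := i.2
          simp [hl] at this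
          omega
        simp [P, ev, Rc, this]
      simp [L, hT, hP]
    have := L.le_opNorm (R.symm (EuclideanSpace.single l 1))
    rw [hLe, R.symm.norm_map] at this
    simpa using this
  have hLpos : 0 < ‖L‖ := by linarith
  let w : En n := (InnerProductSpace.toDual ℝ (En n)).symm L
  have hw : ∀ z, inner ℝ w z = L z := fun z => InnerProductSpace.toDual_symm_apply
  have hwn : ‖w‖ = ‖L‖ := LinearIsometryEquiv.norm_map _ _
  refine ⟨‖L‖⁻¹ • w, ?_, fun y hy => ?_⟩
  · rw [norm_smul, hwn, norm_inv, norm_norm, inv_mul_cancel₀ hLpos.ne']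
  have hLy : L (y - a) = T y - φ (P a) - fderiv ℝ φ (P a) (P y - P a) := by
    simp [L, haT]
  have htay := taylor_holder hε hφ hc (P a) (P y)
  have hpp : ‖P y - P a‖ ^ (1 + ε) ≤ ‖y - a‖ ^ (1 + ε) := by
    rw [← map_sub]
    exact Real.rpow_le_rpow (norm_nonneg _) (hPn _) (by linarith)
  have htay2 := htay.trans (mul_le_mul_of_nonneg_left hpp c.2)
  rw [abs_le] at htay2
  have hX : 0 ≤ (c : ℝ) * ‖y - a‖ ^ (1 + ε) := by positivity
  rw [inner_smul_left, hw, hLy, hmem y hy]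
  simp only [map_inv₀, conj_trivial]
  rw [inv_mul_le_iff₀ hLpos, le_inv_mul_iff₀ hLpos]
  constructor
  · intro h
    nlinarith
  · intro h
    nlinarith

lemma uniform_halfspace {n : ℕ} {ε : ℝ} (hε : 0 < ε) {Ω : Set (En n)} (hΩo : IsOpen Ω)
    (hΩb : Bornology.IsBounded Ω) (hΩ : HasC1HolderBoundary n ε Ω) :
    ∃ r > 0, ∃ c : ℝ, 0 ≤ c ∧ ∀ a ∈ frontier Ω, ∃ ν : En n, ‖ν‖ = 1 ∧
      ∀ y ∈ ball a r, (y ∈ Ω → inner ℝ ν (y - a) ≤ c * ‖y - a‖ ^ (1 + ε)) ∧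
        (y ∉ Ω → -(c * ‖y - a‖ ^ (1 + ε)) ≤ inner ℝ ν (y - a)) := by
  have hcomp : IsCompact (frontier Ω) :=
    Metric.isCompact_of_isClosed_isBounded isClosed_frontier
      (hΩb.closure.subset frontier_subset_closure)
  have hloc := local_halfspace hε hΩo hΩ
  choose! ρ hρ κ hκ H using hloc
  obtain ⟨t, htF, htc⟩ := hcomp.elim_nhds_subcover (fun a => ball a (ρ a / 2))
    (fun a ha => ball_mem_nhds a (half_pos (hρ a ha)))
  obtain ⟨r, hr, hrt⟩ : ∃ r > 0, ∀ a ∈ t, r ≤ ρ a / 2 := by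
    clear htc
    induction t using Finset.induction_on with
    | empty => exact ⟨1, one_pos, by simp⟩
    | insert b s hb ih =>
      obtain ⟨r, hr, h⟩ := ih (fun a ha => htF a (Finset.mem_insert_of_mem ha))
      refine ⟨min r (ρ b / 2), lt_min hr (half_pos (hρ b (htF b (Finset.mem_insert_self _ _)))), ?_⟩
      intro a ha
      rcases Finset.mem_insert.1 ha with rfl | ha
      · exact min_le_right _ _
      · exact (min_le_left _ _).trans (h a ha)
  refine ⟨r, hr, ∑ a ∈ t, κ a, Finset.sum_nonneg fun a ha => hκ a (htF a ha), fun a ha => ?_⟩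
  obtain ⟨b, hb, hab⟩ := mem_iUnion₂.1 (htc ha)
  have hbF := htF b hb
  have hab' : dist a b < ρ b / 2 := hab
  have hbρ := hρ b hbF
  obtain ⟨ν, hν, hy⟩ := H b hbF a ha (by rw [mem_ball]; linarith)
  refine ⟨ν, hν, fun y hya => ?_⟩
  have hle : κ b ≤ ∑ a ∈ t, κ a := Finset.single_le_sum (fun a ha => hκ a (htF a ha)) hb
  have hle2 : κ b * ‖y - a‖ ^ (1 + ε) ≤ (∑ a ∈ t, κ a) * ‖y - a‖ ^ (1 + ε) := by gcongr
  have hya' : dist y a < r := hya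
  obtain ⟨h1, h2⟩ := hy y (by
    rw [mem_ball]; linarith [dist_triangle y a b, hrt b hb])
  exact ⟨fun h => (h1 h).trans hle2, fun h => by linarith [h2 h]⟩

/-! ### The truncated integrals of the characteristic function -/

/-- The properties of the kernel which are used in the proof. -/
structure GoodKer (n : ℕ) (K : En n → ℝ) (B : ℝ) : Prop where
  nonneg : 0 ≤ B
  bound : ∀ z, z ≠ 0 → |K z| ≤ B * (‖z‖ ^ n)⁻¹
  even : ∀ z, z ≠ 0 → K (-z) = K z
  cont : ContinuousOn K {(0 : En n)}ᶜ
  zero : ∀ (I : Set ℝ) (a b : ℝ), MeasurableSet I → 0 < a → I ⊆ Icc a b →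
    ∫ z in {z : En n | ‖z‖ ∈ I}, K z = 0

lemma kernel_zero {n : ℕ} (hn : 0 < n) (ω K : En n → ℝ)
    (hK : ∀ x, x ≠ 0 → K x = ω x / ‖x‖ ^ n)
    (hom : ∀ t : ℝ, 0 < t → ∀ x, ω (t • x) = ω x)
    (hωc : ContinuousOn ω {(0 : En n)}ᶜ)
    (hz : (∫ ξ in sphere (0 : En n) 1, ω ξ ∂μH[(n : ℝ) - 1]) = 0)
    (I : Set ℝ) (a b : ℝ) (hI : MeasurableSet I) (ha : 0 < a) (hab : I ⊆ Icc a b) :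
    ∫ z in {z : En n | ‖z‖ ∈ I}, K z = 0 := by
  have hset : MeasurableSet {z : En n | ‖z‖ ∈ I} := measurable_norm hI
  let w : ℝ → ℝ≥0 := I.indicator fun t => Real.toNNReal ((t ^ n)⁻¹)
  have hw : Measurable w := by
    refine Measurable.indicator ?_ hI
    fun_prop
  have hwle : ∀ z : En n, (w ‖z‖ : ℝ≥0∞) ≤
      (closedBall (0 : En n) b).indicator (fun _ => ENNReal.ofReal ((a ^ n)⁻¹)) z := by
    intro z
    by_cases h : ‖z‖ ∈ I
    · have hz := hab h
      have hzb : z ∈ closedBall (0 : En n) b := by simpa using hz.2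
      rw [indicator_of_mem hzb]
      simp only [w, indicator_of_mem h]
      refine ENNReal.ofReal_le_ofReal ?_
      have := hz.1
      gcongr
    · simp [w, h]
  have hfin : ∫⁻ x : En n, w ‖x‖ ≠ ⊤ := by
    refine ((lintegral_mono hwle).trans_lt ?_).ne
    rw [lintegral_indicator measurableSet_closedBall, setLIntegral_const]
    exact ENNReal.mul_lt_top ENNReal.ofReal_lt_top measure_closedBall_lt_top
  have := radial_integral_zero hn ω hom hωc hz w hw hfin
  rw [← this, ← integral_indicator hset]
  congr 1
  ext z
  by_cases h : ‖z‖ ∈ I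
  · have hz := (hab h).1
    have hz0 : z ≠ 0 := by rintro rfl; simp at hz; linarith
    rw [indicator_of_mem (by exact h), hK z hz0]
    simp only [w, indicator_of_mem h]
    rw [Real.coe_toNNReal _ (by positivity)]
    field_simp
  · rw [indicator_of_notMem (by exact h)]
    simp [w, h]

namespace GoodKer

variable {n : ℕ} {K : En n → ℝ} {B : ℝ}

lemma integrableOn (h : GoodKer n K B) {s : Set (En n)} {a b : ℝ} (ha : 0 < a)
    (hs : ∀ z ∈ s, a ≤ ‖z‖ ∧ ‖z‖ ≤ b) : IntegrableOn K s := by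
  have hc : IsCompact {z : En n | a ≤ ‖z‖ ∧ ‖z‖ ≤ b} := by
    refine Metric.isCompact_of_isClosed_isBounded ?_ ?_
    · exact (isClosed_le continuous_const continuous_norm).inter
        (isClosed_le continuous_norm continuous_const)
    · refine isBounded_closedBall (x := (0 : En n)) (r := b) |>.subset ?_
      rintro z ⟨-, hz⟩
      simpa using hz
  have : IntegrableOn K {z : En n | a ≤ ‖z‖ ∧ ‖z‖ ≤ b} := by
    refine (h.cont.mono ?_).integrableOn_compact hc
    rintro z ⟨hz, -⟩
    rintro rfl
    simp at hz; linarith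
  exact this.mono_set hs

lemma half (h : GoodKer n K B) (ν : En n) (hν : ‖ν‖ = 1) (I : Set ℝ) (a b : ℝ)
    (hI : MeasurableSet I) (ha : 0 < a) (hab : I ⊆ Icc a b) :
    ∫ z in {z : En n | ‖z‖ ∈ I} ∩ {z | 0 < inner ℝ ν z}, K z = 0 := by
  have hset : MeasurableSet {z : En n | ‖z‖ ∈ I} := measurable_norm hI
  have hpos : MeasurableSet {z : En n | 0 < inner ℝ ν z} :=
    measurableSet_lt measurable_const (g := fun z : En n => inner ℝ ν z) (by fun_prop)
  have hneg : MeasurableSet {z : En n | inner ℝ ν z < 0} :=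
    measurableSet_lt (f := fun z : En n => inner ℝ ν z) (by fun_prop) measurable_const
  have hint : IntegrableOn K {z : En n | ‖z‖ ∈ I} := h.integrableOn ha fun z hz => hab hz
  have h0 := h.zero I a b hI ha hab
  rw [← integral_inter_add_sdiff hpos hint] at h0
  have hdiff : ∫ z in {z : En n | ‖z‖ ∈ I} \ {z | 0 < inner ℝ ν z}, K z =
      ∫ z in {z : En n | ‖z‖ ∈ I} ∩ {z | inner ℝ ν z < 0}, K z := by
    refine setIntegral_congr_set ?_
    have hnull : ∀ᵐ z : En n, inner ℝ ν z ≠ 0 := by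
      have := Measure.addHaar_submodule (volume : Measure (En n))
        (LinearMap.ker (innerSL ℝ ν : En n →L[ℝ] ℝ).toLinearMap) (by
          intro ht
          have : ν ∈ LinearMap.ker (innerSL ℝ ν : En n →L[ℝ] ℝ).toLinearMap := by
            rw [ht]; trivial
          have h1 : inner ℝ ν ν = 0 := by simpa using this
          rw [real_inner_self_eq_norm_sq, hν] at h1
          norm_num at h1)
      rw [ae_iff]
      refine measure_mono_null ?_ this
      intro z hz
      simpa using hz
    filter_upwards [hnull] with z hz
    refine propext ⟨fun h => ⟨h.1, ?_⟩, fun h => ⟨h.1, ?_⟩⟩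
    · exact lt_of_le_of_ne (not_lt.1 h.2) hz
    · exact not_lt.2 (le_of_lt (show inner ℝ ν z < 0 from h.2))
  have hrefl : ∫ z in {z : En n | ‖z‖ ∈ I} ∩ {z | inner ℝ ν z < 0}, K z =
      ∫ z in {z : En n | ‖z‖ ∈ I} ∩ {z | 0 < inner ℝ ν z}, K z := by
    rw [← integral_indicator (hset.inter hneg), ← integral_indicator (hset.inter hpos),
      ← integral_neg_eq_self]
    congr 1
    ext z
    by_cases hz : z ∈ {z : En n | ‖z‖ ∈ I} ∩ {z | 0 < inner ℝ ν z}
    · have hz' : -z ∈ {z : En n | ‖z‖ ∈ I} ∩ {z | inner ℝ ν z < 0} := by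
        refine ⟨?_, ?_⟩
        · have := hz.1
          simpa using this
        · have := hz.2
          simpa using this
      rw [indicator_of_mem hz, indicator_of_mem hz']
      refine h.even z ?_
      rintro rfl
      have := hz.2
      simp at this
    · have hz' : -z ∉ {z : En n | ‖z‖ ∈ I} ∩ {z | inner ℝ ν z < 0} := by
        intro h'
        refine hz ⟨?_, ?_⟩
        · have := h'.1
          simpa using this
        · have := h'.2
          simpa using this
      rw [indicator_of_notMem hz, indicator_of_notMem hz']
  rw [hdiff, hrefl] at h0
  linarith

end GoodKer

lemma vol_reflect {n : ℕ} {Ω : Set (En n)} (hΩ : MeasurableSet Ω) (x : En n) :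
    volume {z | x - z ∈ Ω} = volume Ω :=
  (Measure.measurePreserving_sub_left volume x).measure_preimage hΩ.nullMeasurableSet

lemma chi_bound {m : ℕ} {ε : ℝ} (hε : 0 < ε) {Ω : Set (En (m + 1))} (hΩo : IsOpen Ω)
    (hΩb : Bornology.IsBounded Ω) (hΩ : HasC1HolderBoundary (m + 1) ε Ω) :
    ∃ C : ℝ, 0 ≤ C ∧ ∀ (K : En (m + 1) → ℝ) (B : ℝ), GoodKer (m + 1) K B →
      ∀ (x : En (m + 1)) (δ : ℝ), 0 < δ →
        |∫ z in {z | x - z ∈ Ω ∧ δ < ‖z‖}, K z| ≤ C * B := by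
  obtain ⟨r, hr, c, hc, hH⟩ := uniform_halfspace hε hΩo hΩb hΩ
  set r1 := r / 2 with hr1
  have hr1p : 0 < r1 := half_pos hr
  set c' := c * 2 ^ (1 + ε) with hc'
  have hc'0 : 0 ≤ c' := by positivity
  set C1 : ℝ := 4 ^ (m+1) / (1 - 1/2) with hC1
  set C2 : ℝ := (2 * 4 ^ (m+1) * c' * r1 ^ ε) / (1 - (1/2) ^ ε) with hC2
  have hC10 : 0 ≤ C1 := by rw [hC1]; norm_num; positivity
  have hC20 : 0 ≤ C2 := by
    have := half_rpow_lt ε hε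
    apply div_nonneg (by positivity)
    linarith
  set C3 : ℝ := (r1 ^ (m+1))⁻¹ * (volume Ω).toReal with hC3
  have hC30 : 0 ≤ C3 := by positivity
  have hΩfin : volume Ω ≠ ⊤ := hΩb.measure_lt_top.ne
  refine ⟨C1 + C2 + C3, by positivity, fun K B hK x δ hδ => ?_⟩
  have hB := hK.nonneg
  -- the set
  set S : Set (En (m+1)) := {z | x - z ∈ Ω ∧ δ < ‖z‖} with hS
  have hΩ'o : IsOpen {z | x - z ∈ Ω} := hΩo.preimage (by fun_prop)
  have hSm : MeasurableSet S := hΩ'o.measurableSet.inter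
    (measurableSet_lt measurable_const measurable_norm)
  obtain ⟨D, hD⟩ : ∃ D, ∀ z ∈ S, ‖z‖ ≤ D := by
    obtain ⟨D, hD⟩ := hΩb.exists_norm_le
    refine ⟨‖x‖ + D, fun z hz => ?_⟩
    have h1 := hD _ hz.1
    have h2 : z = x - (x - z) := by abel
    calc ‖z‖ = ‖x - (x - z)‖ := by rw [← h2]
      _ ≤ ‖x‖ + ‖x - z‖ := norm_sub_le _ _
      _ ≤ _ := by linarith
  have hSint : IntegrableOn K S := hK.integrableOn hδ fun z hz => ⟨hz.2.le, hD z hz⟩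
  have hball : ∀ d : ℝ, MeasurableSet {z : En (m+1) | ‖z‖ < d} := fun d =>
    measurableSet_lt measurable_norm measurable_const
  -- near part
  have hnear : ∀ d : ℝ, (∀ a ∈ frontier Ω, d ≤ dist x a) → ∫ z in S ∩ {z | ‖z‖ < d}, K z = 0 := by
    intro d hd
    by_cases hmeet : ∃ y ∈ ball x d, y ∈ Ω
    · obtain ⟨y, hy, hyΩ⟩ := hmeet
      have hsub : ball x d ⊆ Ω := by
        have hpre : IsPreconnected (ball x d) := (convex_ball x d).isPreconnected
        refine hpre.subset_of_closure_inter_subset hΩo ⟨y, hy, hyΩ⟩ ?_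
        rintro w ⟨hw1, hw2⟩
        by_contra hw3
        have : w ∈ frontier Ω := by rw [hΩo.frontier_eq]; exact ⟨hw1, hw3⟩
        have h1 := hd w this
        rw [mem_ball, dist_comm] at hw2
        linarith
      have hEq : S ∩ {z | ‖z‖ < d} = {z : En (m+1) | ‖z‖ ∈ Ioo δ d} := by
        ext z
        constructor
        · rintro ⟨h1, h2⟩
          exact ⟨h1.2, h2⟩
        · rintro ⟨h1, h2⟩
          refine ⟨⟨hsub ?_, h1⟩, h2⟩
          simpa [dist_eq_norm] using h2
      rw [hEq]
      exact hK.zero _ δ d measurableSet_Ioo hδ Ioo_subset_Icc_self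
    · have hEq : S ∩ {z | ‖z‖ < d} = ∅ := by
        ext z
        simp only [mem_empty_iff_false, iff_false]
        rintro ⟨h1, h2⟩
        exact hmeet ⟨x - z, by simpa [dist_eq_norm] using h2, h1.1⟩
      rw [hEq]; simp
  -- far part
  have hfar : |∫ z in S \ {z | ‖z‖ < r1}, K z| ≤ C3 * B := by
    have hvol : volume (S \ {z | ‖z‖ < r1}) ≤ volume Ω := by
      rw [← vol_reflect hΩo.measurableSet x]
      exact measure_mono fun z hz => hz.1.1
    have := norm_setIntegral_le_of_norm_le_const (f := K) (s := S \ {z | ‖z‖ < r1})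
      (C := B * (r1 ^ (m+1))⁻¹) (hvol.trans_lt hΩfin.lt_top) (fun z hz => by
        have hz2 : r1 ≤ ‖z‖ := not_lt.1 hz.2
        have hz0 : z ≠ 0 := by rintro rfl; simp at hz2; linarith
        refine (hK.bound z hz0).trans ?_
        gcongr)
    rw [Real.norm_eq_abs] at this
    refine this.trans ?_
    have h2 : volume.real (S \ {z | ‖z‖ < r1}) ≤ (volume Ω).toReal :=
      ENNReal.toReal_mono hΩfin hvol
    calc _ ≤ B * (r1 ^ (m+1))⁻¹ * (volume Ω).toReal := by gcongr
      _ = C3 * B := by rw [hC3]; ring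
  have hsplit := integral_inter_add_sdiff (hball r1) hSint
  rw [← hsplit]
  refine (abs_add_le _ _).trans ?_
  suffices hmid : |∫ z in S ∩ {z | ‖z‖ < r1}, K z| ≤ (C1 + C2) * B by
    calc _ ≤ (C1 + C2) * B + C3 * B := add_le_add hmid hfar
      _ = _ := by ring
  by_cases hcase : ∀ a ∈ frontier Ω, r1 ≤ dist x a
  · rw [hnear r1 hcase, abs_zero]; positivity
  push Not at hcase
  obtain ⟨a1, ha1, hxa1⟩ := hcase
  have hcomp : IsCompact (frontier Ω) :=
    Metric.isCompact_of_isClosed_isBounded isClosed_frontier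
      (hΩb.closure.subset frontier_subset_closure)
  obtain ⟨a, ha, hmin⟩ := hcomp.exists_isMinOn ⟨a1, ha1⟩
    (f := fun a => dist x a) (by fun_prop)
  have hmin' : ∀ b ∈ frontier Ω, dist x a ≤ dist x b := fun b hb => hmin hb
  set d := dist x a with hd
  have hdr : d < r1 := (hmin' a1 ha1).trans_lt hxa1
  have hd0 : 0 ≤ d := dist_nonneg
  obtain ⟨ν, hν, hνy⟩ := hH a ha
  have hSint' : IntegrableOn K (S ∩ {z | ‖z‖ < r1}) := hSint.mono_set inter_subset_left
  rw [← integral_inter_add_sdiff (hball d) hSint']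
  have hEq1 : S ∩ {z | ‖z‖ < r1} ∩ {z | ‖z‖ < d} = S ∩ {z | ‖z‖ < d} := by
    ext z
    constructor
    · rintro ⟨⟨h1, h2⟩, h3⟩; exact ⟨h1, h3⟩
    · rintro ⟨h1, h3⟩; exact ⟨⟨h1, lt_trans h3 hdr⟩, h3⟩
  rw [hEq1, hnear d hmin', zero_add]
  set S2 := (S ∩ {z | ‖z‖ < r1}) \ {z | ‖z‖ < d} with hS2
  set J : Set ℝ := Ioi δ ∩ Ico d r1 with hJ
  have hJm : MeasurableSet J := measurableSet_Ioi.inter measurableSet_Ico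
  set A : Set (En (m+1)) := {z | ‖z‖ ∈ J} with hA
  have hAm : MeasurableSet A := measurable_norm hJm
  set H : Set (En (m+1)) := {z | 0 < inner ℝ ν z} with hHd
  have hHm : MeasurableSet H :=
    measurableSet_lt measurable_const (g := fun z : En (m+1) => inner ℝ ν z) (by fun_prop)
  have hJsub : J ⊆ Icc δ r1 := fun t ht => ⟨ht.1.le, ht.2.2.le⟩
  have hhalf : ∫ z in A ∩ H, K z = 0 := hK.half ν hν J δ r1 hJm hδ hJsub
  have hS2m : MeasurableSet S2 := (hSm.inter (hball r1)).diff (hball d)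
  have hS2A : ∀ z, z ∈ S2 ↔ z ∈ A ∧ x - z ∈ Ω := by
    intro z
    constructor
    · rintro ⟨⟨h1, h2⟩, h3⟩
      exact ⟨⟨h1.2, not_lt.1 h3, h2⟩, h1.1⟩
    · rintro ⟨⟨h1, h2, h3⟩, h4⟩
      exact ⟨⟨⟨h4, h1⟩, h3⟩, not_lt.2 h2⟩
  have hAint : IntegrableOn K A := hK.integrableOn hδ fun z hz => hJsub hz
  have hS2int : IntegrableOn K S2 := hAint.mono_set fun z hz => ((hS2A z).1 hz).1
  have hAHint : IntegrableOn K (A ∩ H) := hAint.mono_set inter_subset_left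
  set ρ0 := max δ d with hρ0
  have hρ0p : 0 < ρ0 := lt_max_of_lt_left hδ
  set E1 : Set (En (m+1)) := {z | |inner ℝ ν z| ≤ 2 * ρ0 ∧ ρ0 ≤ ‖z‖} with hE1
  set E2 : Set (En (m+1)) :=
    {z | |inner ℝ ν z| ≤ 2 * c' * ‖z‖ ^ (1 + ε) ∧ 0 < ‖z‖ ∧ ‖z‖ ≤ r1} with hE2
  have hE1m : MeasurableSet E1 :=
    (measurableSet_le (f := fun z : En (m+1) => |inner ℝ ν z|) (by fun_prop)
      measurable_const).inter (measurableSet_le measurable_const measurable_norm)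
  have hE2m : MeasurableSet E2 :=
    (measurableSet_le (f := fun z : En (m+1) => |inner ℝ ν z|)
      (g := fun z : En (m+1) => 2 * c' * ‖z‖ ^ (1 + ε)) (by fun_prop) (by fun_prop)).inter
      ((measurableSet_lt measurable_const measurable_norm).inter
      (measurableSet_le measurable_norm measurable_const))
  -- geometric heart
  have hgeo : ∀ z ∈ A, ¬ (x - z ∈ Ω ↔ z ∈ H) → z ∈ E1 ∪ E2 := by
    intro z hz hne
    obtain ⟨hz1, hz2, hz3⟩ := hz
    have hz1' : δ < ‖z‖ := hz1
    have hxa : |inner ℝ ν (x - a)| ≤ d := by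
      have := abs_real_inner_le_norm ν (x - a)
      rwa [hν, one_mul, ← dist_eq_norm] at this
    rw [abs_le] at hxa
    have hya : ‖x - z - a‖ ≤ 2 * ‖z‖ := by
      have e : x - z - a = (x - a) - z := by abel
      rw [e]
      have := norm_sub_le (x - a) z
      rw [← dist_eq_norm x a] at this
      linarith
    have hyball : x - z ∈ ball a r := by
      have e : x - z - a = (x - a) - z := by abel
      rw [mem_ball, dist_eq_norm, e]
      have := norm_sub_le (x - a) z
      rw [← dist_eq_norm x a] at this
      linarith
    have hpow : c * ‖x - z - a‖ ^ (1 + ε) ≤ c' * ‖z‖ ^ (1 + ε) := by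
      rw [hc', mul_assoc, ← Real.mul_rpow (by norm_num) (norm_nonneg _)]
      gcongr
    obtain ⟨hin, hout⟩ := hνy _ hyball
    have einner : inner ℝ ν (x - z - a) = inner ℝ ν (x - a) - inner ℝ ν z := by
      rw [← inner_sub_right]; congr 1; abel
    rw [einner] at hin hout
    have hdρ : d ≤ ρ0 := le_max_right _ _
    have hcz : 0 ≤ c' * ‖z‖ ^ (1 + ε) := by positivity
    have hkey : |inner ℝ ν z| ≤ ρ0 + c' * ‖z‖ ^ (1 + ε) := by
      by_cases hzH : 0 < inner ℝ ν z
      · have hnot : x - z ∉ Ω := fun h => hne ⟨fun _ => hzH, fun _ => h⟩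
        rw [abs_of_pos hzH]
        linarith [hout hnot]
      · have hyes : x - z ∈ Ω := by
          by_contra h
          exact hne ⟨fun h' => absurd h' h, fun h' => absurd h' hzH⟩
        rw [abs_of_nonpos (not_lt.1 hzH)]
        linarith [hin hyes]
    rcases le_total (c' * ‖z‖ ^ (1 + ε)) ρ0 with hle | hle
    · left
      exact ⟨by linarith, max_le hz1'.le hz2⟩
    · right
      exact ⟨by linarith, by linarith, hz3.le⟩
  have hpt : ∀ z, ‖S2.indicator K z - (A ∩ H).indicator K z‖ₑ ≤
      (E1 ∪ E2).indicator (fun z => ENNReal.ofReal (B * (‖z‖ ^ (m+1))⁻¹)) z := by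
    intro z
    by_cases hzA : z ∈ A
    · have hz0 : z ≠ 0 := by
        rintro rfl
        have : δ < ‖(0 : En (m+1))‖ := hzA.1
        simp at this; linarith
      have hKz : ‖K z‖ₑ ≤ ENNReal.ofReal (B * (‖z‖ ^ (m+1))⁻¹) := by
        rw [← ofReal_norm]
        exact ENNReal.ofReal_le_ofReal (hK.bound z hz0)
      by_cases hiff : x - z ∈ Ω ↔ z ∈ H
      · have : z ∈ S2 ↔ z ∈ A ∩ H := by
          rw [hS2A, mem_inter_iff, hiff]
        by_cases h2 : z ∈ S2
        · rw [indicator_of_mem h2, indicator_of_mem (this.1 h2), sub_self]; simp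
        · rw [indicator_of_notMem h2, indicator_of_notMem (fun h => h2 (this.2 h)), sub_self]; simp
      · rw [indicator_of_mem (hgeo z hzA hiff)]
        by_cases h2 : z ∈ S2
        · have h3 : z ∉ A ∩ H := fun h =>
            hiff ⟨fun _ => h.2, fun _ => ((hS2A z).1 h2).2⟩
          rw [indicator_of_mem h2, indicator_of_notMem h3, sub_zero]
          exact hKz
        · rw [indicator_of_notMem h2, zero_sub, enorm_neg]
          by_cases h3 : z ∈ A ∩ H
          · rw [indicator_of_mem h3]; exact hKz
          · rw [indicator_of_notMem h3]; simp
    · have h2 : z ∉ S2 := fun h => hzA ((hS2A z).1 h).1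
      have h3 : z ∉ A ∩ H := fun h => hzA h.1
      rw [indicator_of_notMem h2, indicator_of_notMem h3, sub_self]; simp
  have hfinal : ∫ z in S2, K z = ∫ z, (S2.indicator K z - (A ∩ H).indicator K z) := by
    rw [integral_sub (hS2int.integrable_indicator hS2m)
      (hAHint.integrable_indicator (hAm.inter hHm)), integral_indicator hS2m,
      integral_indicator (hAm.inter hHm), hhalf, sub_zero]
  rw [hfinal, ← Real.norm_eq_abs]
  have henorm : ‖∫ z, (S2.indicator K z - (A ∩ H).indicator K z)‖ₑ ≤
      ENNReal.ofReal ((C1 + C2) * B) := by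
    refine (enorm_integral_le_lintegral_enorm _).trans ((lintegral_mono hpt).trans ?_)
    rw [lintegral_indicator (hE1m.union hE2m)]
    simp_rw [ENNReal.ofReal_mul hB]
    rw [lintegral_const_mul' _ _ ENNReal.ofReal_ne_top]
    calc _ ≤ ENNReal.ofReal B * ((∫⁻ z in E1, ENNReal.ofReal ((‖z‖ ^ (m+1))⁻¹)) +
          ∫⁻ z in E2, ENNReal.ofReal ((‖z‖ ^ (m+1))⁻¹)) := by
          gcongr; exact lintegral_union_le _ _ _
      _ ≤ ENNReal.ofReal B * (ENNReal.ofReal C1 + ENNReal.ofReal C2) := by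
          gcongr
          · exact bound_E1 ν hν ρ0 hρ0p
          · exact bound_E2 ν hν ε c' r1 hε hc'0 hr1p
      _ = ENNReal.ofReal ((C1 + C2) * B) := by
          rw [← ENNReal.ofReal_add hC10 hC20, ← ENNReal.ofReal_mul hB, mul_comm]
  rw [← ofReal_norm] at henorm
  exact (ENNReal.ofReal_le_ofReal_iff (by positivity)).1 henorm

/-! ### The main estimate -/

lemma holderNorm_bound {n : ℕ} {ε : ℝ} {Ω : Set (En n)} {f : En n → ℂ}
    (hf : holderNorm ε Ω f ≠ ⊤) {y : En n} (hy : y ∈ Ω) : ‖f y‖ ≤ (holderNorm ε Ω f).toReal := by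
  have h1 : (‖f y‖₊ : ℝ≥0∞) ≤ holderNorm ε Ω f :=
    (le_iSup (fun x : Ω => (‖f x.1‖₊ : ℝ≥0∞)) ⟨y, hy⟩).trans le_self_add
  simpa using ENNReal.toReal_mono hf h1

lemma holderNorm_bound' {n : ℕ} {ε : ℝ} {Ω : Set (En n)} {f : En n → ℂ}
    (hf : holderNorm ε Ω f ≠ ⊤) {y y' : En n} (hy : y ∈ Ω) (hy' : y' ∈ Ω) :
    ‖f y - f y'‖ ≤ (holderNorm ε Ω f).toReal * ‖y - y'‖ ^ ε := by
  have h1 : ENNReal.ofReal (‖f y - f y'‖ / ‖y - y'‖ ^ ε) ≤ holderNorm ε Ω f :=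
    (le_iSup (fun p : Ω × Ω => ENNReal.ofReal (‖f p.1.1 - f p.2.1‖ / ‖p.1.1 - p.2.1‖ ^ ε))
      (⟨y, hy⟩, ⟨y', hy'⟩)).trans le_add_self
  have h2 := (ENNReal.ofReal_le_iff_le_toReal hf).1 h1
  by_cases h : y = y'
  · subst h
    simp only [sub_self, norm_zero]
    positivity
  · have : 0 < ‖y - y'‖ := norm_pos_iff.2 (sub_ne_zero.2 h)
    rwa [div_le_iff₀ (by positivity)] at h2

lemma czConst_bound {n : ℕ} {K : En n → ℝ} (hcz : czConst n K ≠ ⊤) {z : En n} (hz : z ≠ 0) :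
    |K z| ≤ (czConst n K).toReal * (‖z‖ ^ n)⁻¹ := by
  have h1 : ENNReal.ofReal (|K z| * ‖z‖ ^ n) ≤ czConst n K :=
    (le_iSup (fun x : {x : En n // x ≠ 0} => ENNReal.ofReal (|K x.1| * ‖x.1‖ ^ n))
      ⟨z, hz⟩).trans le_self_add
  have h2 := (ENNReal.ofReal_le_iff_le_toReal hcz).1 h1
  have : 0 < ‖z‖ ^ n := by positivity
  rwa [← div_eq_mul_inv, le_div_iff₀ this]

lemma main_bound {m : ℕ} {ε : ℝ} (hε : 0 < ε) (hε1 : ε < 1) {Ω : Set (En (m + 1))}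
    (hΩo : IsOpen Ω) (hΩne : Ω.Nonempty)
    (hΩb : Bornology.IsBounded Ω) (hΩ : HasC1HolderBoundary (m + 1) ε Ω) :
    ∃ C : ℝ, 0 < C ∧ ∀ (K : En (m + 1) → ℝ) (B : ℝ), GoodKer (m + 1) K B →
      ∀ (f : En (m + 1) → ℂ) (N : ℝ), 0 ≤ N → (∀ y ∈ Ω, ‖f y‖ ≤ N) →
      (∀ y ∈ Ω, ∀ y' ∈ Ω, ‖f y - f y'‖ ≤ N * ‖y - y'‖ ^ ε) →
      ∀ (x : En (m + 1)) (δ : ℝ), 0 < δ →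
        ‖∫ y in {y ∈ Ω | δ < dist y x}, f y * (K (x - y) : ℂ)‖ ≤ C * B * N := by
  obtain ⟨C0, hC0, hchi⟩ := chi_bound hε hΩo hΩb hΩ
  set C3 : ℝ := (4 ^ (m+1) * 1 ^ ε) / (1 - (1/2) ^ ε) with hC3
  have hC30 : 0 ≤ C3 := by
    have := half_rpow_lt ε hε
    apply div_nonneg (by positivity)
    linarith
  set W : ℝ := (volume Ω).toReal with hW
  have hW0 : 0 ≤ W := ENNReal.toReal_nonneg
  have hΩfin : volume Ω ≠ ⊤ := hΩb.measure_lt_top.ne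
  refine ⟨3 * (C3 + W) + C0 + 1, by positivity, fun K B hK f N hN hfN hfH x δ hδ => ?_⟩
  have hB := hK.nonneg
  set S : Set (En (m+1)) := {z | x - z ∈ Ω ∧ δ < ‖z‖} with hS
  have hΩ'o : IsOpen {z | x - z ∈ Ω} := hΩo.preimage (by fun_prop)
  have hSm : MeasurableSet S := hΩ'o.measurableSet.inter
    (measurableSet_lt measurable_const measurable_norm)
  obtain ⟨D, hD⟩ : ∃ D, ∀ z ∈ S, ‖z‖ ≤ D := by
    obtain ⟨D, hD⟩ := hΩb.exists_norm_le
    refine ⟨‖x‖ + D, fun z hz => ?_⟩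
    have h1 := hD _ hz.1
    have h2 : z = x - (x - z) := by abel
    calc ‖z‖ = ‖x - (x - z)‖ := by rw [← h2]
      _ ≤ ‖x‖ + ‖x - z‖ := norm_sub_le _ _
      _ ≤ _ := by linarith
  have hSint : IntegrableOn K S := hK.integrableOn hδ fun z hz => ⟨hz.2.le, hD z hz⟩
  have hSintC : IntegrableOn (fun z => (K z : ℂ)) S := hSint.ofReal
  -- change of variables
  have hSm' : MeasurableSet {y ∈ Ω | δ < dist y x} :=
    hΩo.measurableSet.inter
      (measurableSet_lt measurable_const (measurable_id.dist measurable_const))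
  have hcv : ∫ y in {y ∈ Ω | δ < dist y x}, f y * (K (x - y) : ℂ) =
      ∫ z in S, f (x - z) * (K z : ℂ) := by
    rw [← integral_indicator hSm', ← integral_indicator hSm, ← integral_sub_left_eq_self _ _ x]
    congr 1
    ext z
    have hiff : x - z ∈ {y ∈ Ω | δ < dist y x} ↔ z ∈ S := by
      simp [hS, dist_eq_norm]
    by_cases h : z ∈ S
    · rw [indicator_of_mem h, indicator_of_mem (hiff.2 h), sub_sub_cancel]
    · rw [indicator_of_notMem h, indicator_of_notMem (fun h' => h (hiff.1 h'))]
  rw [hcv]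
  -- base point
  obtain ⟨x', hx', hxx'⟩ := (infDist_lt_iff (x := x) hΩne).1 (lt_add_of_pos_right (infDist x Ω) hδ)
  have hdist : ∀ z ∈ S, ‖x - z - x'‖ ≤ 3 * ‖z‖ := by
    rintro z ⟨hz1, hz2⟩
    have h1 : infDist x Ω ≤ ‖z‖ := by
      have := infDist_le_dist_of_mem (x := x) hz1
      simpa [dist_eq_norm] using this
    have e : x - z - x' = (x - x') - z := by abel
    rw [e]
    have h2 := norm_sub_le (x - x') z
    rw [← dist_eq_norm x x'] at h2
    linarith
  -- measurability of f
  have hfc : ContinuousOn f Ω := by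
    intro y hy
    rw [ContinuousWithinAt, tendsto_iff_norm_sub_tendsto_zero]
    have hlim : Tendsto (fun y' => N * ‖y' - y‖ ^ ε) (𝓝[Ω] y) (𝓝 0) := by
      have hcont : Continuous fun y' : En (m+1) => N * ‖y' - y‖ ^ ε :=
        continuous_const.mul ((by fun_prop : Continuous fun y' : En (m+1) => ‖y' - y‖).rpow_const
          fun _ => Or.inr hε.le)
      have := (hcont.tendsto y).mono_left (nhdsWithin_le_nhds (s := Ω))
      simpa [Real.zero_rpow hε.ne'] using this
    refine squeeze_zero' (Eventually.of_forall fun _ => norm_nonneg _) ?_ hlim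
    filter_upwards [self_mem_nhdsWithin] with y' hy'
    exact hfH y' hy' y hy
  have hfS : ContinuousOn (fun z => f (x - z)) S :=
    hfc.comp (by fun_prop) fun z hz => hz.1
  have hfSm : AEStronglyMeasurable (fun z => f (x - z) - f x') (volume.restrict S) :=
    (hfS.sub continuousOn_const).aestronglyMeasurable hSm
  have hint1 : IntegrableOn (fun z => (f (x - z) - f x') * (K z : ℂ)) S := by
    refine Integrable.bdd_mul (c := 2 * N) hSintC hfSm ?_
    filter_upwards [ae_restrict_mem hSm] with z hz
    refine (norm_sub_le _ _).trans ?_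
    linarith [hfN _ hz.1, hfN _ hx']
  have hint2 : IntegrableOn (fun z => f x' * (K z : ℂ)) S := hSintC.const_mul _
  have hsplit : ∫ z in S, f (x - z) * (K z : ℂ) =
      (∫ z in S, (f (x - z) - f x') * (K z : ℂ)) + f x' * ((∫ z in S, K z : ℝ) : ℂ) := by
    rw [← integral_complex_ofReal, ← integral_const_mul, ← integral_add hint1 hint2]
    congr 1
    ext z
    ring
  rw [hsplit]
  refine (norm_add_le _ _).trans ?_
  have hpart2 : ‖f x' * ((∫ z in S, K z : ℝ) : ℂ)‖ ≤ C0 * B * N := by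
    rw [norm_mul, Complex.norm_real, Real.norm_eq_abs, mul_comm]
    exact mul_le_mul (hchi K B hK x δ hδ) (hfN _ hx') (norm_nonneg _) (by positivity)
  set G : Set (En (m+1)) := {z | 0 < ‖z‖ ∧ ‖z‖ ≤ 1} with hG
  have hGm : MeasurableSet G := ((measurableSet_lt measurable_const measurable_norm).inter
      (measurableSet_le measurable_norm measurable_const))
  have hpart1 : ‖∫ z in S, (f (x - z) - f x') * (K z : ℂ)‖ ≤ 3 * (C3 + W) * B * N := by
    have hpt : ∀ z ∈ S, ‖(f (x - z) - f x') * (K z : ℂ)‖ₑ ≤ ENNReal.ofReal (3 * N * B) *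
        (G.indicator (fun z => ENNReal.ofReal (‖z‖ ^ ε * (‖z‖ ^ (m+1))⁻¹)) z + 1) := by
      intro z hz
      have hzp : 0 < ‖z‖ := hδ.trans hz.2
      have hKz := hK.bound z (norm_pos_iff.1 hzp)
      rw [← ofReal_norm, norm_mul, Complex.norm_real, Real.norm_eq_abs]
      by_cases h1 : ‖z‖ ≤ 1
      · rw [indicator_of_mem (show z ∈ G from ⟨hzp, h1⟩)]
        refine le_trans ?_ (mul_le_mul_right le_self_add _)
        rw [← ENNReal.ofReal_mul (by positivity)]
        apply ENNReal.ofReal_le_ofReal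
        have h3 : (3 : ℝ) ^ ε ≤ 3 := by
          calc (3 : ℝ) ^ ε ≤ 3 ^ (1 : ℝ) := Real.rpow_le_rpow_of_exponent_le (by norm_num) hε1.le
            _ = 3 := Real.rpow_one 3
        have hf1 : ‖f (x - z) - f x'‖ ≤ N * (3 * ‖z‖ ^ ε) := by
          refine (hfH _ hz.1 _ hx').trans ?_
          refine mul_le_mul_of_nonneg_left ?_ hN
          calc ‖x - z - x'‖ ^ ε ≤ (3 * ‖z‖) ^ ε :=
                Real.rpow_le_rpow (norm_nonneg _) (hdist z hz) hε.le
            _ = 3 ^ ε * ‖z‖ ^ ε := Real.mul_rpow (by norm_num) hzp.le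
            _ ≤ 3 * ‖z‖ ^ ε := by gcongr
        calc _ ≤ (N * (3 * ‖z‖ ^ ε)) * (B * (‖z‖ ^ (m+1))⁻¹) :=
              mul_le_mul hf1 hKz (abs_nonneg _) (by positivity)
          _ = _ := by ring
      · rw [indicator_of_notMem (fun h : z ∈ G => h1 h.2), zero_add, mul_one]
        apply ENNReal.ofReal_le_ofReal
        have hf1 : ‖f (x - z) - f x'‖ ≤ 3 * N := by
          refine (norm_sub_le _ _).trans ?_
          linarith [hfN _ hz.1, hfN _ hx']
        have hK1 : |K z| ≤ B := by
          refine hKz.trans (mul_le_of_le_one_right hB ?_)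
          exact inv_le_one_of_one_le₀ (one_le_pow₀ (not_le.1 h1).le)
        exact mul_le_mul hf1 hK1 (abs_nonneg _) (by positivity)
    have henorm : ‖∫ z in S, (f (x - z) - f x') * (K z : ℂ)‖ₑ ≤
        ENNReal.ofReal (3 * (C3 + W) * B * N) := by
      refine (enorm_integral_le_lintegral_enorm _).trans
        ((setLIntegral_mono' hSm hpt).trans ?_)
      rw [lintegral_const_mul' _ _ ENNReal.ofReal_ne_top, lintegral_add_right _ measurable_const]
      have hA : ∫⁻ z in S, G.indicator (fun z => ENNReal.ofReal (‖z‖ ^ ε * (‖z‖ ^ (m+1))⁻¹)) z ≤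
          ENNReal.ofReal C3 := by
        refine (setLIntegral_le_lintegral _ _).trans ?_
        rw [lintegral_indicator hGm]
        exact bound_E3 ε 1 hε one_pos
      have hBd : ∫⁻ _ in S, (1 : ℝ≥0∞) ≤ ENNReal.ofReal W := by
        rw [setLIntegral_one, hW, ENNReal.ofReal_toReal hΩfin,
          ← vol_reflect hΩo.measurableSet x]
        exact measure_mono fun z hz => hz.1
      calc _ ≤ ENNReal.ofReal (3 * N * B) * (ENNReal.ofReal C3 + ENNReal.ofReal W) := by
            gcongr
        _ = _ := by
            rw [← ENNReal.ofReal_add hC30 hW0, ← ENNReal.ofReal_mul (by positivity)]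
            congr 1; ring
    rw [← ofReal_norm] at henorm
    exact (ENNReal.ofReal_le_ofReal_iff (by positivity)).1 henorm
  have hBN : 0 ≤ B * N := by positivity
  calc _ ≤ 3 * (C3 + W) * B * N + C0 * B * N := add_le_add hpart1 hpart2
    _ ≤ (3 * (C3 + W) + C0 + 1) * B * N := by nlinarith

/-- For a bounded `C^{1+ε}` domain `Ω ⊆ ℝ^n` and an even smooth homogeneous
Calderón–Zygmund operator with kernel `K`, for every `f ∈ Lip(ε,Ω)` the maximal singular
integral satisfies `T*(fχ_Ω)(x) ≤ C ‖T‖_CZ ‖f‖_{ε,Ω}` for all `x ∈ ℝ^n`, with `C = C(n,ε,Ω)`. -/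
theorem statement2 (n : ℕ) (ε : ℝ) (hε0 : 0 < ε) (hε1 : ε < 1)
    (Ω : Set (En n)) (hΩo : IsOpen Ω) (hΩc : IsConnected Ω)
    (hΩb : Bornology.IsBounded Ω) (hΩ : HasC1HolderBoundary n ε Ω) :
    ∃ C : ℝ≥0, 0 < C ∧
      ∀ ω K : En n → ℝ,
        (∀ x, x ≠ 0 → K x = ω x / ‖x‖ ^ n) →
        (∀ t : ℝ, 0 < t → ∀ x, ω (t • x) = ω x) →
        (∀ x, ω (-x) = ω x) →
        ContDiffOn ℝ 1 ω {(0 : En n)}ᶜ →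
        (∫ ξ in sphere (0 : En n) 1, ω ξ ∂μH[(n : ℝ) - 1]) = 0 →
        ∀ f : En n → ℂ, holderNorm ε Ω f ≠ ⊤ →
          ∀ x : En n, ∀ δ : ℝ, 0 < δ →
            ENNReal.ofReal ‖∫ y in {y ∈ Ω | δ < dist y x}, f y * (K (x - y) : ℂ)‖ ≤
              ↑C * czConst n K * holderNorm ε Ω f := by
  obtain ⟨hn, hΩ'⟩ := id hΩ
  obtain ⟨m, rfl⟩ : ∃ m, n = m + 1 := ⟨n - 1, by omega⟩
  obtain ⟨C, hC, hmain⟩ := main_bound hε0 hε1 hΩo hΩc.nonempty hΩb hΩ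
  refine ⟨C.toNNReal, Real.toNNReal_pos.2 hC, fun ω K hK hom heven hω hz f hf x δ hδ => ?_⟩
  by_cases hcz : czConst (m + 1) K = ⊤
  · by_cases hf0 : holderNorm ε Ω f = 0
    · have hz0 : ∫ y in {y ∈ Ω | δ < dist y x}, f y * (K (x - y) : ℂ) = 0 := by
        refine setIntegral_eq_zero_of_forall_eq_zero fun y hy => ?_
        have := holderNorm_bound hf hy.1
        rw [hf0] at this
        have h0 : f y = 0 := by simpa using this
        rw [h0, zero_mul]
      rw [hz0]; simp
    · rw [hcz, ENNReal.mul_top (ENNReal.coe_ne_zero.2 (Real.toNNReal_pos.2 hC).ne'), ENNReal.top_mul hf0]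
      exact le_top
  have hgood : GoodKer (m + 1) K (czConst (m + 1) K).toReal := by
    refine ⟨ENNReal.toReal_nonneg, fun z hz => czConst_bound hcz hz, fun z hz => ?_, ?_, ?_⟩
    · rw [hK z hz, hK (-z) (neg_ne_zero.2 hz), heven, norm_neg]
    · have hc : ContinuousOn (fun z : En (m + 1) => ω z / ‖z‖ ^ (m + 1)) {(0 : En (m + 1))}ᶜ := by
        refine hω.continuousOn.div (by fun_prop) fun z hz => ?_
        have : z ≠ 0 := hz
        positivity
      exact hc.congr fun z hz => hK z hz
    · exact fun I a b hI ha hab =>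
        kernel_zero hn ω K hK hom hω.continuousOn hz I a b hI ha hab
  have := hmain K _ hgood f _ ENNReal.toReal_nonneg (fun y hy => holderNorm_bound hf hy)
    (fun y hy y' hy' => holderNorm_bound' hf hy hy') x δ hδ
  calc _ ≤ ENNReal.ofReal (C * (czConst (m + 1) K).toReal * (holderNorm ε Ω f).toReal) :=
        ENNReal.ofReal_le_ofReal this
    _ = _ := by
        rw [ENNReal.ofReal_mul (by positivity), ENNReal.ofReal_mul hC.le,
          ENNReal.ofReal_toReal hcz, ENNReal.ofReal_toReal hf]
        rfl

end
end

section
/- Let Ω ⊂ ℝ^n be a bounded domain with boundary of class C^{1+ε}, 0 < ε < 1, and let T be an even smooth homogeneous Calderón–Zygmund operator with kernel K. Then for every x ∈ Ω the principal value T(χ_Ω)(x) = lim_{δ→0+} ∫_{y∈Ω, |y−x|>δ} K(x−y) dy exists, and for all x, y ∈ Ω one has |T(χ_Ω)(x) − T(χ_Ω)(y)| ≤ C ‖T‖_CZ |x − y|^ε, where C depends only on n, ε and Ω. -/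
open MeasureTheory Metric Set Filter Topology
open scoped ENNReal NNReal

noncomputable section

theorem slab_vol {n : ℕ} (hn : 0 < n) (ν : En n) (hν : ‖ν‖ = 1) (p : En n) (s t ρ : ℝ)
    (hst : s ≤ t) (hρ : 0 ≤ ρ) :
    volume {z : En n | ‖z - p‖ ≤ ρ ∧ s ≤ inner ℝ ν z ∧ inner ℝ ν z ≤ t}
      ≤ ENNReal.ofReal ((t - s) * (2 * ρ) ^ (n - 1)) := by
  classical
  let i0 : Fin n := ⟨0, hn⟩
  have hfr : Module.finrank ℝ (En n) = Fintype.card (Fin n) := by simp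
  obtain ⟨b, hb⟩ := Orthonormal.exists_orthonormalBasis_extension_of_card_eq (𝕜 := ℝ) (E := En n)
    (ι := Fin n) hfr (v := fun _ => ν) (s := {i0}) (by
      refine ⟨fun i => by simpa using hν, ?_⟩
      intro i j hij
      exact absurd (Subsingleton.elim i j) hij)
  have hb0 : b i0 = ν := hb i0 (by simp)
  let S : Set (Fin n → ℝ) := Set.pi univ (fun j => if j = i0 then Icc s t else
    Icc (b.repr p j - ρ) (b.repr p j + ρ))
  have hSm : MeasurableSet S := by
    refine MeasurableSet.univ_pi fun j => ?_
    split_ifs <;> exact measurableSet_Icc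
  have hmp := (EuclideanSpace.volume_preserving_symm_measurableEquiv_toLp (Fin n)).comp
    b.measurePreserving_repr
  have hsub : {z : En n | ‖z - p‖ ≤ ρ ∧ s ≤ inner ℝ ν z ∧ inner ℝ ν z ≤ t} ⊆
      ((MeasurableEquiv.toLp 2 (Fin n → ℝ)).symm ∘ b.repr) ⁻¹' S := by
    rintro z ⟨h1, h2, h3⟩
    simp only [mem_preimage, S, mem_univ_pi]
    intro j
    have hj : ((MeasurableEquiv.toLp 2 (Fin n → ℝ)).symm ∘ b.repr) z j = b.repr z j := rfl
    rw [hj]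
    split_ifs with h
    · subst h
      rw [b.repr_apply_apply, hb0]
      exact ⟨h2, h3⟩
    · have : |b.repr z j - b.repr p j| ≤ ρ := by
        have e : b.repr z j - b.repr p j = b.repr (z - p) j := by simp
        rw [e, ← Real.norm_eq_abs]
        refine (PiLp.norm_apply_le _ _).trans ?_
        rw [LinearIsometryEquiv.norm_map]
        exact h1
      rw [abs_le] at this
      constructor <;> linarith
  refine (measure_mono hsub).trans ?_
  rw [hmp.measure_preimage hSm.nullMeasurableSet, volume_pi_pi]
  have : ∀ j, volume (if j = i0 then Icc s t else
    Icc (b.repr p j - ρ) (b.repr p j + ρ)) = ENNReal.ofReal (if j = i0 then (t - s) else 2 * ρ) := by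
    intro j
    split_ifs
    · simp
    · rw [Real.volume_Icc]; congr 1; ring
  simp only [this]
  rw [← ENNReal.ofReal_prod_of_nonneg]
  · apply ENNReal.ofReal_le_ofReal
    rw [Finset.prod_ite]
    simp [Finset.filter_eq', Finset.filter_ne', Finset.card_erase_of_mem]
  · intro j _
    split_ifs <;> linarith

theorem dyadic_bound_s3 {n : ℕ} (E : Set (En n)) (x : En n) (a A m k : ℝ) (ha : 0 < a)
    (hA : 0 ≤ A) (hmk : m < k) (hk : 0 ≤ k) (hE : ∀ ρ, a ≤ ρ → volume (E ∩ closedBall x ρ) ≤ ENNReal.ofReal (A * ρ ^ m)) :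
    ∫⁻ z in E ∩ {z | a ≤ ‖x - z‖}, ENNReal.ofReal (‖x - z‖ ^ (-k)) ≤
      ENNReal.ofReal (2 ^ m / (1 - 2 ^ (m - k)) * A * a ^ (m - k)) := by
  let S : ℕ → Set (En n) := fun j => E ∩ {z | 2 ^ j * a ≤ ‖x - z‖ ∧ ‖x - z‖ < 2 ^ (j + 1) * a}
  have hcov : E ∩ {z | a ≤ ‖x - z‖} ⊆ ⋃ j, S j := by
    rintro z ⟨hz, hza⟩
    simp only [mem_setOf_eq] at hza
    obtain ⟨j, h1, h2⟩ := exists_nat_pow_near (x := ‖x - z‖ / a) (y := (2:ℝ)) (by rwa [le_div_iff₀ ha, one_mul]) (by norm_num)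
    rw [le_div_iff₀ ha] at h1
    rw [div_lt_iff₀ ha] at h2
    exact mem_iUnion.2 ⟨j, hz, h1, h2⟩
  have hS : ∀ j, ∫⁻ z in S j, ENNReal.ofReal (‖x - z‖ ^ (-k)) ≤
      ENNReal.ofReal (2 ^ m * A * a ^ (m - k) * (2 ^ (m - k)) ^ j) := by
    intro j
    have hp : (0:ℝ) < 2 ^ j * a := by positivity
    calc ∫⁻ z in S j, ENNReal.ofReal (‖x - z‖ ^ (-k)) 
        ≤ ∫⁻ z in S j, ENNReal.ofReal ((2 ^ j * a) ^ (-k)) := by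
          refine setLIntegral_mono measurable_const ?_
          rintro z ⟨_, h1, h2⟩
          apply ENNReal.ofReal_le_ofReal
          exact Real.rpow_le_rpow_of_nonpos hp h1 (by linarith)
      _ = ENNReal.ofReal ((2 ^ j * a) ^ (-k)) * volume (S j) := by simp
      _ ≤ ENNReal.ofReal ((2 ^ j * a) ^ (-k)) * ENNReal.ofReal (A * (2 ^ (j + 1) * a) ^ m) := by
          gcongr
          refine (measure_mono ?_).trans (hE _ ?_)
          · rintro z ⟨h0, h1, h2⟩
            refine ⟨h0, ?_⟩
            rw [mem_closedBall, dist_comm, dist_eq_norm]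
            exact h2.le
          · have : (1:ℝ) ≤ 2 ^ (j + 1) := one_le_pow₀ (by norm_num)
            nlinarith
      _ = ENNReal.ofReal (2 ^ m * A * a ^ (m - k) * (2 ^ (m - k)) ^ j) := by
          rw [← ENNReal.ofReal_mul (by positivity)]
          congr 1
          rw [pow_succ, Real.mul_rpow (by positivity) ha.le, Real.mul_rpow (by positivity) ha.le,
            Real.mul_rpow (by positivity) (by positivity), ← Real.rpow_natCast, ← Real.rpow_natCast,
            ← Real.rpow_mul (by norm_num), ← Real.rpow_mul (by norm_num), ← Real.rpow_mul (by norm_num)]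
          have e1 : a ^ (m - k) = a ^ m * a ^ (-k) := by rw [← Real.rpow_add ha]; rfl
          have e2 : (2:ℝ) ^ ((m - k) * j) = 2 ^ (j * m) * 2 ^ (j * -k) := by
            rw [← Real.rpow_add (by norm_num)]; congr 1; ring
          rw [e1, e2]; ring
  have hq : (2:ℝ) ^ (m - k) < 1 := Real.rpow_lt_one_of_one_lt_of_neg (by norm_num) (by linarith)
  have hq0 : (0:ℝ) < 2 ^ (m - k) := by positivity
  calc _ ≤ ∫⁻ z in ⋃ j, S j, ENNReal.ofReal (‖x - z‖ ^ (-k)) := lintegral_mono_set hcov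
    _ ≤ ∑' j, ∫⁻ z in S j, ENNReal.ofReal (‖x - z‖ ^ (-k)) := lintegral_iUnion_le _ _
    _ ≤ ∑' j, ENNReal.ofReal (2 ^ m * A * a ^ (m - k) * (2 ^ (m - k)) ^ j) := ENNReal.tsum_le_tsum hS
    _ = ENNReal.ofReal (∑' j : ℕ, (2 ^ m * A * a ^ (m - k) * (2 ^ (m - k)) ^ j)) := by
        rw [ENNReal.ofReal_tsum_of_nonneg]
        · intro j; positivity
        · exact (summable_geometric_of_lt_one hq0.le hq).mul_left _
    _ = _ := by
        rw [tsum_mul_left, tsum_geometric_of_lt_one hq0.le hq]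
        congr 1
        ring

theorem slab_tail {n : ℕ} (hn : 0 < n) (ν : En n) (hν : ‖ν‖ = 1) (s t R : ℝ)
    (hst : s ≤ t) (hR : 0 < R) :
    ∫⁻ z in {z : En n | s ≤ inner ℝ ν z ∧ inner ℝ ν z ≤ t} ∩ {z | R ≤ ‖z‖},
      ENNReal.ofReal ((‖z‖ ^ n)⁻¹)
      ≤ ENNReal.ofReal (2 ^ (2 * n) * (t - s) / R) := by
  have h := dyadic_bound_s3 (n := n) {z : En n | s ≤ inner ℝ ν z ∧ inner ℝ ν z ≤ t} 0 R
    (2 ^ (n - 1) * (t - s)) ((n - 1 : ℕ) : ℝ) n hR (mul_nonneg (by positivity) (by linarith))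
    (by exact_mod_cast Nat.sub_lt hn one_pos) (by positivity) (by
      intro ρ hρ
      refine (measure_mono ?_).trans ((slab_vol hn ν hν 0 s t ρ hst (by linarith)).trans_eq ?_)
      · rintro z ⟨h1, h2⟩
        refine ⟨by simpa using h2, h1⟩
      · congr 1; rw [Real.rpow_natCast, mul_pow]; ring)
  have e : ((n - 1 : ℕ) : ℝ) - n = -1 := by
    rw [Nat.cast_sub hn]; simp
  rw [e] at h
  have e2 : ∀ z : En n, ‖(0:En n) - z‖ ^ (-(n:ℝ)) = (‖z‖ ^ n)⁻¹ := by
    intro z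
    rw [zero_sub, norm_neg, Real.rpow_neg (norm_nonneg _), Real.rpow_natCast]
  simp only [e2] at h
  simp only [zero_sub, norm_neg] at h
  refine h.trans (ENNReal.ofReal_le_ofReal ?_)
  rw [Real.rpow_natCast, Real.rpow_neg_one, Real.rpow_neg_one]
  have : (2:ℝ) ^ (2 * n) = 2 ^ (n - 1) * 2 ^ (n-1) * 4 := by
    obtain ⟨m, rfl⟩ := Nat.exists_eq_succ_of_ne_zero hn.ne'
    simp; ring
  rw [this]
  have h0 : 0 ≤ (2:ℝ) ^ (n - 1) * 2 ^ (n-1) * (t - s) / R := by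
    have : 0 ≤ t - s := by linarith
    positivity
  calc _ = 2 * ((2:ℝ) ^ (n - 1) * 2 ^ (n-1) * (t - s) / R) := by
        norm_num; field_simp
    _ ≤ 4 * ((2:ℝ) ^ (n - 1) * 2 ^ (n-1) * (t - s) / R) := by linarith
    _ = _ := by ring

structure CZ (n : ℕ) (K : En n → ℝ) (N : ℝ) : Prop where
  N0 : 0 ≤ N
  meas : Measurable K
  bd : ∀ z, z ≠ 0 → |K z| ≤ N * (‖z‖ ^ n)⁻¹
  lip : ∀ u v, u ≠ 0 → ‖u - v‖ ≤ ‖u‖ / 2 →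
    |K u - K v| ≤ N * 2 ^ (n + 1) * ‖u - v‖ * (‖u‖ ^ (n + 1))⁻¹
  even : ∀ z, K (-z) = K z
  hom : ∀ t : ℝ, 0 < t → ∀ z, z ≠ 0 → K (t • z) = (t ^ n)⁻¹ * K z
  zero : ∀ J : Set ℝ, MeasurableSet J → (∃ α β : ℝ, 0 < α ∧ J ⊆ Icc α β) →
    ∫ z in {z : En n | ‖z‖ ∈ J}, K z = 0

def pv {n : ℕ} (K : En n → ℝ) (S : Set (En n)) (x : En n) (δ : ℝ) : ℝ :=
  ∫ z in {z ∈ S | δ < dist z x}, K (x - z)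

theorem abs_int_le {n : ℕ} {f g : En n → ℝ} (hf : Measurable f) {S : Set (En n)}
    (hS : MeasurableSet S) {N c : ℝ} (hN : 0 ≤ N) (hc : 0 ≤ c) (hfg : ∀ z ∈ S, |f z| ≤ N * g z)
    (hI : ∫⁻ z in S, ENNReal.ofReal (g z) ≤ ENNReal.ofReal c) :
    IntegrableOn f S ∧ |∫ z in S, f z| ≤ N * c := by
  have h1 : ∫⁻ z in S, ‖f z‖ₑ ≤ ENNReal.ofReal (N * c) := by
    calc ∫⁻ z in S, ‖f z‖ₑ ≤ ∫⁻ z in S, ENNReal.ofReal N * ENNReal.ofReal (g z) := by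
          refine setLIntegral_mono' hS fun z hz => ?_
          rw [← ENNReal.ofReal_mul hN, ← ofReal_norm]
          exact ENNReal.ofReal_le_ofReal (hfg z hz)
      _ = ENNReal.ofReal N * ∫⁻ z in S, ENNReal.ofReal (g z) :=
          lintegral_const_mul' _ _ ENNReal.ofReal_ne_top
      _ ≤ ENNReal.ofReal N * ENNReal.ofReal c := by gcongr
      _ = _ := (ENNReal.ofReal_mul hN).symm
  refine ⟨⟨hf.aestronglyMeasurable, h1.trans_lt ENNReal.ofReal_lt_top⟩, ?_⟩
  have h2 := enorm_integral_le_lintegral_enorm (μ := volume.restrict S) f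
  have h3 := h2.trans h1
  rw [← ofReal_norm, Real.norm_eq_abs] at h3
  exact (ENNReal.ofReal_le_ofReal_iff (by positivity)).1 h3

theorem setInt_shift {n : ℕ} (f : En n → ℝ) (x : En n) (S : Set (En n)) :
    ∫ z in S, f (x - z) = ∫ w in {w | x - w ∈ S}, f w := by
  have h := (Measure.measurePreserving_sub_left (volume : Measure (En n)) x).setIntegral_preimage_emb
    (MeasurableEquiv.subLeft x).measurableEmbedding (fun w => f (w)) {w | x - w ∈ S}
  rw [← h]
  congr 2
  ext z
  simp

namespace CZ
variable {n : ℕ} {K : En n → ℝ} {N : ℝ}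

theorem integrableOn (hK : CZ n K N) (x : En n) {S : Set (En n)} (hS : MeasurableSet S)
    (hfin : volume S ≠ ∞) {δ : ℝ} (hδ : 0 < δ) (hd : ∀ z ∈ S, δ ≤ ‖x - z‖) :
    IntegrableOn (fun z => K (x - z)) S := by
  refine Measure.integrableOn_of_bounded (M := N * (δ ^ n)⁻¹) hfin
    (hK.meas.comp (measurable_const.sub measurable_id)).aestronglyMeasurable ?_
  filter_upwards [ae_restrict_mem hS] with z hz
  have := hd z hz
  have hne : x - z ≠ 0 := by
    intro h; rw [h, norm_zero] at this; linarith
  refine (hK.bd _ hne).trans ?_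
  have := hK.N0
  gcongr

theorem zero_shift (hK : CZ n K N) (x : En n) {J : Set ℝ} (hJ : MeasurableSet J)
    {α β : ℝ} (hα : 0 < α) (hJs : J ⊆ Icc α β) :
    ∫ z in {z : En n | dist z x ∈ J}, K (x - z) = 0 := by
  rw [setInt_shift, ← hK.zero J hJ ⟨α, β, hα, hJs⟩]
  congr 2
  ext w
  simp [dist_eq_norm]

theorem pv_eq (hK : CZ n K N) (x : En n) {S : Set (En n)} (hS : MeasurableSet S)
    (hfin : volume S ≠ ∞) {δ η : ℝ} (hδ : 0 < δ) (hδη : δ ≤ η) (hsub : closedBall x η ⊆ S) :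
    pv K S x δ = pv K S x η := by
  have hm1 : MeasurableSet {z | η < dist z x} := measurableSet_lt measurable_const (by fun_prop)
  have hm2 : MeasurableSet {z : En n | dist z x ∈ Ioc δ η} := by
    have : Measurable (fun z : En n => dist z x) := by fun_prop
    exact this measurableSet_Ioc
  have e : {z ∈ S | δ < dist z x} = {z ∈ S | η < dist z x} ∪ {z | dist z x ∈ Ioc δ η} := by
    ext z
    constructor
    · rintro ⟨h1, h2⟩
      by_cases h : η < dist z x
      · exact Or.inl ⟨h1, h⟩
      · exact Or.inr ⟨h2, not_lt.1 h⟩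
    · rintro (⟨h1, h2⟩ | ⟨h1, h2⟩)
      · exact ⟨h1, hδη.trans_lt h2⟩
      · exact ⟨hsub h2, h1⟩
  have d : Disjoint {z ∈ S | η < dist z x} {z | dist z x ∈ Ioc δ η} := by
    rw [Set.disjoint_left]
    rintro z ⟨_, h2⟩ ⟨_, h3⟩
    exact absurd h2 (not_lt.2 h3)
  unfold pv
  rw [e, setIntegral_union d hm2, hK.zero_shift x measurableSet_Ioc hδ Ioc_subset_Icc_self, add_zero]
  · refine hK.integrableOn x (hS.inter hm1) ?_ (hδ.trans_le hδη) ?_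
    · exact ne_top_of_le_ne_top hfin (measure_mono inter_subset_left)
    · rintro z ⟨_, h⟩
      rw [← dist_eq_norm, dist_comm]; exact le_of_lt h
  · refine hK.integrableOn x hm2 ?_ hδ ?_
    · refine ne_top_of_le_ne_top hfin (measure_mono ?_)
      rintro z ⟨_, h⟩; exact hsub h
    · rintro z ⟨h, _⟩
      rw [← dist_eq_norm, dist_comm]; exact le_of_lt h

theorem meas_inner (ν : En n) : Measurable (fun z : En n => (inner ℝ ν z : ℝ)) := by fun_prop

theorem slab_int (hK : CZ n K N) (hn : 0 < n) {ν : En n} (hν : ‖ν‖ = 1) {s t R : ℝ}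
    (hst : s ≤ t) (hR : 0 < R) {S : Set (En n)} (hS : MeasurableSet S)
    (hsub : ∀ z ∈ S, s ≤ inner ℝ ν z ∧ inner ℝ ν z ≤ t ∧ R ≤ ‖z‖) :
    IntegrableOn K S ∧ |∫ z in S, K z| ≤ N * (2 ^ (2 * n) * (t - s) / R) := by
  have hts : 0 ≤ t - s := by linarith
  refine abs_int_le (g := fun z => (‖z‖ ^ n)⁻¹) hK.meas hS hK.N0 (by positivity) ?_ ?_
  · intro z hz
    refine hK.bd z ?_
    intro h
    have := (hsub z hz).2.2
    rw [h, norm_zero] at this; linarith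
  · refine (lintegral_mono_set ?_).trans (slab_tail hn ν hν s t R hst hR)
    intro z hz
    obtain ⟨h1, h2, h3⟩ := hsub z hz
    exact ⟨⟨h1, h2⟩, h3⟩

theorem half_zero (hK : CZ n K N) (hn : 0 < n) {ν : En n} (hν : ‖ν‖ = 1) {J : Set ℝ}
    (hJ : MeasurableSet J) {α β : ℝ} (hα : 0 < α) (hJs : J ⊆ Icc α β) :
    IntegrableOn K {z : En n | 0 < (inner ℝ ν z : ℝ) ∧ ‖z‖ ∈ J} ∧
    ∫ z in {z : En n | 0 < (inner ℝ ν z : ℝ) ∧ ‖z‖ ∈ J}, K z = 0 := by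
  have mi := meas_inner ν
  have hmJ : MeasurableSet {z : En n | ‖z‖ ∈ J} := measurable_norm hJ
  have hfull : IntegrableOn K {z : En n | ‖z‖ ∈ J} := by
    have h := hK.integrableOn 0 (S := {z : En n | ‖z‖ ∈ J}) hmJ ?_ hα ?_
    · refine h.congr_fun ?_ hmJ
      intro z _; simp [hK.even]
    · refine ne_top_of_le_ne_top (measure_closedBall_lt_top (x := (0 : En n)) (r := β)).ne (measure_mono ?_)
      intro z hz; simpa using (hJs hz).2
    · intro z hz; simpa using (hJs hz).1
  set P := {z : En n | 0 < (inner ℝ ν z : ℝ) ∧ ‖z‖ ∈ J} with hP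
  set Q := {z : En n | (inner ℝ ν z : ℝ) < 0 ∧ ‖z‖ ∈ J} with hQ
  set Z := {z : En n | (inner ℝ ν z : ℝ) = 0 ∧ ‖z‖ ∈ J} with hZ
  have mP : MeasurableSet P := (measurableSet_lt measurable_const mi).inter hmJ
  have mQ : MeasurableSet Q := (measurableSet_lt mi measurable_const).inter hmJ
  have mZ : MeasurableSet Z := (measurableSet_eq_fun mi measurable_const).inter hmJ
  have sP : P ⊆ {z : En n | ‖z‖ ∈ J} := fun z hz => hz.2
  have sQ : Q ⊆ {z : En n | ‖z‖ ∈ J} := fun z hz => hz.2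
  have sZ : Z ⊆ {z : En n | ‖z‖ ∈ J} := fun z hz => hz.2
  refine ⟨hfull.mono_set sP, ?_⟩
  have hZ0 : volume Z = 0 := by
    refine le_antisymm ?_ bot_le
    by_cases hβ : 0 ≤ β
    · refine (measure_mono ?_).trans ((slab_vol hn ν hν 0 0 0 β le_rfl hβ).trans (by simp))
      rintro z ⟨h1, h2⟩
      exact ⟨by simpa using (hJs h2).2, h1.ge, h1.le⟩
    · have : Z = ∅ := by
        rw [Set.eq_empty_iff_forall_notMem]
        rintro z ⟨h1, h2⟩
        have := (hJs h2)
        exact hβ ((hα.le.trans this.1).trans this.2)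
      simp [this]
  have hPQ : ∫ z in Q, K z = ∫ z in P, K z := by
    have h := setInt_shift K 0 P
    simp only [zero_sub, hK.even] at h
    rw [h]
    congr 2
    ext z
    simp [P, Q]
  have hu : {z : En n | ‖z‖ ∈ J} = (P ∪ Q) ∪ Z := by
    ext z
    constructor
    · intro hz
      rcases lt_trichotomy (inner ℝ ν z : ℝ) 0 with h | h | h
      · exact Or.inl (Or.inr ⟨h, hz⟩)
      · exact Or.inr ⟨h, hz⟩
      · exact Or.inl (Or.inl ⟨h, hz⟩)
    · rintro ((h | h) | h) <;> exact h.2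
  have d1 : Disjoint P Q := by
    rw [Set.disjoint_left]; rintro z ⟨h, _⟩ ⟨h', _⟩; exact lt_asymm h h'
  have d2 : Disjoint (P ∪ Q) Z := by
    rw [Set.disjoint_left]; rintro z (⟨h, _⟩ | ⟨h, _⟩) ⟨h', _⟩
    · exact h.ne' h'
    · exact h.ne h'
  have h0 := hK.zero J hJ ⟨α, β, hα, hJs⟩
  rw [hu, setIntegral_union d2 mZ ((hfull.mono_set sP).union (hfull.mono_set sQ)) (hfull.mono_set sZ),
    setIntegral_union d1 mQ (hfull.mono_set sP) (hfull.mono_set sQ), hPQ,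
    Measure.restrict_eq_zero.2 hZ0] at h0
  simp at h0
  linarith

def Phi (K : En n → ℝ) (ν : En n) (s t : ℝ) : ℝ :=
  ∫ z in {z : En n | s ≤ (inner ℝ ν z : ℝ) ∧ (inner ℝ ν z : ℝ) < t}, K z

theorem meas_slab (ν : En n) (s t : ℝ) :
    MeasurableSet {z : En n | s ≤ (inner ℝ ν z : ℝ) ∧ (inner ℝ ν z : ℝ) < t} :=
  (measurableSet_le measurable_const (meas_inner ν)).inter
    (measurableSet_lt (meas_inner ν) measurable_const)

theorem inner_le_norm' {ν : En n} (hν : ‖ν‖ = 1) (z : En n) : (inner ℝ ν z : ℝ) ≤ ‖z‖ := by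
  have := real_inner_le_norm ν z
  rwa [hν, one_mul] at this

theorem slab_integrable (hK : CZ n K N) (hn : 0 < n) {ν : En n} (hν : ‖ν‖ = 1) {s t : ℝ}
    (hs : 0 < s) (hst : s ≤ t) :
    IntegrableOn K {z : En n | s ≤ (inner ℝ ν z : ℝ) ∧ (inner ℝ ν z : ℝ) < t} :=
  (hK.slab_int hn hν hst hs (meas_slab ν s t)
    fun z hz => ⟨hz.1, hz.2.le, hz.1.trans (inner_le_norm' hν z)⟩).1

theorem Phi_add (hK : CZ n K N) (hn : 0 < n) {ν : En n} (hν : ‖ν‖ = 1) {s t u : ℝ}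
    (hs : 0 < s) (hst : s ≤ t) (htu : t ≤ u) : Phi K ν s u = Phi K ν s t + Phi K ν t u := by
  unfold Phi
  rw [← setIntegral_union _ (meas_slab ν t u) (hK.slab_integrable hn hν hs hst)
    (hK.slab_integrable hn hν (hs.trans_le hst) htu)]
  · congr 2
    ext z
    constructor
    · rintro ⟨h1, h2⟩
      by_cases h : (inner ℝ ν z : ℝ) < t
      · exact Or.inl ⟨h1, h⟩
      · exact Or.inr ⟨not_lt.1 h, h2⟩
    · rintro (⟨h1, h2⟩ | ⟨h1, h2⟩)
      · exact ⟨h1, h2.trans_le htu⟩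
      · exact ⟨hst.trans h1, h2⟩
  · rw [Set.disjoint_left]
    rintro z ⟨_, h⟩ ⟨h', _⟩
    exact absurd h (not_lt.2 h')

open Pointwise in
theorem Phi_smul (hK : CZ n K N) {ν : En n} {s t l : ℝ} (hs : 0 < s)
    (hl : 0 < l) : Phi K ν (l * s) (l * t) = Phi K ν s t := by
  unfold Phi
  have h := Measure.setIntegral_comp_smul_of_pos (volume : Measure (En n)) K
    {z : En n | s ≤ (inner ℝ ν z : ℝ) ∧ (inner ℝ ν z : ℝ) < t} hl
  have e : l • {z : En n | s ≤ (inner ℝ ν z : ℝ) ∧ (inner ℝ ν z : ℝ) < t} =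
     {z : En n | l * s ≤ (inner ℝ ν z : ℝ) ∧ (inner ℝ ν z : ℝ) < l * t} := by
    ext z
    rw [mem_smul_set_iff_inv_smul_mem₀ hl.ne']
    simp only [mem_setOf_eq, inner_smul_right]
    rw [le_inv_mul_iff₀ hl, inv_mul_lt_iff₀ hl]
  rw [e] at h
  have h2 : ∫ z in {z : En n | s ≤ (inner ℝ ν z : ℝ) ∧ (inner ℝ ν z : ℝ) < t}, K (l • z) =
    ∫ z in {z : En n | s ≤ (inner ℝ ν z : ℝ) ∧ (inner ℝ ν z : ℝ) < t}, (l ^ n)⁻¹ * K z := by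
    refine setIntegral_congr_fun (meas_slab ν s t) fun z hz => hK.hom l hl z ?_
    rintro rfl
    have := hz.1
    simp at this; linarith
  rw [h2, integral_const_mul] at h
  simp at h
  rcases h with h | h
  · exact h.symm
  · exact absurd h.1 hl.ne'

theorem Phi_bound (hK : CZ n K N) (hn : 0 < n) {ν : En n} (hν : ‖ν‖ = 1) {L : ℝ}
    (hL : 1 ≤ L) : |Phi K ν 1 L| ≤ 2 * (N * 2 ^ (2 * n)) := by
  set A := {z : En n | 1 ≤ (inner ℝ ν z : ℝ) ∧ (inner ℝ ν z : ℝ) < L} with hA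
  set B := {z : En n | 0 < (inner ℝ ν z : ℝ) ∧ ‖z‖ ∈ Ico 1 L} with hB
  have hL0 : 0 < L := by linarith
  obtain ⟨iB, zB⟩ := hK.half_zero hn hν (J := Ico 1 L) measurableSet_Ico one_pos Ico_subset_Icc_self
  have mA : MeasurableSet A := meas_slab ν 1 L
  have mB : MeasurableSet B := (measurableSet_lt measurable_const (meas_inner ν)).inter
    (measurable_norm measurableSet_Ico)
  have iA : IntegrableOn K A := hK.slab_integrable hn hν one_pos hL
  have e1 := integral_inter_add_sdiff mB iA
  have e2 := integral_inter_add_sdiff mA iB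
  rw [inter_comm] at e2
  obtain ⟨-, b1⟩ := hK.slab_int hn hν (s := 0) (t := L) (R := L) hL0.le hL0 (mA.diff mB) (by
    rintro z ⟨h1, h2⟩
    refine ⟨zero_le_one.trans h1.1, h1.2.le, ?_⟩
    by_contra h
    exact h2 ⟨one_pos.trans_le h1.1, h1.1.trans (inner_le_norm' hν z), not_le.1 h⟩)
  obtain ⟨-, b2⟩ := hK.slab_int hn hν (s := 0) (t := 1) (R := 1) zero_le_one one_pos (mB.diff mA) (by
    rintro z ⟨h1, h2⟩
    refine ⟨h1.1.le, ?_, h1.2.1⟩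
    by_contra h
    exact h2 ⟨(not_le.1 h).le, (inner_le_norm' hν z).trans_lt h1.2.2⟩)
  have : Phi K ν 1 L = ∫ z in A, K z := rfl
  rw [this]
  have q1 : (2:ℝ) ^ (2 * n) * (L - 0) / L = 2 ^ (2 * n) := by field_simp; ring
  have q2 : (2:ℝ) ^ (2 * n) * (1 - 0) / 1 = 2 ^ (2 * n) := by ring
  rw [q1] at b1
  rw [q2] at b2
  have : ∫ z in A, K z = (∫ z in A \ B, K z) - ∫ z in B \ A, K z := by linarith
  rw [this]
  refine (abs_sub _ _).trans ?_
  linarith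

theorem Phi_pow (hK : CZ n K N) (hn : 0 < n) {ν : En n} (hν : ‖ν‖ = 1) {L : ℝ}
    (hL : 1 ≤ L) (k : ℕ) : Phi K ν 1 (L ^ k) = k * Phi K ν 1 L := by
  induction k with
  | zero =>
    have : {z : En n | 1 ≤ (inner ℝ ν z : ℝ) ∧ (inner ℝ ν z : ℝ) < 1} = ∅ := by
      ext z; simp
    simp [Phi, this]
  | succ k ih =>
    have h1 : 1 ≤ L ^ k := one_le_pow₀ hL
    rw [hK.Phi_add hn hν one_pos h1 (t := L ^ k) (by rw [pow_succ]; nlinarith), ih]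
    have := hK.Phi_smul (ν := ν) (s := 1) (t := L) (l := L ^ k) one_pos (by positivity)
    rw [mul_one, ← pow_succ] at this
    rw [this]; push_cast; ring

theorem Phi_zero (hK : CZ n K N) (hn : 0 < n) {ν : En n} (hν : ‖ν‖ = 1) {s t : ℝ}
    (hs : 0 < s) (hst : s ≤ t) : Phi K ν s t = 0 := by
  have hL : 1 ≤ t / s := by rwa [le_div_iff₀ hs, one_mul]
  have h := hK.Phi_smul (ν := ν) (s := 1) (t := t / s) one_pos hs
  rw [mul_one, mul_div_cancel₀ _ hs.ne'] at h
  rw [h]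
  by_contra hne
  have hpos : 0 < |Phi K ν 1 (t / s)| := abs_pos.2 hne
  obtain ⟨k, hk⟩ := exists_nat_gt (2 * (N * 2 ^ (2 * n)) / |Phi K ν 1 (t / s)|)
  rw [div_lt_iff₀ hpos] at hk
  have h1 := hK.Phi_bound hn hν (L := (t / s) ^ k) (one_le_pow₀ hL)
  rw [hK.Phi_pow hn hν hL, abs_mul, Nat.abs_cast] at h1
  linarith

theorem slab_cut (hK : CZ n K N) (hn : 0 < n) {ν : En n} (hν : ‖ν‖ = 1) {s t R : ℝ}
    (hs : 0 < s) (hst : s ≤ t) (hR : 0 < R) :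
    |∫ z in {z : En n | (s ≤ (inner ℝ ν z : ℝ) ∧ (inner ℝ ν z : ℝ) < t) ∧ ‖z‖ < R}, K z|
      ≤ N * (2 ^ (2 * n) * (t - s) / R) := by
  set A := {z : En n | s ≤ (inner ℝ ν z : ℝ) ∧ (inner ℝ ν z : ℝ) < t} with hA
  have mA : MeasurableSet A := meas_slab ν s t
  have mB : MeasurableSet {z : En n | ‖z‖ < R} := measurableSet_lt measurable_norm measurable_const
  have e := integral_inter_add_sdiff mB (hK.slab_integrable hn hν hs hst)
  have z0 := hK.Phi_zero hn hν hs hst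
  unfold Phi at z0
  rw [z0] at e
  obtain ⟨-, b⟩ := hK.slab_int hn hν hst hR (mA.diff mB) (by
    rintro z ⟨h1, h2⟩
    exact ⟨h1.1, h1.2.le, not_lt.1 h2⟩)
  have : ∫ z in A ∩ {z : En n | ‖z‖ < R}, K z = - ∫ z in A \ {z : En n | ‖z‖ < R}, K z := by linarith
  have h2 : {z : En n | (s ≤ (inner ℝ ν z : ℝ) ∧ (inner ℝ ν z : ℝ) < t) ∧ ‖z‖ < R} = A ∩ {z : En n | ‖z‖ < R} := rfl
  rw [h2, this, abs_neg]
  exact b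

end CZ

theorem pow_sub_le {a b : ℝ} (hb : 0 ≤ b) (hab : b ≤ a) (k : ℕ) :
    a ^ (k + 1) - b ^ (k + 1) ≤ (k + 1) * a ^ k * (a - b) := by
  induction k with
  | zero => simp
  | succ k ih =>
    have ha : 0 ≤ a := hb.trans hab
    have h1 : b ^ (k + 1) ≤ a ^ (k + 1) := pow_le_pow_left₀ hb hab _
    have h2 := mul_le_mul_of_nonneg_left ih ha
    have h3 := mul_le_mul_of_nonneg_right h1 (sub_nonneg.2 hab)
    push_cast
    calc a ^ (k + 1 + 1) - b ^ (k + 1 + 1) = a * (a ^ (k + 1) - b ^ (k + 1)) + b ^ (k + 1) * (a - b) := by ring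
      _ ≤ a * ((k + 1) * a ^ k * (a - b)) + a ^ (k + 1) * (a - b) := add_le_add h2 h3
      _ = _ := by ring

def vball (n : ℕ) : ℝ := (volume (ball (0 : En n) 1)).toReal

theorem vball_nonneg (n : ℕ) : 0 ≤ vball n := ENNReal.toReal_nonneg

theorem vol_ball {n : ℕ} (hn : 0 < n) (x : En n) {r : ℝ} (hr : 0 ≤ r) :
    volume (ball x r) = ENNReal.ofReal (r ^ n * vball n) := by
  haveI : Nonempty (Fin n) := ⟨⟨0, hn⟩⟩
  rw [Measure.addHaar_ball _ _ hr, ENNReal.ofReal_mul (by positivity), vball,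
    ENNReal.ofReal_toReal measure_ball_lt_top.ne]
  simp

def shellC (n : ℕ) (R : ℝ) : ℝ := ((R / 2) ^ n)⁻¹ * (n * (2 * R) ^ (n - 1) * 2 * vball n)

theorem shellC_nonneg (n : ℕ) {R : ℝ} (hR : 0 ≤ R) : 0 ≤ shellC n R := by
  have := vball_nonneg n
  unfold shellC; positivity

theorem shell_vol {n : ℕ} (hn : 0 < n) (y : En n) {R h : ℝ} (h0 : 0 ≤ h) (hR : h ≤ R / 2) :
    volume {z : En n | R - h ≤ dist z y ∧ dist z y < R + h} ≤
      ENNReal.ofReal (n * (2 * R) ^ (n - 1) * 2 * vball n * h) := by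
  have hR0 : 0 ≤ R := by linarith
  have e : {z : En n | R - h ≤ dist z y ∧ dist z y < R + h} = ball y (R + h) \ ball y (R - h) := by
    ext z; simp [and_comm]
  rw [e, measure_sdiff (ball_subset_ball (by linarith)) measurableSet_ball.nullMeasurableSet
    measure_ball_lt_top.ne, vol_ball hn y (by linarith), vol_ball hn y (by linarith),
    ← ENNReal.ofReal_sub _ (by have := vball_nonneg n; have : 0 ≤ R - h := by linarith
                               positivity)]
  apply ENNReal.ofReal_le_ofReal
  rw [← sub_mul]
  obtain ⟨k, rfl⟩ := Nat.exists_eq_succ_of_ne_zero hn.ne'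
  have h1 := pow_sub_le (a := R + h) (b := R - h) (by linarith) (by linarith) k
  have h2 : (R + h) ^ k ≤ (2 * R) ^ k := pow_le_pow_left₀ (by linarith) (by linarith) _
  have h3 := vball_nonneg (k + 1)
  calc _ ≤ ((k + 1) * (R + h) ^ k * (R + h - (R - h))) * vball (k + 1) :=
        mul_le_mul_of_nonneg_right h1 h3
    _ = ((k + 1) * (R + h) ^ k * (2 * h)) * vball (k + 1) := by ring
    _ ≤ ((k + 1) * (2 * R) ^ k * (2 * h)) * vball (k + 1) := by gcongr
    _ = _ := by simp; ring

namespace CZ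
variable {n : ℕ} {K : En n → ℝ} {N : ℝ}

theorem int_sub_le {f : En n → ℝ} {S T : Set (En n)} (mS : MeasurableSet S) (mT : MeasurableSet T)
    (iS : IntegrableOn f S) (iT : IntegrableOn f T) {c : ℝ}
    (h1 : |∫ z in S \ T, f z| ≤ c) (h2 : |∫ z in T \ S, f z| ≤ c) :
    |(∫ z in S, f z) - ∫ z in T, f z| ≤ 2 * c := by
  have e1 := integral_inter_add_sdiff mT iS
  have e2 := integral_inter_add_sdiff mS iT
  rw [inter_comm] at e2
  have : (∫ z in S, f z) - ∫ z in T, f z = (∫ z in S \ T, f z) - ∫ z in T \ S, f z := by linarith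
  rw [this]
  refine (abs_sub _ _).trans ?_
  linarith

theorem meas_shift (hK : CZ n K N) (x : En n) : Measurable (fun z => K (x - z)) :=
  hK.meas.comp (measurable_const.sub measurable_id)

theorem meas_gt (x : En n) (δ : ℝ) : MeasurableSet {z : En n | δ < dist z x} :=
  measurableSet_lt measurable_const (by fun_prop)

theorem pv_integrable (hK : CZ n K N) (x : En n) {S : Set (En n)} (hS : MeasurableSet S)
    (hfin : volume S ≠ ∞) {δ : ℝ} (hδ : 0 < δ) :
    IntegrableOn (fun z => K (x - z)) {z ∈ S | δ < dist z x} := by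
  refine hK.integrableOn x (hS.inter (meas_gt x δ)) ?_ hδ ?_
  · exact ne_top_of_le_ne_top hfin (measure_mono inter_subset_left)
  · rintro z ⟨_, h⟩
    rw [← dist_eq_norm, dist_comm]; exact le_of_lt h

theorem shell (hK : CZ n K N) (hn : 0 < n) {x y : En n} {R δ : ℝ} (hR : 0 < R) (hδ : 0 < δ)
    (hxy : ‖x - y‖ ≤ R / 2) {H : Set (En n)} (mH : MeasurableSet H) :
    |pv K (H ∩ ball x R) y δ - pv K (H ∩ ball y R) y δ| ≤ 2 * (N * (shellC n R * ‖x - y‖)) := by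
  have hdist : dist x y = ‖x - y‖ := dist_eq_norm _ _
  have fin : ∀ w : En n, volume (H ∩ ball w R) ≠ ∞ := fun w =>
    ne_top_of_le_ne_top measure_ball_lt_top.ne (measure_mono inter_subset_right)
  have m : ∀ w : En n, MeasurableSet {z ∈ H ∩ ball w R | δ < dist z y} := fun w =>
    (mH.inter measurableSet_ball).inter (meas_gt y δ)
  have key : ∀ S : Set (En n), MeasurableSet S →
      S ⊆ {z : En n | R - ‖x - y‖ ≤ dist z y ∧ dist z y < R + ‖x - y‖} →
      |∫ z in S, K (y - z)| ≤ N * (shellC n R * ‖x - y‖) := by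
    intro S mS hS
    refine (abs_int_le (g := fun _ => ((R / 2) ^ n)⁻¹) (hK.meas_shift y) mS hK.N0 ?_ ?_ ?_).2
    · have := shellC_nonneg n hR.le
      positivity
    · intro z hz
      have h1 := (hS hz).1
      rw [dist_comm, dist_eq_norm] at h1
      refine (hK.bd _ ?_).trans ?_
      · intro h
        rw [h, norm_zero] at h1; linarith
      · have := hK.N0
        gcongr
        linarith
    · rw [setLIntegral_const, shellC, mul_assoc, ENNReal.ofReal_mul (by positivity)]
      gcongr
      refine (measure_mono hS).trans ((shell_vol hn y (norm_nonneg _) hxy).trans_eq ?_)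
      rfl
  unfold pv
  refine int_sub_le (m x) (m y) (hK.pv_integrable y (mH.inter measurableSet_ball) (fin x) hδ)
    (hK.pv_integrable y (mH.inter measurableSet_ball) (fin y) hδ) (key _ ((m x).diff (m y)) ?_)
    (key _ ((m y).diff (m x)) ?_)
  · rintro z ⟨⟨⟨h1, h2⟩, h3⟩, h4⟩
    rw [mem_ball] at h2
    have : R ≤ dist z y := by
      by_contra h
      exact h4 ⟨⟨h1, not_le.1 h⟩, h3⟩
    have := dist_triangle z x y
    have := norm_nonneg (x - y)
    constructor <;> linarith
  · rintro z ⟨⟨⟨h1, h2⟩, h3⟩, h4⟩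
    rw [mem_ball] at h2
    have : R ≤ dist z x := by
      by_contra h
      exact h4 ⟨⟨h1, not_le.1 h⟩, h3⟩
    have := dist_triangle z y x
    rw [dist_comm y x] at this
    have := norm_nonneg (x - y)
    constructor <;> linarith

theorem split_y (hK : CZ n K N) {x y : En n} {η : ℝ} (hη : 0 < η) (hxy : ‖x - y‖ ≤ η / 2)
    {S : Set (En n)} (mS : MeasurableSet S) (fS : volume S ≠ ∞) (bS : closedBall x η ⊆ S) :
    pv K S y (η / 2) = (∫ z in {z ∈ S | η < dist z x}, K (y - z)) +
      ∫ z in {z ∈ closedBall x η | η / 2 < dist z y}, K (y - z) := by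
  unfold pv
  have hdist : dist x y = ‖x - y‖ := dist_eq_norm _ _
  have mB : MeasurableSet {z ∈ closedBall x η | η / 2 < dist z y} :=
    measurableSet_closedBall.inter (meas_gt y _)
  have e : {z ∈ S | η / 2 < dist z y} = {z ∈ S | η < dist z x} ∪
     {z ∈ closedBall x η | η / 2 < dist z y} := by
    ext z
    constructor
    · rintro ⟨h1, h2⟩
      by_cases h : η < dist z x
      · exact Or.inl ⟨h1, h⟩
      · exact Or.inr ⟨not_lt.1 h, h2⟩
    · rintro (⟨h1, h2⟩ | ⟨h1, h2⟩)
      · refine ⟨h1, ?_⟩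
        have := dist_triangle z y x
        rw [dist_comm y x] at this
        linarith
      · exact ⟨bS h1, h2⟩
  have i := hK.pv_integrable y mS fS (half_pos hη)
  rw [e] at i ⊢
  refine setIntegral_union ?_ mB (i.mono_set subset_union_left) (i.mono_set subset_union_right)
  rw [Set.disjoint_left]
  rintro z ⟨_, h⟩ ⟨h', _⟩
  exact absurd h (not_lt.2 h')

theorem comp (hK : CZ n K N) {x y : En n} {η : ℝ} (hη : 0 < η) (hxy : ‖x - y‖ ≤ η / 2)
    {Ω D : Set (En n)} (mΩ : MeasurableSet Ω) (fΩ : volume Ω ≠ ∞) (bΩ : closedBall x η ⊆ Ω)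
    (mD : MeasurableSet D) (fD : volume D ≠ ∞) (bD : closedBall x η ⊆ D) {c : ℝ} (hc : 0 ≤ c)
    (hI : ∫⁻ z in ((Ω \ D) ∪ (D \ Ω)) ∩ {z | η ≤ ‖x - z‖},
      ENNReal.ofReal (‖x - z‖ ^ (-((n : ℝ) + 1))) ≤ ENNReal.ofReal c) :
    |(pv K Ω x η - pv K Ω y (η / 2)) - (pv K D x η - pv K D y (η / 2))| ≤
      2 * (N * 2 ^ (n + 1) * ‖x - y‖ * c) := by
  have hN := hK.N0
  have hdist : dist x y = ‖x - y‖ := dist_eq_norm _ _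
  have diff : ∀ S : Set (En n), MeasurableSet S → volume S ≠ ∞ → closedBall x η ⊆ S →
      IntegrableOn (fun z => K (x - z) - K (y - z)) {z ∈ S | η < dist z x} ∧
      pv K S x η - pv K S y (η / 2) = (∫ z in {z ∈ S | η < dist z x}, (K (x - z) - K (y - z))) -
        ∫ z in {z ∈ closedBall x η | η / 2 < dist z y}, K (y - z) := by
    intro S mS fS bS
    have i1 := hK.pv_integrable x mS fS hη
    have i2 : IntegrableOn (fun z => K (y - z)) {z ∈ S | η < dist z x} := by
      refine (hK.pv_integrable y mS fS (half_pos hη)).mono_set ?_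
      rintro z ⟨h1, h2⟩
      refine ⟨h1, ?_⟩
      have := dist_triangle z y x
      rw [dist_comm y x] at this
      linarith
    refine ⟨i1.sub i2, ?_⟩
    rw [hK.split_y hη hxy mS fS bS, integral_sub i1 i2, pv]
    ring
  obtain ⟨iΩ, eΩ⟩ := diff Ω mΩ fΩ bΩ
  obtain ⟨iD, eD⟩ := diff D mD fD bD
  rw [eΩ, eD, sub_sub_sub_cancel_right]
  have key : ∀ S : Set (En n), MeasurableSet S → S ⊆ ((Ω \ D) ∪ (D \ Ω)) ∩ {z | η < dist z x} →
      |∫ z in S, (K (x - z) - K (y - z))| ≤ N * 2 ^ (n + 1) * ‖x - y‖ * c := by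
    intro S mS hS
    refine (abs_int_le (g := fun z => ‖x - z‖ ^ (-((n : ℝ) + 1)))
      ((hK.meas_shift x).sub (hK.meas_shift y)) mS (by positivity) hc ?_ ?_).2
    · intro z hz
      have h1 := (hS hz).2
      simp only [mem_setOf_eq] at h1
      rw [dist_comm, dist_eq_norm] at h1
      have e1 : (x - z) - (y - z) = x - y := by abel
      have h2 := hK.lip (x - z) (y - z) (by
        intro h; rw [h, norm_zero] at h1; linarith) (by rw [e1]; linarith)
      rw [e1] at h2
      rw [Real.rpow_neg (norm_nonneg _)]
      exact_mod_cast h2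
    · refine (lintegral_mono_set ?_).trans hI
      intro z hz
      refine ⟨(hS hz).1, ?_⟩
      have h1 := (hS hz).2
      simp only [mem_setOf_eq] at h1 ⊢
      rw [dist_comm, dist_eq_norm] at h1
      exact h1.le
  have m : ∀ S : Set (En n), MeasurableSet S → MeasurableSet {z ∈ S | η < dist z x} :=
    fun S mS => mS.inter (meas_gt x η)
  refine int_sub_le (m Ω mΩ) (m D mD) iΩ iD (key _ ((m Ω mΩ).diff (m D mD)) ?_)
    (key _ ((m D mD).diff (m Ω mΩ)) ?_)
  · rintro z ⟨⟨h1, h2⟩, h3⟩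
    exact ⟨Or.inl ⟨h1, fun h => h3 ⟨h, h2⟩⟩, h2⟩
  · rintro z ⟨⟨h1, h2⟩, h3⟩
    exact ⟨Or.inr ⟨h1, fun h => h3 ⟨h, h2⟩⟩, h2⟩

end CZ

namespace CZ
variable {n : ℕ} {K : En n → ℝ} {N : ℝ}

theorem ball_zero (hK : CZ n K N) (x : En n) {R δ : ℝ} (hδ : 0 < δ) :
    pv K (univ ∩ ball x R) x δ = 0 := by
  unfold pv
  rw [← hK.zero_shift x (J := Ioo δ R) measurableSet_Ioo hδ Ioo_subset_Icc_self]
  congr 2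
  ext z
  simp [and_comm]

theorem half_pv (K : En n → ℝ) (ν : En n) (b : ℝ) (x : En n) (R δ : ℝ) :
    pv K ({z | b < inner ℝ ν z} ∩ ball x R) x δ =
    ∫ w in {w : En n | (inner ℝ ν w : ℝ) < inner ℝ ν x - b ∧ δ < ‖w‖ ∧ ‖w‖ < R}, K w := by
  unfold pv
  rw [setInt_shift]
  congr 2
  ext w
  have h1 : dist (x - w) x = ‖w‖ := by simp [dist_eq_norm]
  have h2 : b < (inner ℝ ν (x - w) : ℝ) ↔ (inner ℝ ν w : ℝ) < inner ℝ ν x - b := by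
    rw [inner_sub_right]; constructor <;> intro h <;> linarith
  constructor
  · rintro ⟨⟨h3, h4⟩, h5⟩
    rw [mem_ball, h1] at h4
    rw [h1] at h5
    exact ⟨h2.1 h3, h5, h4⟩
  · rintro ⟨h3, h4, h5⟩
    refine ⟨⟨h2.2 h3, ?_⟩, ?_⟩
    · rw [mem_ball, h1]; exact h5
    · rw [h1]; exact h4

theorem halfdiff_aux (hK : CZ n K N) (hn : 0 < n) {ν : En n} (hν : ‖ν‖ = 1) {b δ R : ℝ} (x y : En n)
    (hδ : 0 < δ) (hR : 0 < R) (hy : δ < inner ℝ ν y - b)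
    (hxy : (inner ℝ ν y : ℝ) ≤ inner ℝ ν x) :
    |pv K ({z | b < inner ℝ ν z} ∩ ball x R) x δ - pv K ({z | b < inner ℝ ν z} ∩ ball y R) y δ| ≤
      N * (2 ^ (2 * n) * ‖x - y‖ / R) := by
  rw [half_pv, half_pv]
  set A := {w : En n | (inner ℝ ν w : ℝ) < inner ℝ ν x - b ∧ δ < ‖w‖ ∧ ‖w‖ < R} with hA
  set B := {w : En n | (inner ℝ ν w : ℝ) < inner ℝ ν y - b ∧ δ < ‖w‖ ∧ ‖w‖ < R} with hB
  have mB : MeasurableSet B := (measurableSet_lt (meas_inner ν) measurable_const).inter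
    ((measurableSet_lt measurable_const measurable_norm).inter
      (measurableSet_lt measurable_norm measurable_const))
  have mA : MeasurableSet A := (measurableSet_lt (meas_inner ν) measurable_const).inter
    ((measurableSet_lt measurable_const measurable_norm).inter
      (measurableSet_lt measurable_norm measurable_const))
  have iA : IntegrableOn K A := by
    have h := hK.integrableOn 0 (S := A) mA ?_ hδ ?_
    · refine h.congr_fun ?_ mA
      intro z _; simp [hK.even]
    · refine ne_top_of_le_ne_top (measure_ball_lt_top (x := (0 : En n)) (r := R)).ne (measure_mono ?_)
      intro z hz; simpa using hz.2.2
    · intro z hz; simpa using hz.2.1.le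
  have hBA : B ⊆ A := by
    rintro w ⟨h1, h2⟩
    exact ⟨by linarith, h2⟩
  have e := integral_inter_add_sdiff mB iA
  rw [inter_eq_right.2 hBA] at e
  have e2 : (∫ w in A, K w) - ∫ w in B, K w = ∫ w in A \ B, K w := by linarith
  have e3 : A \ B = {z : En n | (inner ℝ ν y - b ≤ (inner ℝ ν z : ℝ) ∧
      (inner ℝ ν z : ℝ) < inner ℝ ν x - b) ∧ ‖z‖ < R} := by
    ext w
    constructor
    · rintro ⟨⟨h1, h2, h3⟩, h4⟩
      refine ⟨⟨?_, h1⟩, h3⟩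
      by_contra h
      exact h4 ⟨not_le.1 h, h2, h3⟩
    · rintro ⟨⟨h1, h2⟩, h3⟩
      have := inner_le_norm' hν w
      refine ⟨⟨h2, by linarith, h3⟩, fun h => ?_⟩
      exact absurd h.1 (not_lt.2 h1)
  rw [e2, e3]
  refine (hK.slab_cut hn hν (by linarith) (by linarith) hR).trans ?_
  have h1 : (inner ℝ ν x - b) - (inner ℝ ν y - b) ≤ ‖x - y‖ := by
    have := inner_le_norm' hν (x - y)
    rw [inner_sub_right] at this
    linarith
  have := hK.N0
  gcongr

theorem halfdiff (hK : CZ n K N) (hn : 0 < n) {ν : En n} (hν : ‖ν‖ = 1) {b δ R : ℝ} (x y : En n)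
    (hδ : 0 < δ) (hR : 0 < R) (hx : δ < inner ℝ ν x - b) (hy : δ < inner ℝ ν y - b) :
    |pv K ({z | b < inner ℝ ν z} ∩ ball x R) x δ - pv K ({z | b < inner ℝ ν z} ∩ ball y R) y δ| ≤
      N * (2 ^ (2 * n) * ‖x - y‖ / R) := by
  rcases le_total (inner ℝ ν y : ℝ) (inner ℝ ν x) with h | h
  · exact hK.halfdiff_aux hn hν x y hδ hR hy h
  · rw [abs_sub_comm, norm_sub_rev]
    exact hK.halfdiff_aux hn hν y x hδ hR hx h

end CZ

/-- `g` is the principal value function of `K` over `Ω`. -/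
def IsPV {n : ℕ} (K : En n → ℝ) (Ω : Set (En n)) (g : En n → ℝ) : Prop :=
  ∀ x η, 0 < η → closedBall x η ⊆ Ω → g x = pv K Ω x η

theorem le_rpow_self {h ε : ℝ} (h0 : 0 ≤ h) (h1 : h ≤ 1) (hε : ε ≤ 1) : h ≤ h ^ ε := by
  rcases h0.eq_or_lt with rfl | h0
  · positivity
  · calc h = h ^ (1:ℝ) := (Real.rpow_one h).symm
      _ ≤ h ^ ε := Real.rpow_le_rpow_of_exponent_ge h0 h1 hε

theorem interior_local {n : ℕ} (hn : 0 < n) {ε : ℝ} (hε1 : ε < 1) {Ω : Set (En n)} (hΩo : IsOpen Ω)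
    (fΩ : volume Ω ≠ ∞) {a : En n} (ha : a ∈ Ω) :
    ∃ ρ > 0, ∃ C ≥ 0, ∀ K N g, CZ n K N → IsPV K Ω g → ∀ x ∈ Ω ∩ ball a ρ, ∀ y ∈ Ω ∩ ball a ρ,
      |g x - g y| ≤ C * N * ‖x - y‖ ^ ε := by
  obtain ⟨R0, hR0, hsub0⟩ := nhds_basis_closedBall.mem_iff.1 (hΩo.mem_nhds ha)
  let R := min (R0 / 2) 1
  have hR : 0 < R := lt_min (by linarith) one_pos
  have hR1 : R ≤ 1 := min_le_right _ _
  have hRR : R ≤ R0 / 2 := min_le_left _ _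
  let c := R ^ (-((n:ℝ) + 1)) * (volume Ω).toReal
  have hc : 0 ≤ c := by positivity
  have hsh := shellC_nonneg n hR.le
  refine ⟨R / 8, by positivity, 2 * (2 ^ (n + 1) * c) + 2 * shellC n R, by positivity, ?_⟩
  rintro K N g hK hg x ⟨hx, hxa⟩ y ⟨hy, hya⟩
  rw [mem_ball] at hxa hya
  have hxy : dist x y < R / 4 := by
    have := dist_triangle_right x y a
    linarith
  rw [dist_eq_norm] at hxy
  have hbx : closedBall x R ⊆ Ω := by
    refine Subset.trans (closedBall_subset_closedBall' ?_) hsub0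
    linarith
  have hη : closedBall x (R / 2) ⊆ Ω := (closedBall_subset_closedBall (by linarith)).trans hbx
  have hηy : closedBall y (R / 2 / 2) ⊆ Ω := by
    refine Subset.trans (closedBall_subset_closedBall' ?_) hbx
    rw [dist_comm, dist_eq_norm]; linarith
  have h1 := hK.comp (x := x) (y := y) (η := R / 2) (by positivity) (by linarith) (Ω := Ω)
    (D := univ ∩ ball x R) hΩo.measurableSet fΩ hη (MeasurableSet.univ.inter measurableSet_ball)
    (by rw [univ_inter]; exact measure_ball_lt_top.ne)
    (by rw [univ_inter]; exact closedBall_subset_ball (by linarith)) (c := c) hc (by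
      have hm : MeasurableSet ((Ω \ (univ ∩ ball x R) ∪ (univ ∩ ball x R) \ Ω) ∩ {z | R / 2 ≤ ‖x - z‖}) := by
        refine MeasurableSet.inter ?_ (measurableSet_le measurable_const (by fun_prop))
        have m2 : MeasurableSet (univ ∩ ball x R) := MeasurableSet.univ.inter measurableSet_ball
        exact (hΩo.measurableSet.diff m2).union (m2.diff hΩo.measurableSet)
      calc _ ≤ ∫⁻ z in ((Ω \ (univ ∩ ball x R) ∪ (univ ∩ ball x R) \ Ω) ∩ {z | R / 2 ≤ ‖x - z‖}), ENNReal.ofReal (R ^ (-((n:ℝ) + 1))) := by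
            refine setLIntegral_mono' hm ?_
            rintro z ⟨h | h, -⟩
            · apply ENNReal.ofReal_le_ofReal
              refine Real.rpow_le_rpow_of_nonpos hR ?_ (by have : (0:ℝ) ≤ n := by positivity
                                                           linarith)
              by_contra h3
              refine h.2 ⟨trivial, ?_⟩
              rw [mem_ball, dist_comm, dist_eq_norm]
              exact not_le.1 h3
            · exact absurd (hbx (ball_subset_closedBall h.1.2)) h.2
        _ ≤ ENNReal.ofReal (R ^ (-((n:ℝ) + 1))) * volume Ω := by
            rw [setLIntegral_const]
            gcongr
            rintro z ⟨h | h, -⟩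
            · exact h.1
            · exact absurd (hbx (ball_subset_closedBall h.1.2)) h.2
        _ = _ := by
            rw [ENNReal.ofReal_mul (by positivity), ENNReal.ofReal_toReal fΩ])
  rw [hK.ball_zero x (by positivity), ← hg x _ (by positivity) hη,
    ← hg y _ (by positivity) hηy] at h1
  have h2 := hK.shell hn (x := x) (y := y) hR (δ := R / 2 / 2) (by positivity) (by linarith)
    MeasurableSet.univ
  rw [hK.ball_zero y (by positivity), sub_zero] at h2
  have h3 : |g x - g y| ≤ 2 * (N * 2 ^ (n + 1) * ‖x - y‖ * c) + 2 * (N * (shellC n R * ‖x - y‖)) := by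
    have e : g x - g y = (g x - g y - (0 - pv K (univ ∩ ball x R) y (R / 2 / 2))) -
      pv K (univ ∩ ball x R) y (R / 2 / 2) := by ring
    rw [e]
    exact (abs_sub _ _).trans (add_le_add h1 h2)
  have h4 := le_rpow_self (norm_nonneg (x - y)) (by linarith) hε1.le
  have hN := hK.N0
  calc _ ≤ _ := h3
    _ = (2 * (2 ^ (n + 1) * c) + 2 * shellC n R) * N * ‖x - y‖ := by ring
    _ ≤ _ := by gcongr

structure Chart {n : ℕ} (ε : ℝ) (Ω : Set (En n)) (a : En n) (r : ℝ) (F : En n → ℝ)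
    (DF : En n → En n →L[ℝ] ℝ) (c : ℝ) (e : En n) : Prop where
  r0 : 0 < r
  c0 : 0 ≤ c
  deriv : ∀ z, HasFDerivAt F (DF z) z
  hol : ∀ z w, ‖DF z - DF w‖ ≤ c * ‖z - w‖ ^ ε
  e1 : ‖e‖ = 1
  De : ∀ z, DF z e = 1
  eq : ∀ z ∈ ball a r, z ∈ Ω ↔ 0 < F z
  Fa : F a = 0

namespace Chart
variable {n : ℕ} {ε : ℝ} {Ω : Set (En n)} {a : En n} {r : ℝ} {F : En n → ℝ}
    {DF : En n → En n →L[ℝ] ℝ} {c : ℝ} {e : En n}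

theorem taylor (h : Chart ε Ω a r F DF c e) (hε : 0 ≤ ε) (p z : En n) :
    |F z - F p - DF p (z - p)| ≤ c * ‖z - p‖ ^ (1 + ε) := by
  have hc := h.c0
  have := (convex_closedBall p ‖z - p‖).norm_image_sub_le_of_norm_hasFDerivWithin_le' (f := F)
    (f' := DF) (φ := DF p) (C := c * ‖z - p‖ ^ ε) (x := p) (y := z)
    (fun w _ => (h.deriv w).hasFDerivWithinAt) (by
      intro w hw
      rw [mem_closedBall, dist_eq_norm] at hw
      refine (h.hol w p).trans ?_
      gcongr) (by simp) (by simp [dist_eq_norm])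
  rw [Real.norm_eq_abs] at this
  refine this.trans_eq ?_
  rcases (norm_nonneg (z - p)).eq_or_lt with h0 | h0
  · rw [← h0, Real.zero_rpow (by linarith : 1 + ε ≠ 0)]; simp
  · rw [Real.rpow_add h0, Real.rpow_one]; ring

theorem line (h : Chart ε Ω a r F DF c e) (z : En n) (t : ℝ) : F (z + t • e) = F z + t := by
  have hd : ∀ s : ℝ, HasDerivAt (fun s : ℝ => F (z + s • e) - s) 0 s := by
    intro s
    have h1 : HasDerivAt (fun s : ℝ => z + s • e) e s := by
      simpa using ((hasDerivAt_id s).smul_const e).const_add z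
    have h2 := (h.deriv (z + s • e)).comp_hasDerivAt s h1
    rw [h.De] at h2
    have h3 := h2.sub (hasDerivAt_id s)
    rw [sub_self] at h3
    exact h3
  have := is_const_of_deriv_eq_zero (fun s => (hd s).differentiableAt) (fun s => (hd s).deriv) t 0
  simp at this
  linarith

def L (DF : En n → En n →L[ℝ] ℝ) (a : En n) (c r ε : ℝ) : ℝ := ‖DF a‖ + c * r ^ ε

theorem one_le_norm (h : Chart ε Ω a r F DF c e) (z : En n) : 1 ≤ ‖DF z‖ := by
  have := (DF z).le_opNorm e
  rw [h.De, h.e1] at this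
  simpa using this

theorem one_le_L (h : Chart ε Ω a r F DF c e) : 1 ≤ L DF a c r ε := by
  have := h.one_le_norm a
  have h1 := h.c0
  have h2 := h.r0
  have : 0 ≤ c * r ^ ε := by positivity
  unfold L; linarith

theorem norm_le_L (h : Chart ε Ω a r F DF c e) (hε : 0 ≤ ε) {z : En n} (hz : z ∈ ball a r) :
    ‖DF z‖ ≤ L DF a c r ε := by
  rw [mem_ball, dist_eq_norm] at hz
  have h1 := h.hol z a
  have h2 : ‖DF z‖ ≤ ‖DF a‖ + ‖DF z - DF a‖ := by
    have := norm_add_le (DF a) (DF z - DF a)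
    simpa using this
  have h3 : c * ‖z - a‖ ^ ε ≤ c * r ^ ε := by
    have := h.c0
    gcongr
  unfold L; linarith

theorem lip (h : Chart ε Ω a r F DF c e) (hε : 0 ≤ ε) {z w : En n} (hz : z ∈ ball a r)
    (hw : w ∈ ball a r) : |F z - F w| ≤ L DF a c r ε * ‖z - w‖ := by
  exact (convex_ball a r).norm_image_sub_le_of_norm_hasFDerivWithin_le (f := F) (f' := DF)
    (fun w _ => (h.deriv w).hasFDerivWithinAt) (fun w hw => h.norm_le_L hε hw) hw hz

set_option maxHeartbeats 1000000 in
theorem E1 (h : Chart ε Ω a r F DF c e) (hn : 0 < n) (hε0 : 0 < ε) (hε1 : ε < 1)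
    (hΩo : IsOpen Ω) (fΩ : volume Ω ≠ ∞) :
    ∃ C ≥ 0, ∀ K N g, CZ n K N → IsPV K Ω g →
      ∀ x ∈ Ω ∩ ball a (min r 1 / (16 * L DF a c r ε)), ∀ y, ‖x - y‖ ≤ F x / (4 * L DF a c r ε) →
      |g x - g y| ≤ C * N * ‖x - y‖ ^ ε := by
  set L := L DF a c r ε with hL
  have hL1 : 1 ≤ L := h.one_le_L
  have hL0 : 0 < L := by linarith
  set r' := min r 1 with hr'
  have hr : 0 < r' := lt_min h.r0 one_pos
  have hrr : r' ≤ r := min_le_left _ _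
  have hr1 : r' ≤ 1 := min_le_right _ _
  set R := r' / (8 * L) with hR
  have hR0 : 0 < R := by positivity
  set M := 1 + 2 * L with hM
  have hM0 : 0 < M := by positivity
  set r1 := r' / (16 * L) with hr1def
  have hr10 : 0 < r1 := by positivity
  have er1 : L * r1 = r' / 16 := by rw [hr1def]; field_simp
  have eR : L * R = r' / 8 := by rw [hR]; field_simp
  set V := (volume Ω).toReal + R ^ n * vball n with hV
  have hv := vball_nonneg n
  have hc0 := h.c0
  set A := 2 * c * M ^ (1 + ε) * 2 ^ (n - 1) + V * R ^ (-((n:ℝ) + ε)) with hA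
  have hA0 : 0 ≤ A := by positivity
  set Cd : ℝ := 2 ^ ((n:ℝ) + ε) / (1 - 2 ^ ((n:ℝ) + ε - ((n:ℝ) + 1))) with hCd
  have hCd0 : 0 ≤ Cd := by
    have : (2:ℝ) ^ ((n:ℝ) + ε - ((n:ℝ) + 1)) < 1 :=
      Real.rpow_lt_one_of_one_lt_of_neg (by norm_num) (by linarith)
    have : (0:ℝ) < 1 - 2 ^ ((n:ℝ) + ε - ((n:ℝ) + 1)) := by linarith
    positivity
  have hsh := shellC_nonneg n hR0.le
  refine ⟨2 * (2 ^ (n + 1) * (Cd * A)) + 2 * shellC n R + 2 ^ (2 * n) / R, by positivity, ?_⟩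
  rintro K N g hK hg x ⟨hxΩ, hxa⟩ y hxy
  have hN := hK.N0
  rcases eq_or_ne x y with rfl | hne
  · simp only [sub_self, abs_zero, norm_zero]
    positivity
  have hh0 : 0 < ‖x - y‖ := norm_pos_iff.2 (sub_ne_zero.2 hne)
  have hr1r : r1 ≤ r' / 16 := by
    rw [← er1]; nlinarith
  have hxr : x ∈ ball a r := by
    rw [mem_ball] at hxa ⊢; linarith
  set s := F x with hs
  have hs0 : 0 < s := (h.eq x hxr).1 hxΩ
  have haa : a ∈ ball a r := mem_ball_self h.r0
  have hsL : s ≤ L * r1 := by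
    have h1 := h.lip hε0.le hxr haa
    rw [h.Fa, sub_zero] at h1
    have h2 := le_abs_self (F x)
    rw [mem_ball, dist_eq_norm] at hxa
    have h3 : L * ‖x - a‖ ≤ L * r1 := by gcongr
    exact h2.trans (h1.trans h3)
  set p := x - s • e with hp
  have hxp : x - p = s • e := by rw [hp]; abel
  have hxpn : ‖x - p‖ = s := by rw [hxp, norm_smul, h.e1, Real.norm_eq_abs, abs_of_pos hs0, mul_one]
  have hFp : F p = 0 := by
    have := h.line p s
    rw [← hxp, add_sub_cancel] at this
    linarith
  have hxa' : dist x a < r1 := hxa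
  have hpa : dist p a ≤ r' / 8 := by
    have := dist_triangle p x a
    rw [dist_comm p x, dist_eq_norm x p, hxpn] at this
    linarith
  have hpr : p ∈ ball a r := by rw [mem_ball]; linarith
  set η := s / (2 * L) with hη
  have hη0 : 0 < η := by positivity
  have eη : 2 * L * η = s := by rw [hη]; field_simp
  have hxy' : ‖x - y‖ ≤ η / 2 := by
    refine hxy.trans_eq ?_
    rw [hη]; field_simp; norm_num
  have hηr : η ≤ r1 / 2 := by
    rw [hη, div_le_iff₀ (by positivity)]; linarith
  have hRr1 : R = 2 * r1 := by rw [hR, hr1def]; field_simp; norm_num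
  -- the normal vector
  set v := (InnerProductSpace.toDual ℝ (En n)).symm (DF p) with hv'
  have hvin : ∀ w, inner ℝ v w = DF p w := fun w => InnerProductSpace.toDual_symm_apply
  have hvn : ‖v‖ = ‖DF p‖ := LinearIsometryEquiv.norm_map _ _
  have hv1 : 1 ≤ ‖v‖ := hvn ▸ h.one_le_norm p
  have hvL : ‖v‖ ≤ L := hvn ▸ h.norm_le_L hε0.le hpr
  have hv0 : 0 < ‖v‖ := by linarith
  set ν := ‖v‖⁻¹ • v with hν
  have hν1 : ‖ν‖ = 1 := by
    rw [hν, norm_smul, norm_inv, norm_norm, inv_mul_cancel₀ hv0.ne']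
  have hνin : ∀ w, inner ℝ ν w = DF p w / ‖v‖ := by
    intro w
    rw [hν, real_inner_smul_left, hvin]; field_simp
  set b : ℝ := inner ℝ ν p with hb
  set H := {z : En n | b < inner ℝ ν z} with hH
  have hHiff : ∀ z, z ∈ H ↔ 0 < DF p (z - p) := by
    intro z
    have : z ∈ H ↔ b < inner ℝ ν z := Iff.rfl
    rw [this, hb, ← sub_pos, ← inner_sub_right, hνin]
    constructor
    · intro h; by_contra h2; exact absurd h (not_lt.2 (div_nonpos_of_nonpos_of_nonneg (not_lt.1 h2) hv0.le))
    · intro h; positivity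
  have mH : MeasurableSet H := measurableSet_lt measurable_const (CZ.meas_inner ν)
  have hDs : DF p (x - p) = s := by rw [hxp, map_smul, h.De]; simp
  have hxin : s / L ≤ inner ℝ ν x - b := by
    rw [hb, ← inner_sub_right, hνin, hDs]
    gcongr
  have hsη : s / L = 2 * η := by rw [hη]; field_simp
  have hyin : η / 2 < inner ℝ ν y - b := by
    have h1 := CZ.inner_le_norm' hν1 (x - y)
    rw [inner_sub_right] at h1
    linarith
  -- balls
  have bΩ : closedBall x η ⊆ Ω := by
    intro z hz
    rw [mem_closedBall] at hz
    have hzr : z ∈ ball a r := by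
      rw [mem_ball]
      have := dist_triangle z x a
      linarith
    rw [h.eq z hzr]
    have h1 := h.lip hε0.le hxr hzr
    rw [← dist_eq_norm, dist_comm] at h1
    have h2 : L * dist z x ≤ L * η := by gcongr
    have h3 := (le_abs_self _).trans h1
    nlinarith
  have bH : closedBall x η ⊆ H := by
    intro z hz
    rw [mem_closedBall, dist_comm, dist_eq_norm] at hz
    have h1 := CZ.inner_le_norm' hν1 (x - z)
    rw [inner_sub_right] at h1
    change b < inner ℝ ν z
    linarith
  have bD : closedBall x η ⊆ H ∩ ball x R :=
    subset_inter bH (closedBall_subset_ball (by linarith))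
  have byΩ : closedBall y (η / 2) ⊆ Ω := by
    refine (closedBall_subset_closedBall' ?_).trans bΩ
    rw [dist_comm, dist_eq_norm]; linarith
  have mD : MeasurableSet (H ∩ ball x R) := mH.inter measurableSet_ball
  have fD : volume (H ∩ ball x R) ≠ ∞ :=
    ne_top_of_le_ne_top measure_ball_lt_top.ne (measure_mono inter_subset_right)
  -- volume bound
  have hvol : ∀ ρ, η ≤ ρ → volume (((Ω \ (H ∩ ball x R)) ∪ ((H ∩ ball x R) \ Ω)) ∩ closedBall x ρ)
      ≤ ENNReal.ofReal (A * ρ ^ ((n:ℝ) + ε)) := by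
    intro ρ hρ
    have hρ0 : 0 < ρ := by linarith
    rcases lt_or_ge ρ R with hρR | hρR
    · set τ := c * (M * ρ) ^ (1 + ε) with hτ
      have hτ0 : 0 ≤ τ := by positivity
      have hsub : ((Ω \ (H ∩ ball x R)) ∪ ((H ∩ ball x R) \ Ω)) ∩ closedBall x ρ ⊆
          {z : En n | ‖z - x‖ ≤ ρ ∧ b - τ ≤ inner ℝ ν z ∧ inner ℝ ν z ≤ b + τ} := by
        rintro z ⟨hz, hzx⟩
        rw [mem_closedBall] at hzx
        have hzR : z ∈ ball x R := by rw [mem_ball]; linarith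
        have hzr : z ∈ ball a r := by
          rw [mem_ball]
          have := dist_triangle z x a
          nlinarith
        have hzp : ‖z - p‖ ≤ M * ρ := by
          have := dist_triangle z x p
          rw [dist_eq_norm x p, hxpn, dist_eq_norm z p] at this
          rw [hM]
          nlinarith
        have ht := h.taylor hε0.le p z
        rw [hFp, sub_zero] at ht
        have ht2 : |F z - DF p (z - p)| ≤ τ := by
          refine ht.trans ?_
          rw [hτ]
          gcongr
        have hsg : |DF p (z - p)| ≤ τ := by
          rw [abs_le] at ht2 ⊢
          rcases hz with ⟨hz1, hz2⟩ | ⟨hz1, hz2⟩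
          · have h1 := (h.eq z hzr).1 hz1
            have h2 : ¬ 0 < DF p (z - p) := fun h' => hz2 ⟨(hHiff z).2 h', hzR⟩
            constructor <;> linarith
          · have h1 : ¬ 0 < F z := fun h' => hz2 ((h.eq z hzr).2 h')
            have h2 := (hHiff z).1 hz1.1
            constructor <;> linarith
        have hin : |(inner ℝ ν z : ℝ) - b| ≤ τ := by
          rw [hb, ← inner_sub_right, hνin, abs_div, abs_of_pos hv0, div_le_iff₀ hv0]
          nlinarith
        rw [abs_le] at hin
        refine ⟨by rw [← dist_eq_norm]; exact hzx, ?_, ?_⟩ <;> linarith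
      refine (measure_mono hsub).trans ((slab_vol hn ν hν1 x _ _ ρ (by linarith) hρ0.le).trans ?_)
      apply ENNReal.ofReal_le_ofReal
      have e1 : (b + τ - (b - τ)) * (2 * ρ) ^ (n - 1) =
          2 * c * M ^ (1 + ε) * 2 ^ (n - 1) * ρ ^ ((n:ℝ) + ε) := by
        have : ρ ^ ((n:ℝ) + ε) = ρ ^ (1 + ε) * ρ ^ (n - 1) := by
          rw [← Real.rpow_natCast, ← Real.rpow_add hρ0, Nat.cast_sub hn]
          congr 1; push_cast; ring
        rw [this, hτ, Real.mul_rpow hM0.le hρ0.le, mul_pow]; ring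
      rw [e1, hA, add_mul]
      have : 0 ≤ V * R ^ (-((n:ℝ) + ε)) * ρ ^ ((n:ℝ) + ε) := by positivity
      linarith
    · have h1 : volume (((Ω \ (H ∩ ball x R)) ∪ ((H ∩ ball x R) \ Ω)) ∩ closedBall x ρ) ≤
          ENNReal.ofReal V := by
        calc _ ≤ volume (Ω ∪ ball x R) := by
              refine measure_mono ?_
              rintro z ⟨hz | hz, -⟩
              · exact Or.inl hz.1
              · exact Or.inr hz.1.2
          _ ≤ volume Ω + volume (ball x R) := measure_union_le _ _
          _ = _ := by
              rw [vol_ball hn x hR0.le, hV, ENNReal.ofReal_add (by positivity) (by positivity),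
                ENNReal.ofReal_toReal fΩ]
      refine h1.trans (ENNReal.ofReal_le_ofReal ?_)
      have h2 : R ^ ((n:ℝ) + ε) ≤ ρ ^ ((n:ℝ) + ε) := by gcongr
      have h3 : R ^ (-((n:ℝ) + ε)) * R ^ ((n:ℝ) + ε) = 1 := by
        rw [← Real.rpow_add hR0]; simp
      have hV0 : 0 ≤ V := by positivity
      have h4 : 0 ≤ 2 * c * M ^ (1 + ε) * 2 ^ (n - 1) * ρ ^ ((n:ℝ) + ε) := by positivity
      calc V = V * (R ^ (-((n:ℝ) + ε)) * R ^ ((n:ℝ) + ε)) := by rw [h3, mul_one]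
        _ ≤ V * (R ^ (-((n:ℝ) + ε)) * ρ ^ ((n:ℝ) + ε)) := by gcongr
        _ ≤ _ := by rw [hA, add_mul]; linarith
  have hdy := dyadic_bound_s3 _ x η A ((n:ℝ) + ε) ((n:ℝ) + 1) hη0 hA0 (by linarith) (by positivity) hvol
  have eexp : (n:ℝ) + ε - ((n:ℝ) + 1) = ε - 1 := by ring
  have hcomp := hK.comp hη0 hxy' hΩo.measurableSet fΩ bΩ mD fD bD (by positivity) hdy
  have hpvx := hK.pv_eq x mD fD (half_pos hη0) (half_le_self hη0.le) bD
  have hhd := hK.halfdiff hn hν1 (b := b) (δ := η / 2) (R := R) x y (by positivity) hR0 (by linarith) hyin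
  have hshl := hK.shell hn (x := x) (y := y) hR0 (δ := η / 2) (by positivity) (by linarith) mH
  rw [← hg x η hη0 bΩ, ← hg y (η / 2) (by positivity) byΩ, ← hpvx] at hcomp
  have tri : |g x - g y| ≤ 2 * (N * 2 ^ (n + 1) * ‖x - y‖ * (Cd * A * η ^ ((n:ℝ) + ε - ((n:ℝ) + 1))))
      + N * (2 ^ (2 * n) * ‖x - y‖ / R) + 2 * (N * (shellC n R * ‖x - y‖)) := by
    rw [abs_le] at hcomp hhd hshl ⊢
    constructor <;> linarith [hcomp.1, hcomp.2, hhd.1, hhd.2, hshl.1, hshl.2]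
  have k1 : ‖x - y‖ * η ^ ((n:ℝ) + ε - ((n:ℝ) + 1)) ≤ ‖x - y‖ ^ ε := by
    rw [eexp]
    calc ‖x - y‖ * η ^ (ε - 1) ≤ ‖x - y‖ * ‖x - y‖ ^ (ε - 1) := by
          refine mul_le_mul_of_nonneg_left ?_ hh0.le
          exact Real.rpow_le_rpow_of_nonpos hh0 (by linarith) (by linarith)
      _ = ‖x - y‖ ^ (1:ℝ) * ‖x - y‖ ^ (ε - 1) := by rw [Real.rpow_one]
      _ = ‖x - y‖ ^ ε := by rw [← Real.rpow_add hh0]; congr 1; ring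
  have k2 : ‖x - y‖ ≤ ‖x - y‖ ^ ε := le_rpow_self hh0.le (by linarith) hε1.le
  calc |g x - g y| ≤ _ := tri
    _ = 2 * (2 ^ (n + 1) * (Cd * A)) * N * (‖x - y‖ * η ^ ((n:ℝ) + ε - ((n:ℝ) + 1))) +
        (2 * shellC n R + 2 ^ (2 * n) / R) * N * ‖x - y‖ := by ring
    _ ≤ 2 * (2 ^ (n + 1) * (Cd * A)) * N * ‖x - y‖ ^ ε +
        (2 * shellC n R + 2 ^ (2 * n) / R) * N * ‖x - y‖ ^ ε := by gcongr
    _ = _ := by ring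

end Chart

theorem Chart.boundary_local {n : ℕ} {ε : ℝ} {Ω : Set (En n)} {a : En n} {r : ℝ} {F : En n → ℝ}
    {DF : En n → En n →L[ℝ] ℝ} {c : ℝ} {e : En n}
    (h : Chart ε Ω a r F DF c e) (hn : 0 < n) (hε0 : 0 < ε) (hε1 : ε < 1)
    (hΩo : IsOpen Ω) (fΩ : volume Ω ≠ ∞) :
    ∃ ρ > 0, ∃ C ≥ 0, ∀ K N g, CZ n K N → IsPV K Ω g → ∀ x ∈ Ω ∩ ball a ρ, ∀ y ∈ Ω ∩ ball a ρ,
      |g x - g y| ≤ C * N * ‖x - y‖ ^ ε := by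
  obtain ⟨C1, hC1, hE1⟩ := h.E1 hn hε0 hε1 hΩo fΩ
  have hL1 : 1 ≤ Chart.L DF a c r ε := h.one_le_L
  set L := Chart.L DF a c r ε with hL
  have hL0 : 0 < L := by linarith
  set r1 := min r 1 / (16 * L) with hr1
  have hmr : 0 < min r 1 := lt_min h.r0 one_pos
  have hr10 : 0 < r1 := by positivity
  have hr1r : r1 ≤ r := by
    rw [hr1, div_le_iff₀ (by positivity)]
    have := min_le_left r 1
    have := h.r0
    nlinarith
  set l := 1 + 1 / (4 * L) with hl
  have hl1 : 1 < l := by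
    have : 0 < 1 / (4 * L) := by positivity
    linarith
  have hle : 1 < l ^ ε := Real.one_lt_rpow hl1 hε0
  have hle' : 0 < l ^ ε - 1 := by linarith
  set M := C1 / (l ^ ε - 1) + C1 with hM
  have hM0 : 0 ≤ M := by positivity
  have hMC : C1 ≤ M := by
    have : 0 ≤ C1 / (l ^ ε - 1) := by positivity
    linarith
  have hMl : M + C1 ≤ M * l ^ ε := by
    have h1 : M * (l ^ ε - 1) = C1 + C1 * (l ^ ε - 1) := by
      rw [hM]; field_simp
    have : 0 ≤ C1 * (l ^ ε - 1) := by positivity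
    linarith
  refine ⟨r1 / (16 * L), by positivity, 2 * M * (4 * L) ^ ε + C1, by positivity, ?_⟩
  rintro K N g hK hg
  have hN := hK.N0
  have he := h.e1
  have hin : ∀ x ∈ Ω ∩ ball a (r1 / 2), ∀ t, 0 ≤ t → t ≤ r1 / 2 →
      x + t • e ∈ Ω ∩ ball a r1 ∧ F x + t = F (x + t • e) ∧ 0 < F x := by
    rintro x ⟨hx, hxa⟩ t ht0 ht
    rw [mem_ball] at hxa
    have h0 : 0 < F x := (h.eq x (by rw [mem_ball]; linarith)).1 hx
    have hb : x + t • e ∈ ball a r1 := by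
      rw [mem_ball]
      have h1 := dist_triangle (x + t • e) x a
      have h2 : dist (x + t • e) x = t := by
        rw [dist_eq_norm, add_sub_cancel_left, norm_smul, he, mul_one, Real.norm_eq_abs, abs_of_nonneg ht0]
      linarith
    refine ⟨⟨?_, hb⟩, (h.line x t).symm, h0⟩
    rw [h.eq _ (ball_subset_ball hr1r hb), h.line]
    linarith
  have chain : ∀ x ∈ Ω ∩ ball a (r1 / 2), ∀ k : ℕ, ∀ t, 0 ≤ t → t ≤ r1 / 2 →
      t ≤ l ^ k * (F x / (4 * L)) → |g x - g (x + t • e)| ≤ M * N * t ^ ε := by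
    intro x hx k
    induction k with
    | zero =>
      intro t ht0 ht1 ht
      rw [pow_zero, one_mul] at ht
      have hn1 : ‖x - (x + t • e)‖ = t := by
        rw [sub_add_cancel_left, norm_neg, norm_smul, he, mul_one, Real.norm_eq_abs, abs_of_nonneg ht0]
      have := hE1 K N g hK hg x ⟨hx.1, ball_subset_ball (by linarith) hx.2⟩ (x + t • e) (by rw [hn1]; exact ht)
      rw [hn1] at this
      refine this.trans ?_
      gcongr
    | succ k ih =>
      intro t ht0 ht1 ht
      have hl0 : 0 < l := by linarith
      set u := t / l with hu
      have hu0 : 0 ≤ u := by positivity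
      have htu : t = l * u := by rw [hu]; field_simp
      have hut : u ≤ t := by rw [htu]; nlinarith
      have h1 := ih u hu0 (by linarith) (by
        rw [hu, div_le_iff₀ hl0]; rw [pow_succ] at ht; linarith)
      obtain ⟨h2, h3, h4⟩ := hin x hx u hu0 (by linarith)
      have htu2 : t - u = u / (4 * L) := by rw [htu, hl]; field_simp; ring
      have hn1 : ‖(x + u • e) - (x + t • e)‖ = t - u := by
        rw [add_sub_add_left_eq_sub, ← sub_smul, norm_smul, he, mul_one, Real.norm_eq_abs,
          abs_sub_comm, abs_of_nonneg (by linarith)]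
      have h5 := hE1 K N g hK hg _ h2 (x + t • e) (by
        rw [hn1, htu2, ← h3]
        gcongr
        linarith)
      rw [hn1, htu2] at h5
      have h6 : (u / (4 * L)) ^ ε ≤ u ^ ε := by
        gcongr
        exact div_le_self hu0 (by linarith)
      have h7 : t ^ ε = l ^ ε * u ^ ε := by rw [htu, Real.mul_rpow hl0.le hu0]
      calc |g x - g (x + t • e)| ≤ |g x - g (x + u • e)| + |g (x + u • e) - g (x + t • e)| :=
            abs_sub_le _ _ _
        _ ≤ M * N * u ^ ε + C1 * N * u ^ ε := by
            refine add_le_add h1 (h5.trans ?_)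
            gcongr
        _ = (M + C1) * (N * u ^ ε) := by ring
        _ ≤ (M * l ^ ε) * (N * u ^ ε) := by gcongr
        _ = _ := by rw [h7]; ring
  have chain' : ∀ x ∈ Ω ∩ ball a (r1 / 2), ∀ t, 0 ≤ t → t ≤ r1 / 2 →
      |g x - g (x + t • e)| ≤ M * N * t ^ ε := by
    intro x hx t ht0 ht
    have h0 := (hin x hx t ht0 ht).2.2
    have h1 : 0 < F x / (4 * L) := by positivity
    obtain ⟨k, hk⟩ := pow_unbounded_of_one_lt (t / (F x / (4 * L))) hl1
    rw [div_lt_iff₀ h1] at hk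
    exact chain x hx k t ht0 ht hk.le
  rintro x ⟨hx, hxa⟩ y ⟨hy, hya⟩
  have hsm : r1 / (16 * L) ≤ r1 / 2 := by gcongr; linarith
  have hx' : x ∈ Ω ∩ ball a (r1 / 2) := ⟨hx, ball_subset_ball hsm hxa⟩
  have hy' : y ∈ Ω ∩ ball a (r1 / 2) := ⟨hy, ball_subset_ball hsm hya⟩
  have hxy : ‖x - y‖ ≤ 2 * (r1 / (16 * L)) := by
    rw [← dist_eq_norm]
    rw [mem_ball] at hxa hya
    have := dist_triangle_right x y a
    linarith
  set t := 4 * L * ‖x - y‖ with ht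
  have ht0 : 0 ≤ t := by positivity
  have htr : t ≤ r1 / 2 := by
    calc t ≤ 4 * L * (2 * (r1 / (16 * L))) := by rw [ht]; gcongr
      _ = r1 / 2 := by field_simp; norm_num
  have a1 := chain' x hx' t ht0 htr
  have a2 := chain' y hy' t ht0 htr
  obtain ⟨h2, h3, h4⟩ := hin x hx' t ht0 htr
  have hn1 : ‖(x + t • e) - (y + t • e)‖ = ‖x - y‖ := by rw [add_sub_add_right_eq_sub]
  have a3 := hE1 K N g hK hg _ h2 (y + t • e) (by
    rw [hn1, le_div_iff₀ (by positivity), ← h3, mul_comm]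
    linarith)
  rw [hn1] at a3
  have a4 : t ^ ε = (4 * L) ^ ε * ‖x - y‖ ^ ε := by rw [ht, Real.mul_rpow (by positivity) (norm_nonneg _)]
  rw [abs_sub_comm] at a2
  calc |g x - g y| ≤ |g x - g (x + t • e)| + |g (x + t • e) - g y| := abs_sub_le _ _ _
    _ ≤ |g x - g (x + t • e)| + (|g (x + t • e) - g (y + t • e)| + |g (y + t • e) - g y|) := by
        gcongr; exact abs_sub_le _ _ _
    _ ≤ M * N * t ^ ε + (C1 * N * ‖x - y‖ ^ ε + M * N * t ^ ε) := by gcongr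
    _ = _ := by rw [a4]; ring

theorem base_bound {n : ℕ} {Ω : Set (En n)} (hΩo : IsOpen Ω)
    (fΩ : volume Ω ≠ ∞) {b : En n} (hb : b ∈ Ω) :
    ∃ B ≥ 0, ∀ K N g, CZ n K N → IsPV K Ω g → |g b| ≤ B * N := by
  obtain ⟨R, hR, hsub⟩ := nhds_basis_closedBall.mem_iff.1 (hΩo.mem_nhds hb)
  refine ⟨(R ^ n)⁻¹ * (volume Ω).toReal, by positivity, ?_⟩
  intro K N g hK hg
  rw [hg b R hR hsub, pv]
  have := (abs_int_le (f := fun z => K (b - z)) (g := fun _ => (R ^ n)⁻¹) (S := {z ∈ Ω | R < dist z b})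
    (c := (R ^ n)⁻¹ * (volume Ω).toReal)
    (hK.meas_shift b) (hΩo.measurableSet.inter (CZ.meas_gt b R)) hK.N0 (by positivity) ?_ ?_).2
  · linarith
  · rintro z ⟨_, hz⟩
    rw [dist_comm, dist_eq_norm] at hz
    refine (hK.bd _ ?_).trans ?_
    · intro h
      rw [h, norm_zero] at hz; linarith
    · have := hK.N0
      gcongr
  · rw [setLIntegral_const, ENNReal.ofReal_mul (by positivity), ENNReal.ofReal_toReal fΩ]
    gcongr
    exact fun z hz => hz.1

theorem global_of_local {n : ℕ} {ε : ℝ} (hε0 : 0 < ε) {Ω : Set (En n)} (hΩo : IsOpen Ω)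
    (hΩb : Bornology.IsBounded Ω)
    (hloc : ∀ a ∈ closure Ω, ∃ ρ > 0, ∃ C ≥ 0, ∀ K N g, CZ n K N → IsPV K Ω g →
      ∀ x ∈ Ω ∩ ball a ρ, ∀ y ∈ Ω ∩ ball a ρ, |g x - g y| ≤ C * N * ‖x - y‖ ^ ε) :
    ∃ C ≥ 0, ∀ K N g, CZ n K N → IsPV K Ω g →
      ∀ x ∈ Ω, ∀ y ∈ Ω, |g x - g y| ≤ C * N * ‖x - y‖ ^ ε := by
  have fΩ : volume Ω ≠ ∞ := hΩb.measure_lt_top.ne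
  have hcomp : IsCompact (closure Ω) := hΩb.isCompact_closure
  have hloc2 : ∀ a : closure Ω, ∃ ρ > 0, ∃ C ≥ 0, ∃ B ≥ 0, ∀ K N g, CZ n K N → IsPV K Ω g →
      ∀ x ∈ Ω ∩ ball a.1 ρ, |g x| ≤ B * N ∧
        ∀ y ∈ Ω ∩ ball a.1 ρ, |g x - g y| ≤ C * N * ‖x - y‖ ^ ε := by
    rintro ⟨a, ha⟩
    obtain ⟨ρ, hρ, C, hC, H⟩ := hloc a ha
    obtain ⟨b, hb, hab⟩ := Metric.mem_closure_iff.1 ha ρ hρ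
    obtain ⟨B, hB, HB⟩ := base_bound hΩo fΩ hb
    refine ⟨ρ, hρ, C, hC, B + C * (2 * ρ) ^ ε, by positivity, ?_⟩
    rintro K N g hK hg x hx
    have hN := hK.N0
    refine ⟨?_, H K N g hK hg x hx⟩
    have hb' : b ∈ ball a ρ := by rw [mem_ball, dist_comm]; exact hab
    have h1 := H K N g hK hg x hx b ⟨hb, hb'⟩
    have h2 := HB K N g hK hg
    have h3 : ‖x - b‖ ≤ 2 * ρ := by
      rw [← dist_eq_norm]
      have := dist_triangle_right x b a
      have h4 := hx.2
      rw [mem_ball] at h4 hb'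
      linarith
    have h4 : C * N * ‖x - b‖ ^ ε ≤ C * N * (2 * ρ) ^ ε := by gcongr
    calc |g x| = |g b + (g x - g b)| := by congr 1; ring
      _ ≤ |g b| + |g x - g b| := abs_add_le _ _
      _ ≤ B * N + C * N * (2 * ρ) ^ ε := by linarith
      _ = _ := by ring
  choose ρ hρ C hC B hB H using hloc2
  obtain ⟨t, ht⟩ := hcomp.elim_finite_subcover (fun a : closure Ω => ball a.1 (ρ a))
    (fun a => isOpen_ball) (fun x hx => mem_iUnion.2 ⟨⟨x, hx⟩, mem_ball_self (hρ _)⟩)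
  obtain ⟨δ, hδ, hleb⟩ := lebesgue_number_lemma_of_metric hcomp
    (c := fun a : t => ball a.1.1 (ρ a.1)) (fun a => isOpen_ball) (by
      intro x hx
      obtain ⟨i, hi⟩ := mem_iUnion.1 (ht hx)
      obtain ⟨hit, hi⟩ := mem_iUnion.1 hi
      exact mem_iUnion.2 ⟨⟨i, hit⟩, hi⟩)
  set CC := ∑ a ∈ t, C a with hCC
  set BB := ∑ a ∈ t, B a with hBB
  have hCC0 : 0 ≤ CC := Finset.sum_nonneg fun a _ => hC a
  have hBB0 : 0 ≤ BB := Finset.sum_nonneg fun a _ => hB a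
  refine ⟨CC + 2 * BB / δ ^ ε, by positivity, ?_⟩
  intro K N g hK hg x hx y hy
  have hN := hK.N0
  have hbd : ∀ x ∈ Ω, |g x| ≤ BB * N := by
    intro x hx
    obtain ⟨i, hi⟩ := hleb x (subset_closure hx)
    have h1 := (H i.1 K N g hK hg x ⟨hx, hi (mem_ball_self hδ)⟩).1
    have h2 : B i.1 ≤ BB := Finset.single_le_sum (fun a _ => hB a) i.2
    exact h1.trans (by gcongr)
  rcases lt_or_ge ‖x - y‖ δ with hd | hd
  · obtain ⟨i, hi⟩ := hleb x (subset_closure hx)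
    have hyx : y ∈ ball x δ := by rw [mem_ball, dist_comm, dist_eq_norm]; exact hd
    have h1 := (H i.1 K N g hK hg x ⟨hx, hi (mem_ball_self hδ)⟩).2 y ⟨hy, hi hyx⟩
    have h2 : C i.1 ≤ CC := Finset.single_le_sum (fun a _ => hC a) i.2
    refine h1.trans ?_
    have : 0 ≤ 2 * BB / δ ^ ε := by positivity
    gcongr
    linarith
  · have h1 := hbd x hx
    have h2 := hbd y hy
    have h3 : δ ^ ε ≤ ‖x - y‖ ^ ε := by gcongr
    have h4 : 0 < δ ^ ε := by positivity
    calc |g x - g y| ≤ |g x| + |g y| := abs_sub _ _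
      _ ≤ 2 * BB / δ ^ ε * N * δ ^ ε := by
          have : 2 * BB / δ ^ ε * N * δ ^ ε = 2 * BB * N := by field_simp
          linarith
      _ ≤ 2 * BB / δ ^ ε * N * ‖x - y‖ ^ ε := by gcongr
      _ ≤ _ := by
          gcongr
          linarith

theorem chart_exists {n : ℕ} (hn : 0 < n) {ε : ℝ} (hε0 : 0 < ε) {Ω : Set (En n)} (hΩo : IsOpen Ω) {a : En n}
    (ha : a ∈ frontier Ω) {r : ℝ} (hr : 0 < r) (R : En n ≃ₗᵢ[ℝ] En n) (φ : (Fin (n - 1) → ℝ) → ℝ)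
    (hφ : ContDiff ℝ 1 φ) (c : ℝ≥0) (hc : HolderOnWith c ε.toNNReal (fderiv ℝ φ) univ)
    (heq : Ω ∩ ball a r = {x ∈ ball a r |
        R x ⟨n - 1, Nat.sub_lt hn Nat.one_pos⟩ <
          φ fun i : Fin (n - 1) => R x (Fin.castLE (Nat.sub_le n 1) i)}) :
    ∃ F DF c e, Chart ε Ω a r F DF c e := by
  let m : Fin n := ⟨n - 1, Nat.sub_lt hn Nat.one_pos⟩
  let P : En n →L[ℝ] (Fin (n - 1) → ℝ) := ContinuousLinearMap.pi fun i =>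
    (EuclideanSpace.proj (Fin.castLE (Nat.sub_le n 1) i) : En n →L[ℝ] ℝ) ∘L
      (R.toContinuousLinearEquiv : En n →L[ℝ] En n)
  let Q : En n →L[ℝ] ℝ := (EuclideanSpace.proj m : En n →L[ℝ] ℝ) ∘L
      (R.toContinuousLinearEquiv : En n →L[ℝ] En n)
  have hP : ∀ z, P z = fun i : Fin (n - 1) => R z (Fin.castLE (Nat.sub_le n 1) i) := fun z => rfl
  have hQ : ∀ z, Q z = R z m := fun z => rfl
  have hPn : ‖P‖ ≤ 1 := by
    refine P.opNorm_le_bound zero_le_one fun z => ?_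
    rw [one_mul, pi_norm_le_iff_of_nonneg (norm_nonneg _)]
    intro i
    rw [hP]
    calc _ ≤ ‖R z‖ := PiLp.norm_apply_le (R z) _
      _ = ‖z‖ := R.norm_map z
  have heq' : ∀ z ∈ ball a r, z ∈ Ω ↔ 0 < φ (P z) - Q z := by
    intro z hz
    have := Set.ext_iff.1 heq z
    simp only [mem_inter_iff, hz, and_true, mem_setOf_eq, true_and] at this
    rw [this, sub_pos]; rfl
  have hder : ∀ z, HasFDerivAt (fun z => φ (P z) - Q z) ((fderiv ℝ φ (P z)) ∘L P - Q) z := by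
    intro z
    have h1 := ((hφ.differentiable one_ne_zero) (P z)).hasFDerivAt
    exact (h1.comp z P.hasFDerivAt).sub Q.hasFDerivAt
  refine ⟨fun z => φ (P z) - Q z, fun z => (fderiv ℝ φ (P z)) ∘L P - Q, c, - R.symm (EuclideanSpace.single m 1),
    hr, c.2, hder, ?_, ?_, ?_, heq', ?_⟩
  · intro z w
    have h1 : ‖fderiv ℝ φ (P z) - fderiv ℝ φ (P w)‖ ≤ c * ‖P z - P w‖ ^ ε := by
      have := hc.dist_le (mem_univ (P z)) (mem_univ (P w))
      rwa [dist_eq_norm, dist_eq_norm, Real.coe_toNNReal _ hε0.le] at this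
    have h2 : ‖P z - P w‖ ≤ ‖z - w‖ := by
      rw [← map_sub]
      calc _ ≤ ‖P‖ * ‖z - w‖ := P.le_opNorm _
        _ ≤ 1 * ‖z - w‖ := by gcongr
        _ = _ := one_mul _
    have h3 : ((fderiv ℝ φ (P z)) ∘L P - Q) - ((fderiv ℝ φ (P w)) ∘L P - Q) =
        (fderiv ℝ φ (P z) - fderiv ℝ φ (P w)) ∘L P := by
      ext v; simp
    rw [h3]
    calc _ ≤ ‖fderiv ℝ φ (P z) - fderiv ℝ φ (P w)‖ * ‖P‖ := ContinuousLinearMap.opNorm_comp_le _ _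
      _ ≤ (c * ‖P z - P w‖ ^ ε) * 1 := by gcongr
      _ ≤ c * ‖z - w‖ ^ ε := by rw [mul_one]; gcongr
  · simp
  · intro z
    have h1 : P (- R.symm (EuclideanSpace.single m 1)) = 0 := by
      rw [hP]
      ext i
      have : Fin.castLE (Nat.sub_le n 1) i ≠ m := by
        intro h
        have := congrArg Fin.val h
        have h2 := i.2
        simp [m] at this
        omega
      simp [this]
    have h2 : Q (- R.symm (EuclideanSpace.single m 1)) = -1 := by
      rw [hQ]
      simp
    simp only [ContinuousLinearMap.sub_apply, ContinuousLinearMap.comp_apply, h1, h2]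
    simp
  · have hcont : Continuous (fun z => φ (P z) - Q z) :=
      continuous_iff_continuousAt.2 fun z => (hder z).continuousAt
    have haΩ : a ∉ Ω := by
      rw [hΩo.frontier_eq] at ha
      exact ha.2
    have hacl : a ∈ closure Ω := ha.1
    have h1 : ¬ (0 < φ (P a) - Q a) := fun h => haΩ ((heq' a (mem_ball_self hr)).2 h)
    by_contra h2
    have h3 : φ (P a) - Q a < 0 := lt_of_le_of_ne (not_lt.1 h1) h2
    have h4 : ∀ᶠ z in 𝓝 a, φ (P z) - Q z < 0 := hcont.continuousAt.eventually_lt continuousAt_const h3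
    have h5 := h4.and (ball_mem_nhds a hr)
    obtain ⟨z, ⟨hz1, hz2⟩, hz3⟩ := mem_closure_iff_nhds.1 hacl _ h5
    have := (heq' z hz2).1 hz3
    linarith

theorem holder_bound {n : ℕ} {ε : ℝ} (hε0 : 0 < ε) (hε1 : ε < 1)
    {Ω : Set (En n)} (hΩo : IsOpen Ω)
    (hΩb : Bornology.IsBounded Ω) (hΩ : HasC1HolderBoundary n ε Ω) :
    ∃ C ≥ 0, ∀ K N g, CZ n K N → IsPV K Ω g → ∀ x ∈ Ω, ∀ y ∈ Ω, |g x - g y| ≤ C * N * ‖x - y‖ ^ ε := by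
  obtain ⟨hn, hΩ⟩ := hΩ
  have fΩ : volume Ω ≠ ∞ := hΩb.measure_lt_top.ne
  refine global_of_local hε0 hΩo hΩb fun a ha => ?_
  by_cases h : a ∈ Ω
  · exact interior_local hn hε1 hΩo fΩ h
  · have hf : a ∈ frontier Ω := by rw [hΩo.frontier_eq]; exact ⟨ha, h⟩
    obtain ⟨r, hr, R, φ, hφ, ⟨c, hc⟩, heq⟩ := hΩ a hf
    obtain ⟨F, DF, c, e, hch⟩ := chart_exists hn hε0 hΩo hf hr R φ hφ c hc heq
    exact hch.boundary_local hn hε0 hε1 hΩo fΩ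

def sphPar (m : ℕ) (i : Fin (m + 1)) (s : ℝ) (w : Fin m → ℝ) : En (m + 1) :=
  WithLp.toLp 2 (Fin.insertNth (α := fun _ => ℝ) i s w)

theorem sphPar_contDiff (m : ℕ) (i : Fin (m + 1)) (s : ℝ) : ContDiff ℝ 1 (sphPar m i s) := by
  rw [contDiff_euclidean]
  intro j
  rcases Fin.eq_self_or_eq_succAbove i j with h | ⟨k, h⟩
  · subst h
    simp only [sphPar, Fin.insertNth_apply_same]
    exact contDiff_const
  · subst h
    simp only [sphPar, Fin.insertNth_apply_succAbove]
    fun_prop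

theorem sphPar_ne (m : ℕ) (i : Fin (m + 1)) {s : ℝ} (hs : s ≠ 0) (w : Fin m → ℝ) : sphPar m i s w ≠ 0 := by
  intro h
  have := congrArg (fun v : En (m + 1) => v i) h
  simp [sphPar] at this
  exact hs this

theorem sph_fin (m : ℕ) : μH[(m : ℝ)] (sphere (0 : En (m + 1)) 1) < ∞ := by
  let f : Fin (m + 1) × Bool → (Fin m → ℝ) → En (m + 1) := fun p w =>
    ‖sphPar m p.1 (if p.2 then 1 else -1) w‖⁻¹ • sphPar m p.1 (if p.2 then 1 else -1) w
  have hs : ∀ b : Bool, (if b then (1 : ℝ) else -1) ≠ 0 := by intro b; cases b <;> simp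
  have hcov : sphere (0 : En (m + 1)) 1 ⊆ ⋃ p, f p '' closedBall 0 1 := by
    intro x hx
    have hx1 : ‖x‖ = 1 := by simpa using hx
    obtain ⟨i, -, hi⟩ := Finset.exists_max_image Finset.univ (fun i => |x i|) Finset.univ_nonempty
    have hi : ∀ j, |x j| ≤ |x i| := fun j => hi j (Finset.mem_univ j)
    have hxi : x i ≠ 0 := by
      intro h0
      have : x = 0 := by
        ext j
        have := hi j
        rw [h0, abs_zero] at this
        simpa using abs_nonpos_iff.1 this
      rw [this] at hx1
      simp at hx1
    have hai : 0 < |x i| := abs_pos.2 hxi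
    have key : ∃ b : Bool, x i = |x i| * (if b then 1 else -1) := by
      rcases lt_or_gt_of_ne hxi with h | h
      · exact ⟨false, by rw [abs_of_neg h]; simp⟩
      · exact ⟨true, by rw [abs_of_pos h]; simp⟩
    obtain ⟨b, hb⟩ := key
    refine mem_iUnion.2 ⟨(i, b), fun j => |x i|⁻¹ * x (i.succAbove j), ?_, ?_⟩
    · rw [mem_closedBall_zero_iff, pi_norm_le_iff_of_nonneg zero_le_one]
      intro j
      rw [Real.norm_eq_abs, abs_mul, abs_inv, abs_abs, inv_mul_le_iff₀ hai, mul_one]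
      exact hi _
    · have h1 : sphPar m i (if b then 1 else -1) (fun j => |x i|⁻¹ * x (i.succAbove j)) = |x i|⁻¹ • x := by
        ext j
        rcases Fin.eq_self_or_eq_succAbove i j with h | ⟨k, h⟩
        · subst h
          simp only [sphPar, Fin.insertNth_apply_same, PiLp.smul_apply, smul_eq_mul]
          rw [eq_inv_mul_iff_mul_eq₀ hai.ne']
          exact hb.symm
        · subst h
          simp [sphPar]
      simp only [f]
      rw [h1, norm_smul, hx1, mul_one, norm_inv, Real.norm_eq_abs, abs_abs, inv_inv, smul_smul,
        mul_inv_cancel₀ hai.ne', one_smul]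
  refine (measure_mono hcov).trans_lt ((measure_iUnion_le _).trans_lt ?_)
  rw [tsum_fintype]
  refine ENNReal.sum_lt_top.2 fun p _ => ?_
  have hcd : ContDiff ℝ 1 (f p) := by
    have h1 := sphPar_contDiff m p.1 (if p.2 then 1 else -1)
    exact ((h1.norm ℝ (fun w => sphPar_ne m p.1 (hs _) w)).inv
      (fun w => norm_ne_zero_iff.2 (sphPar_ne m p.1 (hs _) w))).smul h1
  obtain ⟨L, hL⟩ := (hcd.contDiffOn (s := univ)).locallyLipschitzOn convex_univ |>.mono (subset_univ (closedBall 0 1))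
    |>.exists_lipschitzOnWith_of_compact (isCompact_closedBall 0 1)
  refine (hL.hausdorffMeasure_image_le (d := m) (by positivity)).trans_lt ?_
  have hv : μH[(m : ℝ)] (closedBall (0 : Fin m → ℝ) 1) = volume (closedBall (0 : Fin m → ℝ) 1) := by
    have := hausdorffMeasure_pi_real (ι := Fin m)
    rw [Fintype.card_fin] at this
    rw [this]
  rw [hv]
  exact ENNReal.mul_lt_top (ENNReal.rpow_lt_top_of_nonneg (by positivity) ENNReal.coe_ne_top) measure_closedBall_lt_top

theorem sph_pos (m : ℕ) : 0 < μH[(m : ℝ)] (sphere (0 : En (m + 1)) 1) := by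
  let P : En (m + 1) → (Fin m → ℝ) := fun x j => x j.succ
  have hP : LipschitzWith 1 P := by
    refine LipschitzWith.of_dist_le_mul fun x y => ?_
    rw [NNReal.coe_one, one_mul, dist_pi_le_iff dist_nonneg]
    intro j
    rw [dist_eq_norm, dist_eq_norm]
    exact PiLp.norm_apply_le (x - y) j.succ
  have h1 := hP.hausdorffMeasure_image_le (d := m) (by positivity) (sphere (0 : En (m + 1)) 1)
  have hv : μH[(m : ℝ)] = (volume : Measure (Fin m → ℝ)) := by
    have := hausdorffMeasure_pi_real (ι := Fin m)
    rwa [Fintype.card_fin] at this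
  rw [hv] at h1
  simp only [ENNReal.coe_one, ENNReal.one_rpow, one_mul] at h1
  refine lt_of_lt_of_le ?_ h1
  have hsub : ball (0 : Fin m → ℝ) (1 / (m + 1)) ⊆ P '' sphere (0 : En (m + 1)) 1 := by
    intro w hw
    rw [mem_ball_zero_iff] at hw
    have hsum : ∑ j, w j ^ 2 ≤ 1 := by
      have : ∀ j, w j ^ 2 ≤ (1 / (m + 1) : ℝ) := by
        intro j
        have h2 := (norm_le_pi_norm w j).trans hw.le
        have h3 : (1 / (m + 1) : ℝ) ≤ 1 := by
          rw [div_le_one (by positivity)]; linarith [(Nat.cast_nonneg m : (0:ℝ) ≤ m)]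
        rw [← sq_abs, ← Real.norm_eq_abs]
        nlinarith [norm_nonneg (w j)]
      calc _ ≤ ∑ j : Fin m, (1 / (m + 1) : ℝ) := Finset.sum_le_sum fun j _ => this j
        _ = m * (1 / (m + 1)) := by simp
        _ ≤ 1 := by rw [mul_one_div, div_le_one (by positivity)]; linarith
    refine ⟨WithLp.toLp 2 (Fin.cons (Real.sqrt (1 - ∑ j, w j ^ 2)) w), ?_, ?_⟩
    · rw [mem_sphere_zero_iff_norm, EuclideanSpace.norm_eq, Fin.sum_univ_succ]
      simp only [Fin.cons_zero, Fin.cons_succ, Real.norm_eq_abs, sq_abs]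
      rw [Real.sq_sqrt (by linarith)]
      simp
    · ext j; simp [P]
  exact lt_of_lt_of_le (measure_ball_pos _ _ (by positivity)) (measure_mono hsub)

def sphM (m : ℕ) : Measure (En (m + 1)) := μH[(m : ℝ)].restrict (sphere (0 : En (m + 1)) 1)

instance sphM_fin (m : ℕ) : IsFiniteMeasure (sphM m) :=
  ⟨by rw [sphM, Measure.restrict_apply_univ]; exact sph_fin m⟩

theorem sph_trans {m : ℕ} {x y : En (m + 1)} (hx : ‖x‖ = 1) (hy : ‖y‖ = 1) :
    ∃ R : En (m + 1) ≃ₗᵢ[ℝ] En (m + 1), R x = y :=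
  ⟨_, Submodule.reflection_sub (hx.trans hy.symm)⟩

theorem sphM_ball_eq {m : ℕ} {x y : En (m + 1)} (hx : ‖x‖ = 1) (hy : ‖y‖ = 1) (r : ℝ) :
    sphM m (ball x r) = sphM m (ball y r) := by
  obtain ⟨R, hR⟩ := sph_trans hx hy
  rw [sphM, Measure.restrict_apply measurableSet_ball, Measure.restrict_apply measurableSet_ball]
  rw [← R.toIsometryEquiv.hausdorffMeasure_preimage (m : ℝ) (ball y r ∩ _)]
  congr 1
  ext z
  have : dist (R z) y = dist z x := by rw [← hR, R.dist_map]
  simp [← hR]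

theorem sphM_ball_pos {m : ℕ} {x : En (m + 1)} (hx : ‖x‖ = 1) {r : ℝ} (hr : 0 < r) :
    0 < sphM m (ball x r) := by
  by_contra h
  have h0 : sphM m (ball x r) = 0 := by simpa using h
  have h1 : μH[(m : ℝ)] (sphere (0 : En (m + 1)) 1) = 0 := by
    refine (isCompact_sphere (0 : En (m + 1)) 1).measure_zero_of_nhdsWithin fun y hy => ?_
    have hy1 : ‖y‖ = 1 := by simpa using hy
    refine ⟨ball y r ∩ sphere 0 1, inter_mem (mem_nhdsWithin_of_mem_nhds (ball_mem_nhds y hr)) self_mem_nhdsWithin, ?_⟩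
    have := sphM_ball_eq hx hy1 r
    rw [h0, sphM, Measure.restrict_apply measurableSet_ball] at this
    exact this.symm
  exact (sph_pos m).ne' h1

def sphK (m : ℕ) (r : ℝ) (x y : En (m + 1)) : ℝ := if dist x (‖y‖⁻¹ • y) < r then 1 else 0

def sphH (m : ℕ) (J : Set ℝ) (y : En (m + 1)) : ℝ :=
  ({y : En (m + 1) | ‖y‖ ∈ J}).indicator (fun y => (‖y‖ ^ (m + 1))⁻¹) y

theorem sphK_meas (m : ℕ) (r : ℝ) : Measurable (Function.uncurry (sphK m r)) := by
  refine Measurable.ite ?_ measurable_const measurable_const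
  exact measurableSet_lt (by fun_prop) measurable_const

theorem sphK_nonneg (m : ℕ) (r : ℝ) (x y : En (m + 1)) : 0 ≤ sphK m r x y := by
  unfold sphK; split_ifs <;> norm_num

theorem sphK_le (m : ℕ) (r : ℝ) (x y : En (m + 1)) : sphK m r x y ≤ 1 := by
  unfold sphK; split_ifs <;> norm_num

theorem sphH_nonneg (m : ℕ) (J : Set ℝ) (y : En (m + 1)) : 0 ≤ sphH m J y :=
  indicator_nonneg (fun _ _ => by positivity) _

theorem sphH_int (m : ℕ) {J : Set ℝ} (hJ : MeasurableSet J) {α β : ℝ} (hα : 0 < α) (hJs : J ⊆ Icc α β) :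
    Integrable (sphH m J) := by
  have hm : MeasurableSet {y : En (m + 1) | ‖y‖ ∈ J} := measurable_norm hJ
  refine (integrable_indicator_iff hm).2 ?_
  have hfin : volume {y : En (m + 1) | ‖y‖ ∈ J} ≠ ∞ := by
    refine ne_top_of_le_ne_top (measure_closedBall_lt_top (x := (0 : En (m + 1))) (r := β)).ne (measure_mono ?_)
    intro y hy
    simpa using (hJs hy).2
  refine Measure.integrableOn_of_bounded (M := (α ^ (m + 1))⁻¹) hfin
    (by fun_prop) ?_
  filter_upwards [ae_restrict_mem hm] with y hy
  have := (hJs hy).1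
  rw [Real.norm_of_nonneg (by positivity)]
  gcongr

/-- inner integral over the sphere -/
theorem sphK_int_sph {m : ℕ} {e : En (m + 1)} (he : ‖e‖ = 1) (r : ℝ) {y : En (m + 1)} (hy : y ≠ 0) :
    ∫ x, sphK m r x y ∂(sphM m) = (sphM m).real (ball e r) := by
  have hy1 : ‖‖y‖⁻¹ • y‖ = 1 := by
    rw [norm_smul, norm_inv, norm_norm, inv_mul_cancel₀ (norm_ne_zero_iff.2 hy)]
  have : (fun x => sphK m r x y) = (ball (‖y‖⁻¹ • y) r).indicator 1 := by
    ext x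
    unfold sphK
    split_ifs with h
    · rw [indicator_of_mem (mem_ball.2 h), Pi.one_apply]
    · rw [indicator_of_notMem (fun h' => h (mem_ball.1 h'))]
  rw [this, integral_indicator_one measurableSet_ball, Measure.real, Measure.real, sphM_ball_eq hy1 he]

theorem sphK_int_vol {m : ℕ} {e x : En (m + 1)} (he : ‖e‖ = 1) (hx : ‖x‖ = 1) (r : ℝ) (J : Set ℝ) :
    ∫ y, sphK m r x y * sphH m J y = ∫ y, sphK m r e y * sphH m J y := by
  obtain ⟨R, hR⟩ := sph_trans he hx
  rw [← R.measurePreserving.integral_comp R.toHomeomorph.measurableEmbedding]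
  congr 1
  ext y
  have h1 : sphK m r x (R y) = sphK m r e y := by
    simp only [sphK]
    rw [← hR, R.norm_map, ← map_smul, R.dist_map]
  have h2 : sphH m J (R y) = sphH m J y := by
    unfold sphH
    by_cases h : ‖y‖ ∈ J
    · rw [indicator_of_mem (show y ∈ {y : En (m + 1) | ‖y‖ ∈ J} from h),
        indicator_of_mem (show R y ∈ {y : En (m + 1) | ‖y‖ ∈ J} from by simpa using h), R.norm_map]
    · rw [indicator_of_notMem (show y ∉ {y : En (m + 1) | ‖y‖ ∈ J} from h),
        indicator_of_notMem (show R y ∉ {y : En (m + 1) | ‖y‖ ∈ J} from by simpa using h)]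
  rw [h1, h2]

theorem sph_cancel {m : ℕ} {ω : En (m + 1) → ℝ} (hom : ∀ t : ℝ, 0 < t → ∀ x, ω (t • x) = ω x)
    (hc : ContinuousOn ω {0}ᶜ) (h0 : ∫ x, ω x ∂(sphM m) = 0) {J : Set ℝ} (hJ : MeasurableSet J)
    {α β : ℝ} (hα : 0 < α) (hJs : J ⊆ Icc α β) :
    ∫ y, ω y * sphH m J y = 0 := by
  have hmω : Measurable ω := measurable_of_continuousOn_compl_singleton 0 hc
  have hcS : ContinuousOn ω (sphere 0 1) := hc.mono fun x hx => by
    rintro rfl; simp at hx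
  have hproj : ∀ y : En (m + 1), y ≠ 0 → ω y = ω (‖y‖⁻¹ • y) := fun y hy =>
    (hom _ (by positivity) _).symm
  have hpn : ∀ y : En (m + 1), y ≠ 0 → ‖‖y‖⁻¹ • y‖ = 1 := fun y hy => by
    rw [norm_smul, norm_inv, norm_norm, inv_mul_cancel₀ (norm_ne_zero_iff.2 hy)]
  obtain ⟨M, hM⟩ : ∃ M, ∀ x, ‖ω x‖ ≤ M := by
    obtain ⟨M, hM⟩ := (isCompact_sphere (0 : En (m + 1)) 1).exists_bound_of_continuousOn hcS
    refine ⟨max M ‖ω 0‖, fun x => ?_⟩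
    by_cases hx : x = 0
    · subst hx; exact le_max_right _ _
    · rw [hproj x hx]
      exact (hM _ (by simpa using hpn x hx)).trans (le_max_left _ _)
  have hHi := sphH_int m hJ hα hJs
  let e : En (m + 1) := EuclideanSpace.single 0 1
  have he : ‖e‖ = 1 := by simp [e]
  -- integrability
  have hI1 : ∀ r, Integrable (fun p : En (m + 1) × En (m + 1) => ω p.1 * sphK m r p.1 p.2 * sphH m J p.2)
      ((sphM m).prod volume) := by
    intro r
    refine (hHi.comp_snd (sphM m)).bdd_mul (c := M)
      ((hmω.comp measurable_fst).mul (sphK_meas m r)).aestronglyMeasurable ?_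
    refine Eventually.of_forall fun p => ?_
    rw [norm_mul, Real.norm_of_nonneg (sphK_nonneg _ _ _ _)]
    exact (mul_le_of_le_one_right (norm_nonneg _) (sphK_le _ _ _ _)).trans (hM _)
  have hωH : Integrable (fun y => ω y * sphH m J y) :=
    hHi.bdd_mul (c := M) hmω.aestronglyMeasurable (Eventually.of_forall hM)
  set I := ∫ y, sphH m J y with hIdef
  have hI0 : 0 ≤ I := integral_nonneg (sphH_nonneg m J)
  have main : ∀ η > 0, |∫ y, ω y * sphH m J y| ≤ η * I := by
    intro η hη
    have huc := (isCompact_sphere (0 : En (m + 1)) 1).uniformContinuousOn_of_continuous hcS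
    obtain ⟨r, hr, hosc⟩ := Metric.uniformContinuousOn_iff.1 huc η hη
    set γ := (sphM m).real (ball e r) with hγ
    have hγ0 : 0 < γ := ENNReal.toReal_pos (sphM_ball_pos he hr).ne' (measure_ne_top _ _)
    have hD1 : ∫ y, ∫ x, ω x * sphK m r x y * sphH m J y ∂(sphM m) = 0 := by
      rw [← integral_integral_swap (hI1 r)]
      calc _ = ∫ x, ω x * (∫ y, sphK m r e y * sphH m J y) ∂(sphM m) := by
            refine integral_congr_ae ?_
            have : ∀ᵐ x ∂(sphM m), x ∈ sphere (0 : En (m + 1)) 1 := ae_restrict_mem isClosed_sphere.measurableSet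
            filter_upwards [this] with x hx
            simp only [mul_assoc]
            rw [integral_const_mul, sphK_int_vol he (by simpa using hx)]
        _ = 0 := by rw [integral_mul_const, h0, zero_mul]
    have hinn : Integrable (fun y => ∫ x, ω x * sphK m r x y * sphH m J y ∂(sphM m)) := (hI1 r).integral_prod_right
    have hKi : ∀ y, Integrable (fun x => sphK m r x y) (sphM m) := by
      intro y
      refine Integrable.of_bound (C := 1) ((sphK_meas m r).comp measurable_prodMk_right).aestronglyMeasurable ?_
      refine Eventually.of_forall fun x => ?_
      rw [Real.norm_of_nonneg (sphK_nonneg _ _ _ _)]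
      exact sphK_le _ _ _ _
    have hωKi : ∀ y, Integrable (fun x => ω x * sphK m r x y) (sphM m) := fun y =>
      (hKi y).bdd_mul (c := M) hmω.aestronglyMeasurable (Eventually.of_forall hM)
    have hpt : ∀ᵐ y ∂(volume : Measure (En (m + 1))),
        ‖γ * (ω y * sphH m J y) - ∫ x, ω x * sphK m r x y * sphH m J y ∂(sphM m)‖ ≤ η * γ * sphH m J y := by
      have : ∀ᵐ y ∂(volume : Measure (En (m + 1))), y ≠ 0 := by
        rw [ae_iff]; simp
      filter_upwards [this] with y hy
      rw [integral_mul_const]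
      have h1 : γ * (ω y * sphH m J y) - (∫ x, ω x * sphK m r x y ∂(sphM m)) * sphH m J y =
          (∫ x, (ω y - ω x) * sphK m r x y ∂(sphM m)) * sphH m J y := by
        simp only [sub_mul]
        rw [integral_sub ((hKi y).const_mul _) (hωKi y), integral_const_mul, sphK_int_sph he r hy]
        ring
      rw [h1, norm_mul, Real.norm_of_nonneg (sphH_nonneg m J y)]
      refine mul_le_mul_of_nonneg_right ?_ (sphH_nonneg m J y)
      have h2 : ‖∫ x, (ω y - ω x) * sphK m r x y ∂(sphM m)‖ ≤ ∫ x, η * sphK m r x y ∂(sphM m) := by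
        refine norm_integral_le_of_norm_le ((hKi y).const_mul _) ?_
        have : ∀ᵐ x ∂(sphM m), x ∈ sphere (0 : En (m + 1)) 1 := ae_restrict_mem isClosed_sphere.measurableSet
        filter_upwards [this] with x hx
        rw [norm_mul, Real.norm_of_nonneg (sphK_nonneg _ _ _ _)]
        unfold sphK
        split_ifs with hd
        · rw [mul_one, mul_one, hproj y hy]
          have := hosc x hx (‖y‖⁻¹ • y) (by simpa using hpn y hy) hd
          rw [dist_comm, dist_eq_norm] at this
          exact this.le
        · simp
      rwa [integral_const_mul, sphK_int_sph he r hy] at h2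
    have h3 := norm_integral_le_of_norm_le (hHi.const_mul (η * γ)) hpt
    rw [integral_sub (hωH.const_mul γ) hinn, hD1, sub_zero, integral_const_mul, integral_const_mul, norm_mul,
      Real.norm_of_nonneg hγ0.le, Real.norm_eq_abs] at h3
    have h4 : γ * |∫ y, ω y * sphH m J y| ≤ γ * (η * I) := by linarith
    exact le_of_mul_le_mul_left h4 hγ0
  by_contra hne
  have hpos : 0 < |∫ y, ω y * sphH m J y| := abs_pos.2 hne
  set A := |∫ y, ω y * sphH m J y|
  have := main (A / (2 * (I + 1))) (by positivity)
  have h5 : A / (2 * (I + 1)) * I < A := by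
    rw [div_mul_eq_mul_div, div_lt_iff₀ (by positivity)]
    nlinarith
  linarith

theorem kernel_cancel {n : ℕ} (hn : 0 < n) {ω K : En n → ℝ} (hK : ∀ x, x ≠ 0 → K x = ω x / ‖x‖ ^ n)
    (hom : ∀ t : ℝ, 0 < t → ∀ x, ω (t • x) = ω x)
    (hc : ContinuousOn ω {0}ᶜ) (h0 : (∫ ξ in sphere (0 : En n) 1, ω ξ ∂μH[(n : ℝ) - 1]) = 0)
    (J : Set ℝ) (hJ : MeasurableSet J) (hJs : ∃ α β : ℝ, 0 < α ∧ J ⊆ Icc α β) :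
    ∫ z in {z : En n | ‖z‖ ∈ J}, K z = 0 := by
  obtain ⟨m, rfl⟩ : ∃ m, n = m + 1 := ⟨n - 1, by omega⟩
  obtain ⟨α, β, hα, hJs⟩ := hJs
  have h1 : ((m + 1 : ℕ) : ℝ) - 1 = m := by push_cast; ring
  rw [h1] at h0
  have h2 := sph_cancel hom hc h0 hJ hα hJs
  have hm : MeasurableSet {y : En (m + 1) | ‖y‖ ∈ J} := measurable_norm hJ
  rw [← integral_indicator hm, ← h2]
  congr 1
  ext y
  unfold sphH
  by_cases h : ‖y‖ ∈ J
  · have hy : y ≠ 0 := by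
      rintro rfl
      have := (hJs h).1
      simp at this; linarith
    have h' : y ∈ {y : En (m + 1) | ‖y‖ ∈ J} := h
    rw [indicator_of_mem h', indicator_of_mem h', hK y hy, div_eq_mul_inv]
  · have h' : y ∉ {y : En (m + 1) | ‖y‖ ∈ J} := h
    rw [indicator_of_notMem h', indicator_of_notMem h', mul_zero]

theorem czConst_lt_top {n : ℕ} {K : En n → ℝ} (hc : ContDiffOn ℝ 1 K {0}ᶜ)
    (hom : ∀ t : ℝ, 0 < t → ∀ z, z ≠ 0 → K (t • z) = (t ^ n)⁻¹ * K z) : czConst n K < ∞ := by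
  have hS : sphere (0 : En n) 1 ⊆ {0}ᶜ := fun x hx => by rintro rfl; simp at hx
  have ho : IsOpen ({0}ᶜ : Set (En n)) := isOpen_compl_singleton
  obtain ⟨B1, hB1⟩ := (isCompact_sphere (0 : En n) 1).exists_bound_of_continuousOn (hc.continuousOn.mono hS)
  obtain ⟨B2, hB2⟩ := (isCompact_sphere (0 : En n) 1).exists_bound_of_continuousOn
    ((hc.continuousOn_fderiv_of_isOpen ho le_rfl).mono hS)
  have hn : ∀ y : En n, y ≠ 0 → ‖y‖⁻¹ • y ∈ sphere (0 : En n) 1 := fun y hy => by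
    rw [mem_sphere_zero_iff_norm, norm_smul, norm_inv, norm_norm, inv_mul_cancel₀ (norm_ne_zero_iff.2 hy)]
  refine ENNReal.add_lt_top.2 ⟨?_, ?_⟩
  · refine lt_of_le_of_lt (iSup_le fun x => ?_) (ENNReal.ofReal_lt_top (r := B1))
    refine ENNReal.ofReal_le_ofReal ?_
    have hx : 0 < ‖x.1‖ := norm_pos_iff.2 x.2
    have h1 := hB1 _ (hn x.1 x.2)
    rw [hom _ (by positivity) _ x.2, Real.norm_eq_abs, abs_mul, inv_pow, inv_inv, abs_of_pos (by positivity)] at h1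
    linarith
  · refine lt_of_le_of_lt (iSup_le fun x => ?_) (ENNReal.ofReal_lt_top (r := B2))
    refine ENNReal.ofReal_le_ofReal ?_
    have hx : 0 < ‖x.1‖ := norm_pos_iff.2 x.2
    have h1 := hB2 _ (hn x.1 x.2)
    set t := ‖x.1‖⁻¹ with ht
    have ht0 : 0 < t := by positivity
    have h2 : fderiv ℝ (fun z => K (t • z)) x.1 = t • fderiv ℝ K (t • x.1) := fderiv_comp_smul t
    have h3 : fderiv ℝ (fun z => K (t • z)) x.1 = (t ^ n)⁻¹ • fderiv ℝ K x.1 := by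
      have : (fun z => K (t • z)) =ᶠ[𝓝 x.1] fun z => (t ^ n)⁻¹ • K z := by
        filter_upwards [ho.mem_nhds x.2] with z hz
        exact hom t ht0 z hz
      rw [this.fderiv_eq]
      exact fderiv_fun_const_smul ((hc.differentiableOn one_ne_zero _ x.2).differentiableAt (ho.mem_nhds x.2)) _
    have h4 : ‖fderiv ℝ K x.1‖ * (t ^ n)⁻¹ = t * ‖fderiv ℝ K (t • x.1)‖ := by
      have := congrArg norm (h2.symm.trans h3)
      rw [norm_smul, norm_smul, Real.norm_of_nonneg ht0.le, Real.norm_of_nonneg (by positivity)] at this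
      linarith
    have h5 : (t ^ n)⁻¹ = ‖x.1‖ ^ n := by rw [ht, inv_pow, inv_inv]
    rw [h5] at h4
    calc _ = (‖fderiv ℝ K x.1‖ * ‖x.1‖ ^ n) * ‖x.1‖ := by ring
      _ = ‖fderiv ℝ K (t • x.1)‖ * (t * ‖x.1‖) := by rw [h4]; ring
      _ = ‖fderiv ℝ K (t • x.1)‖ := by rw [ht, inv_mul_cancel₀ hx.ne', mul_one]
      _ ≤ B2 := h1

theorem cz_of {n : ℕ} (hn : 0 < n) {ω K : En n → ℝ} (hK : ∀ x, x ≠ 0 → K x = ω x / ‖x‖ ^ n)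
    (hom : ∀ t : ℝ, 0 < t → ∀ x, ω (t • x) = ω x) (hev : ∀ x, ω (-x) = ω x)
    (hc : ContDiffOn ℝ 1 ω {0}ᶜ) (h0 : (∫ ξ in sphere (0 : En n) 1, ω ξ ∂μH[(n : ℝ) - 1]) = 0) :
    czConst n K < ∞ ∧ CZ n K (czConst n K).toReal := by
  have ho : IsOpen ({0}ᶜ : Set (En n)) := isOpen_compl_singleton
  have hKc : ContDiffOn ℝ 1 K {0}ᶜ := by
    have h1 : ContDiffOn ℝ 1 (fun x : En n => ω x / ‖x‖ ^ n) {0}ᶜ := by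
      refine hc.div (ContDiffOn.pow (contDiffOn_id.norm ℝ fun x hx => hx) n) fun x hx => ?_
      have : ‖x‖ ≠ 0 := norm_ne_zero_iff.2 hx
      positivity
    exact h1.congr fun x hx => hK x hx
  have hKh : ∀ t : ℝ, 0 < t → ∀ z, z ≠ 0 → K (t • z) = (t ^ n)⁻¹ * K z := by
    intro t ht z hz
    rw [hK _ (smul_ne_zero ht.ne' hz), hK z hz, hom t ht, norm_smul, Real.norm_of_nonneg ht.le, mul_pow]
    field_simp
  have hfin := czConst_lt_top hKc hKh
  have hb1 : ∀ z : En n, z ≠ 0 → |K z| * ‖z‖ ^ n ≤ (czConst n K).toReal := by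
    intro z hz
    refine (ENNReal.ofReal_le_iff_le_toReal hfin.ne).1 ?_
    refine le_trans ?_ (le_self_add (a := (⨆ x : {x : En n // x ≠ 0}, ENNReal.ofReal (|K x.1| * ‖x.1‖ ^ n))))
    exact le_iSup (fun x : {x : En n // x ≠ 0} => ENNReal.ofReal (|K x.1| * ‖x.1‖ ^ n)) ⟨z, hz⟩
  have hb2 : ∀ z : En n, z ≠ 0 → ‖fderiv ℝ K z‖ * ‖z‖ ^ (n + 1) ≤ (czConst n K).toReal := by
    intro z hz
    refine (ENNReal.ofReal_le_iff_le_toReal hfin.ne).1 ?_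
    refine le_trans ?_ (le_add_self (a := (⨆ x : {x : En n // x ≠ 0}, ENNReal.ofReal (‖fderiv ℝ K x.1‖ * ‖x.1‖ ^ (n + 1)))))
    exact le_iSup (fun x : {x : En n // x ≠ 0} => ENNReal.ofReal (‖fderiv ℝ K x.1‖ * ‖x.1‖ ^ (n + 1))) ⟨z, hz⟩
  set N := (czConst n K).toReal with hN
  have hN0 : 0 ≤ N := ENNReal.toReal_nonneg
  refine ⟨hfin, hN0, measurable_of_continuousOn_compl_singleton 0 hKc.continuousOn, ?_, ?_, ?_, hKh,
    kernel_cancel hn hK hom hc.continuousOn h0⟩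
  · intro z hz
    have : 0 < ‖z‖ := norm_pos_iff.2 hz
    rw [← div_eq_mul_inv, le_div_iff₀ (by positivity)]
    exact hb1 z hz
  · intro u v hu huv
    have hu0 : 0 < ‖u‖ := norm_pos_iff.2 hu
    have hw : ∀ w ∈ closedBall u (‖u‖ / 2), ‖u‖ / 2 ≤ ‖w‖ := by
      intro w hw
      rw [mem_closedBall, dist_eq_norm] at hw
      have := norm_sub_norm_le u w
      rw [norm_sub_rev] at this
      linarith
    have hw0 : ∀ w ∈ closedBall u (‖u‖ / 2), w ≠ 0 := by
      intro w hw1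
      have := hw w hw1
      exact norm_pos_iff.1 (by linarith)
    have key := (convex_closedBall u (‖u‖ / 2)).norm_image_sub_le_of_norm_fderiv_le (𝕜 := ℝ) (f := K)
      (C := N * 2 ^ (n + 1) * (‖u‖ ^ (n + 1))⁻¹) (x := v) (y := u) ?_ ?_ ?_ ?_
    · rw [Real.norm_eq_abs] at key
      linarith
    · intro w hw1
      exact ((hKc.differentiableOn one_ne_zero) w (hw0 w hw1)).differentiableAt (ho.mem_nhds (hw0 w hw1))
    · intro w hw1
      have h1 := hb2 w (hw0 w hw1)
      have h2 : (‖u‖ / 2) ^ (n + 1) ≤ ‖w‖ ^ (n + 1) := by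
        have := hw w hw1
        gcongr
      have h3 : ‖fderiv ℝ K w‖ * (‖u‖ / 2) ^ (n + 1) ≤ N :=
        (mul_le_mul_of_nonneg_left h2 (norm_nonneg _)).trans h1
      rw [← div_eq_mul_inv, le_div_iff₀ (by positivity)]
      rw [div_pow, mul_div_assoc', div_le_iff₀ (by positivity)] at h3
      exact h3
    · rw [mem_closedBall, dist_comm, dist_eq_norm]; exact huv
    · exact mem_closedBall_self (by positivity)
  · intro z
    by_cases hz : z = 0
    · rw [hz, neg_zero]
    · rw [hK _ (neg_ne_zero.2 hz), hK z hz, hev, norm_neg]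

/-- For a bounded `C^{1+ε}` domain `Ω ⊆ ℝ^n` and an even smooth homogeneous
Calderón–Zygmund operator with kernel `K`, the principal value `T(χ_Ω)(x)` exists for all
`x ∈ Ω`, and `|T(χ_Ω)(x) − T(χ_Ω)(y)| ≤ C ‖T‖_CZ |x−y|^ε` on `Ω`, with `C = C(n,ε,Ω)`. -/
theorem statement3 (n : ℕ) (ε : ℝ) (hε0 : 0 < ε) (hε1 : ε < 1)
    (Ω : Set (En n)) (hΩo : IsOpen Ω) (hΩc : IsConnected Ω)
    (hΩb : Bornology.IsBounded Ω) (hΩ : HasC1HolderBoundary n ε Ω) :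
    ∃ C : ℝ≥0, 0 < C ∧
      ∀ ω K : En n → ℝ,
        (∀ x, x ≠ 0 → K x = ω x / ‖x‖ ^ n) →
        (∀ t : ℝ, 0 < t → ∀ x, ω (t • x) = ω x) →
        (∀ x, ω (-x) = ω x) →
        ContDiffOn ℝ 1 ω {(0 : En n)}ᶜ →
        (∫ ξ in sphere (0 : En n) 1, ω ξ ∂μH[(n : ℝ) - 1]) = 0 →
        ∃ g : En n → ℝ,
          (∀ x ∈ Ω, Tendsto
            (fun δ : ℝ => ∫ y in {y ∈ Ω | δ < dist y x}, K (x - y))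
            (𝓝[>] 0) (𝓝 (g x))) ∧
          ∀ x ∈ Ω, ∀ y ∈ Ω,
            ENNReal.ofReal |g x - g y| ≤
              ↑C * czConst n K * ENNReal.ofReal (dist x y ^ ε) := by
  obtain ⟨C, hC0, hC⟩ := holder_bound hε0 hε1 hΩo hΩb hΩ
  obtain ⟨hn, -⟩ := hΩ
  have fΩ : volume Ω ≠ ∞ := hΩb.measure_lt_top.ne
  refine ⟨C.toNNReal + 1, by positivity, ?_⟩
  intro ω K hK hom hev hc h0
  obtain ⟨hfin, hcz⟩ := cz_of hn hK hom hev hc h0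
  have hex : ∀ x ∈ Ω, ∃ η > 0, closedBall x η ⊆ Ω := fun x hx =>
    nhds_basis_closedBall.mem_iff.1 (hΩo.mem_nhds hx)
  have hev' : ∀ x η η', 0 < η → 0 < η' → closedBall x η ⊆ Ω → closedBall x η' ⊆ Ω →
      pv K Ω x η = pv K Ω x η' := by
    intro x η η' h1 h2 h3 h4
    rcases le_total η η' with h | h
    · exact hcz.pv_eq x hΩo.measurableSet fΩ h1 h h4
    · exact (hcz.pv_eq x hΩo.measurableSet fΩ h2 h h3).symm
  classical
  let g : En n → ℝ := fun x => if h : ∃ η > 0, closedBall x η ⊆ Ω then pv K Ω x h.choose else 0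
  have hg : IsPV K Ω g := by
    intro x η hη hsub
    have h : ∃ η > 0, closedBall x η ⊆ Ω := ⟨η, hη, hsub⟩
    simp only [g, dif_pos h]
    exact hev' x _ _ h.choose_spec.1 hη h.choose_spec.2 hsub
  refine ⟨g, ?_, ?_⟩
  · intro x hx
    obtain ⟨η, hη, hsub⟩ := hex x hx
    refine tendsto_const_nhds.congr' ?_
    filter_upwards [Ioc_mem_nhdsGT hη] with δ hδ
    exact hg x δ hδ.1 ((closedBall_subset_closedBall hδ.2).trans hsub)
  · intro x hx y hy
    have h1 := hC K _ g hcz hg x hx y hy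
    rw [← dist_eq_norm] at h1
    calc ENNReal.ofReal |g x - g y| ≤ ENNReal.ofReal (C * (czConst n K).toReal * dist x y ^ ε) :=
          ENNReal.ofReal_le_ofReal h1
      _ = ENNReal.ofReal C * czConst n K * ENNReal.ofReal (dist x y ^ ε) := by
          rw [ENNReal.ofReal_mul (by positivity), ENNReal.ofReal_mul hC0, ENNReal.ofReal_toReal hfin.ne]
      _ ≤ _ := by
          gcongr
          rw [ENNReal.ofReal, ENNReal.coe_le_coe]
          exact le_self_add

end
end
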